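/- Assume m + p = 2 (so that the assumption on σ reads σ > 2). Then for every ξ0 ∈ (0, ξ_max], the profile equation (SSODE) admits at least one good profile with interface whose interface point is exactly ξ0. -/

import Mathlib

open Real Filter Set Topology

noncomputable def alphaC (m p σ : ℝ) : ℝ := (σ + 2) / (σ * (m - 1) + 2 * (p - 1))

noncomputable def betaC (m p σ : ℝ) : ℝ := (m - p) / (σ * (m - 1) + 2 * (p - 1))

/-- The self-similar profile ODE (SSODE) at the point `ξ`. -/
def SSODE (N : ℕ) (m p σ : ℝ) (f : ℝ → ℝ) (ξ : ℝ) : Prop :=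
  deriv (deriv fun x => f x ^ m) ξ + ((N : ℝ) - 1) / ξ * deriv (fun x => f x ^ m) ξ
    - alphaC m p σ * f ξ + betaC m p σ * ξ * deriv f ξ + ξ ^ σ * f ξ ^ p = 0

/-- `f` is a profile with interface at `ξ0`. -/
def ProfileWithInterface (N : ℕ) (m p σ : ℝ) (f : ℝ → ℝ) (ξ0 : ℝ) : Prop :=
  0 < ξ0 ∧
  ContinuousOn f (Icc 0 ξ0) ∧
  (∀ ξ ∈ Ioo 0 ξ0, 0 < f ξ) ∧
  ContDiffOn ℝ 2 f (Ioo 0 ξ0) ∧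
  (∀ ξ ∈ Ioo 0 ξ0, SSODE N m p σ f ξ) ∧
  f ξ0 = 0 ∧
  Tendsto (fun ξ => deriv (fun x => f x ^ m) ξ) (𝓝[<] ξ0) (𝓝 0)

/-- Interface of Type I: `f(ξ) ~ (ξ0 - ξ)^(1/(m-1))` as `ξ → ξ0⁻`. -/
def TypeI (m : ℝ) (f : ℝ → ℝ) (ξ0 : ℝ) : Prop :=
  ∃ c, 0 < c ∧ Tendsto (fun ξ => f ξ * (ξ0 - ξ) ^ (-(1 / (m - 1)))) (𝓝[<] ξ0) (𝓝 c)

/-- Interface of Type II: `f(ξ) ~ (ξ0 - ξ)^(1/(1-p))` as `ξ → ξ0⁻`. -/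
def TypeII (p : ℝ) (f : ℝ → ℝ) (ξ0 : ℝ) : Prop :=
  ∃ c, 0 < c ∧ Tendsto (fun ξ => f ξ * (ξ0 - ξ) ^ (-(1 / (1 - p)))) (𝓝[<] ξ0) (𝓝 c)

/-- Behavior (B1) at the origin. -/
def BehB1 (N : ℕ) (m p σ : ℝ) (f : ℝ → ℝ) : Prop :=
  0 < f 0 ∧ Tendsto (fun ξ => (f ξ ^ (m - 1) - f 0 ^ (m - 1)) / ξ ^ 2)
    (𝓝[>] 0) (𝓝 (alphaC m p σ * (m - 1) / (2 * m * (N : ℝ))))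

/-- Behavior (B2) at the origin. -/
def BehB2 (N : ℕ) (m : ℝ) (f : ℝ → ℝ) : Prop :=
  f 0 = 0 ∧ Tendsto (fun ξ => f ξ * ξ ^ (-(2 / (m - 1)))) (𝓝[>] 0)
    (𝓝 (((m - 1) / (2 * m * (m * (N : ℝ) - (N : ℝ) + 2))) ^ (1 / (m - 1))))

/-- Behavior (B3) at the origin. -/
def BehB3 (m p σ : ℝ) (f : ℝ → ℝ) : Prop :=
  f 0 = 0 ∧ ∃ K, 0 < K ∧
    Tendsto (fun ξ => f ξ * ξ ^ (-((σ + 2) / (m - p)))) (𝓝[>] 0) (𝓝 K)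

/-- A good profile with interface at `ξ0`. -/
def GoodProfile (N : ℕ) (m p σ : ℝ) (f : ℝ → ℝ) (ξ0 : ℝ) : Prop :=
  ProfileWithInterface N m p σ f ξ0 ∧
  (BehB1 N m p σ f ∨ BehB2 N m f ∨ BehB3 m p σ f)

noncomputable def xiMax (m p σ : ℝ) : ℝ := (betaC m p σ ^ 2 / (4 * m)) ^ (1 / (σ - 2))


def VNice (V : ℝ → ℝ × ℝ → ℝ × ℝ) (a b : ℝ) : Prop :=
  ∃ K L : NNReal, (∀ t ∈ Icc a b, LipschitzWith K (V t)) ∧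
    (∀ t ∈ Icc a b, ∀ x, ‖V t x‖ ≤ L) ∧ ∀ x, ContinuousOn (fun t => V t x) (Icc a b)

def SolOn (V : ℝ → ℝ × ℝ → ℝ × ℝ) (X : ℝ → ℝ × ℝ) (a b : ℝ) : Prop :=
  ∀ t ∈ Icc a b, HasDerivWithinAt X (V t (X t)) (Icc a b) t

lemma SolOn.mono {V : ℝ → ℝ × ℝ → ℝ × ℝ} {X : ℝ → ℝ × ℝ} {a b a' b' : ℝ}
    (h : SolOn V X a b) (ha : a ≤ a') (hb : b' ≤ b) : SolOn V X a' b' := by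
  intro t ht
  exact (h t ⟨ha.trans ht.1, ht.2.trans hb⟩).mono (Icc_subset_Icc ha hb)

lemma flow_exists (V : ℝ → ℝ × ℝ → ℝ × ℝ) (a c b : ℝ) (hac : a ≤ c) (hcb : c ≤ b)
    (hV : VNice V a b) (R : NNReal) :
    ∃ α : ℝ × ℝ → ℝ → ℝ × ℝ, (∀ x ∈ Metric.closedBall (0 : ℝ × ℝ) R,
      α x c = x ∧ SolOn V (α x) a b) ∧
      ∀ t ∈ Icc a b, ContinuousOn (fun x => α x t) (Metric.closedBall (0 : ℝ × ℝ) R) := by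
  obtain ⟨K, L, hK, hL, hc⟩ := hV
  have hmax : 0 ≤ max (b - c) (c - a) := le_max_of_le_left (by linarith)
  obtain ⟨M, hM⟩ : ∃ M : NNReal, (M : ℝ) = max (b - c) (c - a) :=
    ⟨Real.toNNReal _, Real.coe_toNNReal _ hmax⟩
  have hPL : IsPicardLindelof V (tmin := a) (tmax := b) ⟨c, hac, hcb⟩ (0 : ℝ × ℝ)
      (L * M + R) R L K :=
    { lipschitzOnWith := fun t ht => (hK t ht).lipschitzOnWith
      continuousOn := fun x _ => hc x
      norm_le := fun t ht x _ => hL t ht x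
      mul_max_le := by
        show (L : ℝ) * max (b - c) (c - a) ≤ _
        rw [← hM]
        push_cast
        linarith }
  obtain ⟨α, h1, L', h2⟩ := hPL.exists_forall_mem_closedBall_eq_hasDerivWithinAt_lipschitzOnWith
  exact ⟨α, fun x hx => h1 x hx, fun t ht => (h2 t ht).continuousOn⟩

lemma sol_unique (V : ℝ → ℝ × ℝ → ℝ × ℝ) (a c b : ℝ) (hac : a < c) (hcb : c < b)
    (hV : VNice V a b) (X Y : ℝ → ℝ × ℝ) (hX : SolOn V X a b) (hY : SolOn V Y a b)
    (h : X c = Y c) : EqOn X Y (Icc a b) := by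
  obtain ⟨K, L, hK, hL, hc⟩ := hV
  refine ODE_solution_unique_of_mem_Icc (v := V) (K := K) (s := fun _ => univ) (t₀ := c)
    (fun t ht => (hK t (Ioo_subset_Icc_self ht)).lipschitzOnWith) ⟨hac, hcb⟩
    (fun t ht => (hX t ht).continuousWithinAt)
    (fun t ht => (hX t (Ioo_subset_Icc_self ht)).hasDerivAt (Icc_mem_nhds ht.1 ht.2))
    (fun _ _ => trivial) (fun t ht => (hY t ht).continuousWithinAt)
    (fun t ht => (hY t (Ioo_subset_Icc_self ht)).hasDerivAt (Icc_mem_nhds ht.1 ht.2))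
    (fun _ _ => trivial) h

lemma limit_sol (V : ℝ → ℝ × ℝ → ℝ × ℝ) (c ξ0 : ℝ) (hc : 0 < c) (hcξ : c < ξ0)
    (hV : ∀ a b, 0 < a → b < ξ0 → VNice V a b) (C : ℝ → Set (ℝ × ℝ))
    (hC : ∀ t ∈ Ioo 0 ξ0, IsClosed (C t)) (hCb : Bornology.IsBounded (C c))
    (hsol : ∀ a b, 0 < a → a < c → c < b → b < ξ0 → ∃ X, SolOn V X a b ∧ ∀ t ∈ Icc a b, X t ∈ C t) :
    ∃ X : ℝ → ℝ × ℝ, ∀ t ∈ Ioo 0 ξ0, HasDerivAt X (V t (X t)) t ∧ X t ∈ C t := by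
  obtain ⟨R0, hR0⟩ := hCb.subset_closedBall (0 : ℝ × ℝ)
  let R : NNReal := ⟨max R0 0, le_max_right _ _⟩
  have hR : C c ⊆ Metric.closedBall (0 : ℝ × ℝ) R :=
    hR0.trans (Metric.closedBall_subset_closedBall (le_max_left _ _))
  let a : ℕ → ℝ := fun n => c / (n + 2)
  let b : ℕ → ℝ := fun n => ξ0 - (ξ0 - c) / (n + 2)
  have hn2 : ∀ n : ℕ, (0 : ℝ) < n + 2 := fun n => by positivity
  have ha0 : ∀ n, 0 < a n := fun n => div_pos hc (hn2 n)
  have hac : ∀ n, a n < c := fun n => by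
    simp only [a]; rw [div_lt_iff₀ (hn2 n)]
    have : (0 : ℝ) ≤ n := Nat.cast_nonneg n
    nlinarith
  have hbξ : ∀ n, b n < ξ0 := fun n => by
    have : 0 < (ξ0 - c) / (n + 2) := div_pos (by linarith) (hn2 n)
    simp only [b]; linarith
  have hcb : ∀ n, c < b n := fun n => by
    have : (ξ0 - c) / (n + 2) < ξ0 - c := by
      rw [div_lt_iff₀ (hn2 n)]
      have : (0 : ℝ) ≤ n := Nat.cast_nonneg n
      nlinarith
    simp only [b]; linarith
  have hamono : Antitone a := by
    intro i j hij
    simp only [a]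
    have : (i : ℝ) ≤ j := by exact_mod_cast hij
    gcongr
  have hbmono : Monotone b := by
    intro i j hij
    simp only [b]
    have : (i : ℝ) ≤ j := by exact_mod_cast hij
    have h0 : 0 ≤ ξ0 - c := by linarith
    gcongr
  have hsub : ∀ n, Icc (a n) (b n) ⊆ Ioo 0 ξ0 := fun n t ht =>
    ⟨(ha0 n).trans_le ht.1, ht.2.trans_lt (hbξ n)⟩
  let S : ℕ → Set (ℝ × ℝ) := fun n =>
    {z | ∃ X, SolOn V X (a n) (b n) ∧ (∀ t ∈ Icc (a n) (b n), X t ∈ C t) ∧ X c = z}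
  have hSR : ∀ n, S n ⊆ Metric.closedBall (0 : ℝ × ℝ) R := by
    rintro n z ⟨X, -, hX, rfl⟩
    exact hR (hX c ⟨(hac n).le, (hcb n).le⟩)
  have hScl : ∀ n, IsClosed (S n) := by
    intro n
    obtain ⟨α, hα1, hα2⟩ := flow_exists V (a n) c (b n) (hac n).le (hcb n).le
      (hV _ _ (ha0 n) (hbξ n)) R
    have : S n = Metric.closedBall (0 : ℝ × ℝ) R ∩
        ⋂ t ∈ Icc (a n) (b n), (Metric.closedBall (0 : ℝ × ℝ) R ∩ (fun x => α x t) ⁻¹' C t) := by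
      ext z
      constructor
      · intro hz
        have hzR := hSR n hz
        obtain ⟨X, hX1, hX2, hX3⟩ := hz
        refine ⟨hzR, mem_iInter₂.2 fun t ht => ⟨hzR, ?_⟩⟩
        have := sol_unique V (a n) c (b n) (hac n) (hcb n) (hV _ _ (ha0 n) (hbξ n)) X (α z)
          hX1 (hα1 z hzR).2 (by rw [hX3, (hα1 z hzR).1])
        show α z t ∈ C t
        rw [← this ht]
        exact hX2 t ht
      · rintro ⟨hzR, hz⟩
        refine ⟨α z, (hα1 z hzR).2, fun t ht => ?_, (hα1 z hzR).1⟩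
        exact ((mem_iInter₂.1 hz) t ht).2
    rw [this]
    refine Metric.isClosed_closedBall.inter (isClosed_biInter fun t ht => ?_)
    exact (hα2 t ht).preimage_isClosed_of_isClosed Metric.isClosed_closedBall
      (hC t (hsub n ht))
  have hne : (⋂ n, S n).Nonempty := by
    refine IsCompact.nonempty_iInter_of_sequence_nonempty_isCompact_isClosed S ?_ ?_ ?_ hScl
    · rintro n z ⟨X, h1, h2, h3⟩
      have e1 := hamono (Nat.le_succ n)
      have e2 := hbmono (Nat.le_succ n)
      exact ⟨X, h1.mono e1 e2, fun t ht => h2 t ⟨e1.trans ht.1, ht.2.trans e2⟩, h3⟩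
    · intro n
      obtain ⟨X, h1, h2⟩ := hsol (a n) (b n) (ha0 n) (hac n) (hcb n) (hbξ n)
      exact ⟨X c, X, h1, h2, rfl⟩
    · exact (isCompact_closedBall (0 : ℝ × ℝ) R).of_isClosed_subset (hScl 0) (hSR 0)
  obtain ⟨z, hz⟩ := hne
  have hz' : ∀ n, z ∈ S n := fun n => mem_iInter.1 hz n
  choose X hX1 hX2 hX3 using hz'
  have hagree : ∀ i j, i ≤ j → EqOn (X i) (X j) (Icc (a i) (b i)) := by
    intro i j hij
    exact sol_unique V (a i) c (b i) (hac i) (hcb i) (hV _ _ (ha0 i) (hbξ i)) _ _ (hX1 i)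
      ((hX1 j).mono (hamono hij) (hbmono hij)) (by rw [hX3, hX3])
  have hex : ∀ t, ∃ n, t ∈ Ioo 0 ξ0 → t ∈ Ioo (a n) (b n) := by
    intro t
    by_cases ht : t ∈ Ioo 0 ξ0
    · obtain ⟨n1, h1⟩ := exists_nat_gt (c / t)
      obtain ⟨n2, h2⟩ := exists_nat_gt ((ξ0 - c) / (ξ0 - t))
      have h3 : 0 < ξ0 - t := by linarith [ht.2]
      refine ⟨max n1 n2, fun _ => ⟨?_, ?_⟩⟩
      · have : (n1 : ℝ) ≤ (max n1 n2 : ℕ) := by exact_mod_cast le_max_left _ _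
        simp only [a]
        rw [div_lt_iff₀ (hn2 _)]
        rw [div_lt_iff₀ ht.1] at h1
        nlinarith [ht.1]
      · have : (n2 : ℝ) ≤ (max n1 n2 : ℕ) := by exact_mod_cast le_max_right _ _
        simp only [b]
        rw [div_lt_iff₀ h3] at h2
        have : (ξ0 - c) / ((max n1 n2 : ℕ) + 2) < ξ0 - t := by
          rw [div_lt_iff₀ (hn2 _)]
          nlinarith
        linarith
    · exact ⟨0, fun h => absurd h ht⟩
  choose ν hν using hex
  refine ⟨fun t => X (ν t) t, fun t ht => ?_⟩
  have hkey : ∀ s ∈ Ioo (a (ν t)) (b (ν t)), X (ν s) s = X (ν t) s := by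
    intro s hs
    have hs0 : s ∈ Ioo 0 ξ0 := hsub _ (Ioo_subset_Icc_self hs)
    rcases le_total (ν s) (ν t) with h | h
    · exact hagree _ _ h (Ioo_subset_Icc_self (hν s hs0))
    · exact (hagree _ _ h (Ioo_subset_Icc_self hs)).symm
  have htI := hν t ht
  refine ⟨?_, hX2 _ t (Ioo_subset_Icc_self htI)⟩
  have := (hX1 (ν t) t (Ioo_subset_Icc_self htI)).hasDerivAt (Icc_mem_nhds htI.1 htI.2)
  refine this.congr_of_eventuallyEq ?_
  filter_upwards [Ioo_mem_nhds htI.1 htI.2] with s hs using hkey s hs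

lemma up_escape (D G D' G' : ℝ → ℝ) (a b : ℝ) (hab : a < b)
    (hD : ∀ x ∈ Icc a b, HasDerivWithinAt D (D' x) (Icc a b) x)
    (hG : ∀ x ∈ Icc a b, HasDerivWithinAt G (G' x) (Icc a b) x)
    (h1 : ∀ x ∈ Icc a b, 0 ≤ D x → 0 < G x → 0 < D' x)
    (h2 : ∀ x ∈ Icc a b, 0 ≤ D x → 0 ≤ G' x)
    (hDa : 0 ≤ D a) (hGa : 0 < G a) : 0 < D b := by
  have hDc : ContinuousOn D (Icc a b) := fun x hx => (hD x hx).continuousWithinAt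
  have hGc : ContinuousOn G (Icc a b) := fun x hx => (hG x hx).continuousWithinAt
  have haI : a ∈ Icc a b := left_mem_Icc.2 hab.le
  -- positivity right after `a`
  have hpos : ∀ᶠ x in 𝓝[>] a, 0 < D x := by
    have hd := h1 a haI hDa hGa
    have h3 : HasDerivWithinAt D (D' a) (Ioi a) a := by
      have := (hD a haI).mono (Ioc_subset_Icc_self)
      exact this.mono_of_mem_nhdsWithin (Ioc_mem_nhdsGT hab)
    have h4 := (hasDerivWithinAt_iff_tendsto_slope' (by simp)).1 h3
    have h5 := h4.eventually (lt_mem_nhds hd)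
    filter_upwards [h5, self_mem_nhdsWithin] with x hx hxa
    rw [slope_def_field] at hx
    have hxa' : 0 < x - a := sub_pos.2 hxa
    have := (div_pos_iff_of_pos_right hxa').1 hx
    linarith
  by_contra hcon
  obtain ⟨e, hea, he⟩ := (mem_nhdsGT_iff_exists_Ioo_subset).1 hpos
  have heb : e ≤ b := by
    by_contra h
    push Not at h
    exact hcon (he ⟨hab, h⟩)
  have hea' : a < e := hea
  let S := {x ∈ Icc e b | D x ≤ 0}
  have hSsub : S ⊆ Icc e b := fun x hx => hx.1
  have hDe : ContinuousOn D (Icc e b) := hDc.mono (Icc_subset_Icc_left hea'.le)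
  have hScomp : IsCompact S :=
    isCompact_Icc.of_isClosed_subset (hDe.preimage_isClosed_of_isClosed isClosed_Icc isClosed_Iic) hSsub
  have hSne : S.Nonempty := ⟨b, ⟨heb, le_rfl⟩, not_lt.1 hcon⟩
  obtain ⟨x1, hx1S, hx1min⟩ := hScomp.exists_isLeast hSne
  have hx1 : x1 ∈ Icc e b := hx1S.1
  have hax1 : a < x1 := hea'.trans_le hx1.1
  have hDpos : ∀ x ∈ Ioo a x1, 0 < D x := by
    intro x hx
    rcases lt_or_ge x e with h | h
    · exact he ⟨hx.1, h⟩
    · by_contra hD0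
      exact absurd (hx1min ⟨⟨h, hx.2.le.trans hx1.2⟩, not_lt.1 hD0⟩) (not_le.2 hx.2)
  have hsub : Icc a x1 ⊆ Icc a b := Icc_subset_Icc_right hx1.2
  have hderD : ∀ x ∈ Ioo a x1, HasDerivAt D (D' x) x := fun x hx =>
    (hD x ⟨hx.1.le, hx.2.le.trans hx1.2⟩).hasDerivAt (Icc_mem_nhds hx.1 (hx.2.trans_le hx1.2))
  have hderG : ∀ x ∈ Ioo a x1, HasDerivAt G (G' x) x := fun x hx =>
    (hG x ⟨hx.1.le, hx.2.le.trans hx1.2⟩).hasDerivAt (Icc_mem_nhds hx.1 (hx.2.trans_le hx1.2))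
  have hGmono : MonotoneOn G (Icc a x1) := by
    refine monotoneOn_of_deriv_nonneg (convex_Icc _ _) (hGc.mono hsub) ?_ ?_
    · intro x hx
      rw [interior_Icc] at hx
      exact (hderG x hx).differentiableAt.differentiableWithinAt
    · intro x hx
      rw [interior_Icc] at hx
      rw [(hderG x hx).deriv]
      exact h2 x (hsub (Ioo_subset_Icc_self hx)) (hDpos x hx).le
  have hDmono : StrictMonoOn D (Icc a x1) := by
    refine strictMonoOn_of_deriv_pos (convex_Icc _ _) (hDc.mono hsub) ?_
    intro x hx
    rw [interior_Icc] at hx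
    rw [(hderD x hx).deriv]
    refine h1 x (hsub (Ioo_subset_Icc_self hx)) (hDpos x hx).le ?_
    exact hGa.trans_le (hGmono (left_mem_Icc.2 hax1.le) (Ioo_subset_Icc_self hx) hx.1.le)
  have := hDmono (left_mem_Icc.2 hax1.le) (right_mem_Icc.2 hax1.le) hax1
  have h0 : D x1 ≤ 0 := hx1S.2
  linarith

lemma no_cross (D G D' G' : ℝ → ℝ) (a b : ℝ)
    (hD : ∀ x ∈ Icc a b, HasDerivWithinAt D (D' x) (Icc a b) x)
    (hG : ∀ x ∈ Icc a b, HasDerivWithinAt G (G' x) (Icc a b) x)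
    (h1 : ∀ x ∈ Icc a b, 0 ≤ D x → (0 < D' x ↔ 0 < G x))
    (h2 : ∀ x ∈ Icc a b, 0 ≤ D x → 0 ≤ G' x)
    (hDa : D a ≤ 0) (hDb : D b ≤ 0) : ∀ x ∈ Icc a b, D x ≤ 0 := by
  intro x1 hx1
  by_contra hcon
  push Not at hcon
  have hDc : ContinuousOn D (Icc a b) := fun x hx => (hD x hx).continuousWithinAt
  let S := {x ∈ Icc a x1 | D x ≤ 0}
  have hsub : Icc a x1 ⊆ Icc a b := Icc_subset_Icc_right hx1.2
  have hSsub : S ⊆ Icc a x1 := fun x hx => hx.1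
  have hScomp : IsCompact S :=
    isCompact_Icc.of_isClosed_subset
      ((hDc.mono hsub).preimage_isClosed_of_isClosed isClosed_Icc isClosed_Iic) hSsub
  obtain ⟨l, hlS, hlmax⟩ := hScomp.exists_isGreatest ⟨a, ⟨le_rfl, hx1.1⟩, hDa⟩
  have hl0 : D l ≤ 0 := hlS.2
  have hl : l ∈ Icc a x1 := hlS.1
  have hlx : l < x1 := lt_of_le_of_ne hl.2 (fun h => by rw [h] at hl0; linarith)
  obtain ⟨y, hy, hyd⟩ := exists_hasDerivAt_eq_slope D D' hlx
    (hDc.mono (Icc_subset_Icc hl.1 hx1.2)) (fun x hx =>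
      (hD x ⟨hl.1.trans hx.1.le, hx.2.le.trans hx1.2⟩).hasDerivAt
        (Icc_mem_nhds (hl.1.trans_lt hx.1) (hx.2.trans_le hx1.2)))
  have hyD : 0 < D y := by
    by_contra h
    exact absurd (hlmax ⟨⟨hl.1.trans hy.1.le, hy.2.le⟩, not_lt.1 h⟩) (not_le.2 hy.1)
  have hyI : y ∈ Icc a b := ⟨hl.1.trans hy.1.le, hy.2.le.trans hx1.2⟩
  have hyd' : 0 < D' y := by
    rw [hyd]; exact div_pos (by linarith) (by linarith)
  have hyG := (h1 y hyI hyD.le).1 hyd'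
  have hss : Icc y b ⊆ Icc a b := Icc_subset_Icc_left hyI.1
  have := up_escape D G D' G' y b (hy.2.trans_le hx1.2) (fun x hx => (hD x (hss hx)).mono hss)
    (fun x hx => (hG x (hss hx)).mono hss) (fun x hx h => (h1 x (hss hx) h).2)
    (fun x hx h => h2 x (hss hx) h) hyD.le hyG
  linarith

lemma shoot (V : ℝ → ℝ × ℝ → ℝ × ℝ) (a b : ℝ) (hab : a < b) (hV : VNice V a b)
    (lo up Flo Fup lo' up' Flo' Fup' γ : ℝ → ℝ)
    (dlo : ∀ t ∈ Icc a b, HasDerivAt lo (lo' t) t)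
    (dup : ∀ t ∈ Icc a b, HasDerivAt up (up' t) t)
    (dFlo : ∀ t ∈ Icc a b, HasDerivAt Flo (Flo' t) t)
    (dFup : ∀ t ∈ Icc a b, HasDerivAt Fup (Fup' t) t)
    (hup1 : ∀ t ∈ Icc a b, ∀ x F, up t ≤ x → (up' t < (V t (x, F)).1 ↔ Fup t < F))
    (hup2 : ∀ t ∈ Icc a b, ∀ x F, up t ≤ x → Fup' t ≤ (V t (x, F)).2)
    (hlo1 : ∀ t ∈ Icc a b, ∀ x F, x ≤ lo t → ((V t (x, F)).1 < lo' t ↔ F < Flo t))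
    (hlo2 : ∀ t ∈ Icc a b, ∀ x F, x ≤ lo t → (V t (x, F)).2 ≤ Flo' t)
    (hlu : ∀ t ∈ Icc a b, lo t ≤ up t)
    (hγ : ContinuousOn γ (Icc (lo a) (up a))) (hγu : Fup a < γ (up a)) (hγl : γ (lo a) < Flo a) :
    ∃ X, SolOn V X a b ∧ (∀ t ∈ Icc a b, lo t ≤ (X t).1 ∧ (X t).1 ≤ up t) ∧
      (X a).2 = γ (X a).1 := by
  have haI : a ∈ Icc a b := left_mem_Icc.2 hab.le
  have hbI : b ∈ Icc a b := right_mem_Icc.2 hab.le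
  have hcurve : ContinuousOn (fun s => (s, γ s)) (Icc (lo a) (up a)) := continuousOn_id.prodMk hγ
  obtain ⟨R0, hR0⟩ := ((isCompact_Icc.image_of_continuousOn hcurve).isBounded).subset_closedBall
    (0 : ℝ × ℝ)
  let R : NNReal := ⟨max R0 0, le_max_right _ _⟩
  have hR : ∀ s ∈ Icc (lo a) (up a), (s, γ s) ∈ Metric.closedBall (0 : ℝ × ℝ) R := fun s hs =>
    Metric.closedBall_subset_closedBall (le_max_left _ _) (hR0 (mem_image_of_mem _ hs))
  obtain ⟨α, hα1, hα2⟩ := flow_exists V a a b le_rfl hab.le hV R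
  have hfst : ∀ s ∈ Icc (lo a) (up a), ∀ t ∈ Icc a b, HasDerivWithinAt (fun t => (α (s, γ s) t).1)
      (V t (α (s, γ s) t)).1 (Icc a b) t := by
    intro s hs t ht
    exact ((hα1 _ (hR s hs)).2 t ht).fst
  have hsnd : ∀ s ∈ Icc (lo a) (up a), ∀ t ∈ Icc a b, HasDerivWithinAt (fun t => (α (s, γ s) t).2)
      (V t (α (s, γ s) t)).2 (Icc a b) t := by
    intro s hs t ht
    exact ((hα1 _ (hR s hs)).2 t ht).snd
  have hluI : lo a ≤ up a := hlu a haI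
  have hcont : ContinuousOn (fun s => (α (s, γ s) b).1) (Icc (lo a) (up a)) :=
    continuous_fst.comp_continuousOn ((hα2 b hbI).comp hcurve hR)
  have htop : up b < (α (up a, γ (up a)) b).1 := by
    have hs : up a ∈ Icc (lo a) (up a) := right_mem_Icc.2 hluI
    have h0 := (hα1 _ (hR _ hs)).1
    have := up_escape (fun t => (α (up a, γ (up a)) t).1 - up t)
      (fun t => (α (up a, γ (up a)) t).2 - Fup t) _ _ a b hab
      (fun x hx => (hfst _ hs x hx).sub (dup x hx).hasDerivWithinAt)
      (fun x hx => (hsnd _ hs x hx).sub (dFup x hx).hasDerivWithinAt)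
      (fun x hx h g => sub_pos.2 ((hup1 x hx _ _ (sub_nonneg.1 h)).2 (sub_pos.1 g)))
      (fun x hx h => sub_nonneg.2 (hup2 x hx _ _ (sub_nonneg.1 h)))
      (by simp only [h0]; simp) (by simp only [h0]; linarith)
    simpa using this
  have hbot : (α (lo a, γ (lo a)) b).1 < lo b := by
    have hs : lo a ∈ Icc (lo a) (up a) := left_mem_Icc.2 hluI
    have h0 := (hα1 _ (hR _ hs)).1
    have := up_escape (fun t => lo t - (α (lo a, γ (lo a)) t).1)
      (fun t => Flo t - (α (lo a, γ (lo a)) t).2) _ _ a b hab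
      (fun x hx => (dlo x hx).hasDerivWithinAt.sub (hfst _ hs x hx))
      (fun x hx => (dFlo x hx).hasDerivWithinAt.sub (hsnd _ hs x hx))
      (fun x hx h g => sub_pos.2 ((hlo1 x hx _ _ (sub_nonneg.1 h)).2 (sub_pos.1 g)))
      (fun x hx h => sub_nonneg.2 (hlo2 x hx _ _ (sub_nonneg.1 h)))
      (by simp only [h0]; simp) (by simp only [h0]; linarith)
    simpa using this
  obtain ⟨s, hs, hsb⟩ : ∃ s ∈ Icc (lo a) (up a), (α (s, γ s) b).1 = up b :=
    intermediate_value_Icc hluI hcont ⟨hbot.le.trans (hlu b hbI), htop.le⟩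
  have h0 := (hα1 _ (hR _ hs)).1
  refine ⟨α (s, γ s), (hα1 _ (hR _ hs)).2, fun t ht => ⟨?_, ?_⟩, by rw [h0]⟩
  · have := no_cross (fun t => lo t - (α (s, γ s) t).1)
      (fun t => Flo t - (α (s, γ s) t).2) _ _ a b
      (fun x hx => (dlo x hx).hasDerivWithinAt.sub (hfst _ hs x hx))
      (fun x hx => (dFlo x hx).hasDerivWithinAt.sub (hsnd _ hs x hx))
      (fun x hx h => by
        rw [sub_pos, sub_pos]; exact (hlo1 x hx _ _ (sub_nonneg.1 h)))
      (fun x hx h => sub_nonneg.2 (hlo2 x hx _ _ (sub_nonneg.1 h)))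
      (by simp only [h0]; linarith [hs.1]) (by simp only [hsb]; linarith [hlu b hbI]) t ht
    simpa using this
  · have := no_cross (fun t => (α (s, γ s) t).1 - up t)
      (fun t => (α (s, γ s) t).2 - Fup t) _ _ a b
      (fun x hx => (hfst _ hs x hx).sub (dup x hx).hasDerivWithinAt)
      (fun x hx => (hsnd _ hs x hx).sub (dFup x hx).hasDerivWithinAt)
      (fun x hx h => by
        rw [sub_pos, sub_pos]; exact (hup1 x hx _ _ (sub_nonneg.1 h)))
      (fun x hx h => sub_nonneg.2 (hup2 x hx _ _ (sub_nonneg.1 h)))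
      (by simp only [h0]; linarith [hs.2]) (by simp only [hsb]; linarith [hlu b hbI]) t ht
    simpa using this

lemma rpow_lip (q l0 : ℝ) (hq0 : 0 ≤ q) (hq : q ≤ 1) (hl : 0 < l0) :
    ∃ K : ℝ, 0 ≤ K ∧ ∀ x y, l0 ≤ x → l0 ≤ y → |x ^ q - y ^ q| ≤ K * |x - y| := by
  refine ⟨q * l0 ^ (q - 1), by positivity, fun x y hx hy => ?_⟩
  have := Convex.norm_image_sub_le_of_norm_hasDerivWithin_le (f := fun x : ℝ => x ^ q)
    (f' := fun x => q * x ^ (q - 1)) (s := Ici l0) (C := q * l0 ^ (q - 1)) (x := y) (y := x)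
    (fun z hz => (Real.hasDerivAt_rpow_const (Or.inl (hl.trans_le hz).ne')).hasDerivWithinAt)
    (fun z hz => by
      have hz0 : 0 < z := hl.trans_le hz
      rw [Real.norm_of_nonneg (by positivity)]
      have : z ^ (q - 1) ≤ l0 ^ (q - 1) := Real.rpow_le_rpow_of_nonpos hl hz (by linarith)
      gcongr) (convex_Ici l0) hy hx
  simpa using this

noncomputable def clampF (lo up : ℝ → ℝ) (t x : ℝ) : ℝ := max (lo t) (min x (up t))

noncomputable def vfield (n : ℕ) (β c σ q s M : ℝ) (lo up : ℝ → ℝ) (t : ℝ) (z : ℝ × ℝ) : ℝ × ℝ :=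
  (max (-M) (min z.2 M) / t ^ n - β * t * clampF lo up t z.1 ^ q,
    t ^ n * (c * clampF lo up t z.1 ^ q - t ^ σ * clampF lo up t z.1 ^ s))

lemma clamp_lip (l u x y : ℝ) : |max l (min x u) - max l (min y u)| ≤ |x - y| := by
  have h1 := abs_max_sub_max_le_max l (min x u) l (min y u)
  have h2 := abs_min_sub_min_le_max x u y u
  rw [sub_self, abs_zero] at h1 h2
  exact h1.trans (max_le (abs_nonneg _) (h2.trans (max_le le_rfl (abs_nonneg _))))

lemma vfield_nice (n : ℕ) (β c σ q s M : ℝ) (lo up : ℝ → ℝ) (a b : ℝ) (ha : 0 < a)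
    (hq0 : 0 ≤ q) (hq : q ≤ 1) (hs0 : 0 ≤ s) (hs : s ≤ 1) (hM : 0 ≤ M)
    (hlo : ContinuousOn lo (Icc a b)) (hup : ContinuousOn up (Icc a b))
    (hpos : ∀ t ∈ Icc a b, 0 < lo t) (hlu : ∀ t ∈ Icc a b, lo t ≤ up t) :
    VNice (vfield n β c σ q s M lo up) a b := by
  obtain ⟨l0, hl0, hl⟩ := isCompact_Icc.exists_forall_le' hlo hpos
  obtain ⟨U, hU⟩ := isCompact_Icc.exists_bound_of_continuousOn hup
  obtain ⟨Kq, hKq0, hKq⟩ := rpow_lip q l0 hq0 hq hl0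
  obtain ⟨Ks, hKs0, hKs⟩ := rpow_lip s l0 hs0 hs hl0
  have htc : ContinuousOn (fun t : ℝ => 1 / t ^ n) (Icc a b) :=
    ContinuousOn.div continuousOn_const (continuousOn_id.pow n)
      (fun t ht => pow_ne_zero _ (ha.trans_le ht.1).ne')
  obtain ⟨A1, hA1⟩ := isCompact_Icc.exists_bound_of_continuousOn htc
  obtain ⟨A2, hA2⟩ := isCompact_Icc.exists_bound_of_continuousOn
    (f := fun t : ℝ => β * t) (s := Icc a b) (by fun_prop)
  obtain ⟨A3, hA3⟩ := isCompact_Icc.exists_bound_of_continuousOn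
    (f := fun t : ℝ => t ^ n * c) (s := Icc a b) (by fun_prop)
  have htσ : ContinuousOn (fun t : ℝ => t ^ n * t ^ σ) (Icc a b) :=
    (continuousOn_id.pow n).mul (continuousOn_id.rpow_const
      (fun t ht => Or.inl (ha.trans_le ht.1).ne'))
  obtain ⟨A4, hA4⟩ := isCompact_Icc.exists_bound_of_continuousOn htσ
  have hT : ∀ t ∈ Icc a b, ∀ x, l0 ≤ clampF lo up t x := fun t ht x =>
    (hl t ht).trans (le_max_left _ _)
  have hTU : ∀ t ∈ Icc a b, ∀ x, clampF lo up t x ≤ |U| := fun t ht x =>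
    max_le ((hlu t ht).trans ((le_abs_self _).trans ((hU t ht).trans (le_abs_self _))))
      ((min_le_right _ _).trans ((le_abs_self _).trans ((hU t ht).trans (le_abs_self _))))
  have hdec : ∀ t (z : ℝ × ℝ), vfield n β c σ q s M lo up t z =
      (max (-M) (min z.2 M) * (1 / t ^ n) - (β * t) * clampF lo up t z.1 ^ q,
        (t ^ n * c) * clampF lo up t z.1 ^ q - (t ^ n * t ^ σ) * clampF lo up t z.1 ^ s) := by
    intro t z
    simp only [vfield]
    congr 1 <;> ring
  have hqp : ∀ t ∈ Icc a b, ∀ x (r : ℝ), 0 ≤ r → |clampF lo up t x ^ r| ≤ |U| ^ r := by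
    intro t ht x r hr
    have h0 : 0 ≤ clampF lo up t x := hl0.le.trans (hT t ht x)
    rw [abs_of_nonneg (Real.rpow_nonneg h0 _)]
    exact Real.rpow_le_rpow h0 (hTU t ht x) hr
  have hMb : ∀ y, |max (-M) (min y M)| ≤ M := fun y =>
    abs_le.2 ⟨le_max_left _ _, max_le (by linarith) (min_le_right _ _)⟩
  simp only [Real.norm_eq_abs] at hA1 hA2 hA3 hA4
  refine ⟨Real.toNNReal (max (|A1| + |A2| * Kq) (|A3| * Kq + |A4| * Ks)),
    Real.toNNReal (max (M * |A1| + |A2| * |U| ^ q) (|A3| * |U| ^ q + |A4| * |U| ^ s)), ?_, ?_, ?_⟩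
  · intro t ht
    refine LipschitzWith.of_dist_le_mul fun x y => ?_
    rw [Real.coe_toNNReal _ (by positivity), hdec, hdec, dist_eq_norm, dist_eq_norm, Prod.mk_sub_mk,
      Prod.norm_mk]
    have hx1 : |x.1 - y.1| ≤ ‖x - y‖ := norm_fst_le (x - y)
    have hx2 : |x.2 - y.2| ≤ ‖x - y‖ := norm_snd_le (x - y)
    have hcl : |clampF lo up t x.1 - clampF lo up t y.1| ≤ ‖x - y‖ := (clamp_lip _ _ _ _).trans hx1
    have e1 : |clampF lo up t x.1 ^ q - clampF lo up t y.1 ^ q| ≤ Kq * ‖x - y‖ :=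
      (hKq _ _ (hT t ht _) (hT t ht _)).trans (by gcongr)
    have e2 : |clampF lo up t x.1 ^ s - clampF lo up t y.1 ^ s| ≤ Ks * ‖x - y‖ :=
      (hKs _ _ (hT t ht _) (hT t ht _)).trans (by gcongr)
    have e3 : |max (-M) (min x.2 M) - max (-M) (min y.2 M)| ≤ ‖x - y‖ :=
      (clamp_lip _ _ _ _).trans hx2
    have b1 := (hA1 t ht).trans (le_abs_self _)
    have b2 := (hA2 t ht).trans (le_abs_self _)
    have b3 := (hA3 t ht).trans (le_abs_self _)
    have b4 := (hA4 t ht).trans (le_abs_self _)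
    have hmul : ∀ u v A B : ℝ, |u| ≤ A → |v| ≤ B → |u * v| ≤ A * B := fun u v A B h1 h2 => by
      rw [abs_mul]; exact mul_le_mul h1 h2 (abs_nonneg _) ((abs_nonneg _).trans h1)
    rw [max_mul_of_nonneg _ _ (norm_nonneg _)]
    refine max_le_max ?_ ?_
    · rw [Real.norm_eq_abs]
      calc _ = |(1 / t ^ n) * (max (-M) (min x.2 M) - max (-M) (min y.2 M)) -
            (β * t) * (clampF lo up t x.1 ^ q - clampF lo up t y.1 ^ q)| := by congr 1; ring
        _ ≤ _ := abs_sub _ _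
        _ ≤ |A1| * ‖x - y‖ + |A2| * (Kq * ‖x - y‖) :=
            add_le_add (hmul _ _ _ _ b1 e3) (hmul _ _ _ _ b2 e1)
        _ = _ := by ring
    · rw [Real.norm_eq_abs]
      calc _ = |(t ^ n * c) * (clampF lo up t x.1 ^ q - clampF lo up t y.1 ^ q) -
            (t ^ n * t ^ σ) * (clampF lo up t x.1 ^ s - clampF lo up t y.1 ^ s)| := by
              congr 1; ring
        _ ≤ _ := abs_sub _ _
        _ ≤ |A3| * (Kq * ‖x - y‖) + |A4| * (Ks * ‖x - y‖) :=
            add_le_add (hmul _ _ _ _ b3 e1) (hmul _ _ _ _ b4 e2)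
        _ = _ := by ring
  · intro t ht z
    have b1 := (hA1 t ht).trans (le_abs_self _)
    have b2 := (hA2 t ht).trans (le_abs_self _)
    have b3 := (hA3 t ht).trans (le_abs_self _)
    have b4 := (hA4 t ht).trans (le_abs_self _)
    have hmul : ∀ u v A B : ℝ, |u| ≤ A → |v| ≤ B → |u * v| ≤ A * B := fun u v A B h1 h2 => by
      rw [abs_mul]; exact mul_le_mul h1 h2 (abs_nonneg _) ((abs_nonneg _).trans h1)
    rw [Real.coe_toNNReal _ (by positivity), hdec, Prod.norm_mk]
    refine max_le_max ?_ ?_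
    · exact (abs_sub _ _).trans (add_le_add (hmul _ _ _ _ (hMb _) b1)
        (hmul _ _ _ _ b2 (hqp t ht _ _ hq0)))
    · exact (abs_sub _ _).trans (add_le_add (hmul _ _ _ _ b3 (hqp t ht _ _ hq0))
        (hmul _ _ _ _ b4 (hqp t ht _ _ hs0)))
  · intro z
    simp only [hdec]
    have hTc : ContinuousOn (fun t => clampF lo up t z.1) (Icc a b) :=
      ContinuousOn.sup hlo (ContinuousOn.inf continuousOn_const hup)
    have hTq : ∀ r : ℝ, ContinuousOn (fun t => clampF lo up t z.1 ^ r) (Icc a b) := fun r =>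
      hTc.rpow_const fun t ht => Or.inl (hl0.trans_le (hT t ht _)).ne'
    refine ContinuousOn.prodMk ?_ ?_
    · exact (continuousOn_const.mul htc).sub ((by fun_prop : ContinuousOn (fun t : ℝ => β * t) _).mul (hTq q))
    · exact ((by fun_prop : ContinuousOn (fun t : ℝ => t ^ n * c) _).mul (hTq q)).sub (htσ.mul (hTq s))

lemma barrier_deriv (n : ℕ) (r β α c σ : ℝ) (hc : c = α + (n + 1) * β)
    (w w1 : ℝ → ℝ) (w2 ξ : ℝ) (hξ : 0 < ξ) (hw : 0 < w ξ) (d1 : HasDerivAt w (w1 ξ) ξ)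
    (d2 : HasDerivAt w1 w2 ξ) :
    HasDerivAt (fun t => w t ^ (r + 1)) ((r + 1) * w ξ ^ r * w1 ξ) ξ ∧
    HasDerivAt (fun t => t ^ n * (w t ^ r * ((r + 1) * w1 t + β * t)))
      (ξ ^ n * (c * w ξ ^ r - ξ ^ σ * w ξ ^ (r - 1)) + ξ ^ n * w ξ ^ (r - 1) *
        (n / ξ * (r + 1) * (w ξ * w1 ξ) + r * (r + 1) * w1 ξ ^ 2 + r * β * ξ * w1 ξ
          + (r + 1) * (w ξ * w2) - α * w ξ + ξ ^ σ)) ξ := by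
  constructor
  · have := d1.rpow_const (p := r + 1) (Or.inl hw.ne')
    convert this using 1
    rw [add_sub_cancel_right]; ring
  · have h1 := d1.rpow_const (p := r) (Or.inl hw.ne')
    have h2 : HasDerivAt (fun t => (r + 1) * w1 t + β * t) ((r + 1) * w2 + β * 1) ξ :=
      (d2.const_mul _).add ((hasDerivAt_id ξ).const_mul β)
    have h3 := (hasDerivAt_pow n ξ).mul (h1.mul h2)
    refine h3.congr_deriv ?_
    have e : w ξ ^ r = w ξ ^ (r - 1) * w ξ := by
      rw [← Real.rpow_add_one hw.ne']; congr 1; ring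
    have e2 : (n : ℝ) * ξ ^ (n - 1) = n / ξ * ξ ^ n := by
      rcases n with _ | n
      · simp
      · simp only [Nat.add_sub_cancel, pow_succ]; field_simp
    simp only [Pi.mul_apply]
    rw [e2, e, hc]
    field_simp
    ring

lemma upper_G (n : ℕ) (r β α σ μ ξ0 ξ : ℝ) (hr : 1 < r) (hβ : 0 < β) (hα : 0 < α)
    (hμ : μ = β / (2 * (r + 1))) (hξ : 0 < ξ) (hξ0 : ξ < ξ0)
    (hb : ξ ^ σ ≤ r * β ^ 2 / (4 * (r + 1)) * ξ ^ 2) :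
    (n / ξ * (r + 1) * ((μ / 2 * (ξ0 ^ 2 - ξ ^ 2)) * (-μ * ξ)) + r * (r + 1) * (-μ * ξ) ^ 2
      + r * β * ξ * (-μ * ξ) + (r + 1) * ((μ / 2 * (ξ0 ^ 2 - ξ ^ 2)) * (-μ))
      - α * (μ / 2 * (ξ0 ^ 2 - ξ ^ 2)) + ξ ^ σ) ≤ 0 := by
  have hμ0 : 0 < μ := by rw [hμ]; positivity
  have hw : 0 < μ / 2 * (ξ0 ^ 2 - ξ ^ 2) := by
    have : 0 < ξ0 ^ 2 - ξ ^ 2 := by nlinarith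
    positivity
  set w := μ / 2 * (ξ0 ^ 2 - ξ ^ 2)
  have e1 : n / ξ * (r + 1) * (w * (-μ * ξ)) = -(n * (r + 1) * w * μ) := by field_simp
  have e2 : r * (r + 1) * (-μ * ξ) ^ 2 + r * β * ξ * (-μ * ξ)
      = - (r * β ^ 2 / (4 * (r + 1)) * ξ ^ 2) := by
    rw [hμ]; field_simp; ring
  have h1 : 0 ≤ n * (r + 1) * w * μ := by positivity
  have h2 : 0 ≤ (r + 1) * (w * μ) := by positivity
  have h3 : 0 ≤ α * w := by positivity
  nlinarith

lemma lower_G (n i : ℕ) (r β α σ ξ0 : ℝ) (hr : 1 < r) (hβ : 0 < β) (hα : 0 < α)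
    (hi : σ ≤ i + 2) (hξ0 : 0 < ξ0) :
    ∃ δ0 > 0, δ0 ≤ 1 ∧ ∀ δ, 0 < δ → δ ≤ δ0 → ∀ ξ, 0 < ξ → ξ < ξ0 →
    0 ≤ (n / ξ * (r + 1) * ((δ * (ξ ^ (i + 2) * (ξ0 - ξ))) *
        (δ * ((i + 2) * ξ0 * ξ ^ (i + 1) - (i + 3) * ξ ^ (i + 2))))
      + r * (r + 1) * (δ * ((i + 2) * ξ0 * ξ ^ (i + 1) - (i + 3) * ξ ^ (i + 2))) ^ 2
      + r * β * ξ * (δ * ((i + 2) * ξ0 * ξ ^ (i + 1) - (i + 3) * ξ ^ (i + 2)))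
      + (r + 1) * ((δ * (ξ ^ (i + 2) * (ξ0 - ξ))) *
        (δ * ((i + 2) * (i + 1) * ξ0 * ξ ^ i - (i + 3) * (i + 2) * ξ ^ (i + 1))))
      - α * (δ * (ξ ^ (i + 2) * (ξ0 - ξ))) + ξ ^ σ) := by
  set C : ℝ := (n * (r + 1) * (i + 3) + (r + 1) * ((i + 3) * (i + 2))) * ξ0 ^ (i + 2)
    + r * β * (i + 3) * ξ0 + α * ξ0 with hC
  have hC0 : 0 < C := by positivity
  set S : ℝ := ξ0 ^ ((i + 2 : ℝ) - σ) with hS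
  have hS0 : 0 < S := Real.rpow_pos_of_pos hξ0 _
  refine ⟨min 1 (1 / (C * S)), by positivity, min_le_left _ _, fun δ hδ hδ' ξ hξ hξξ => ?_⟩
  have hδ1 : δ ≤ 1 := hδ'.trans (min_le_left _ _)
  have hδ2 : δ * (C * S) ≤ 1 := by
    have := hδ'.trans (min_le_right _ _)
    rwa [le_div_iff₀ (by positivity)] at this
  have hpow : ξ ^ (i + 2) ≤ S * ξ ^ σ := by
    have h1 : ξ ^ (i + 2) = ξ ^ ((i + 2 : ℝ) - σ) * ξ ^ σ := by
      rw [← Real.rpow_add hξ, ← Real.rpow_natCast]; congr 1; push_cast; ring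
    rw [h1]
    have : ξ ^ ((i + 2 : ℝ) - σ) ≤ S := Real.rpow_le_rpow hξ.le hξξ.le (by linarith)
    gcongr
  have hσ0 : 0 < ξ ^ σ := Real.rpow_pos_of_pos hξ _
  have hmain : δ * C * ξ ^ (i + 2) ≤ ξ ^ σ := by
    calc δ * C * ξ ^ (i + 2) ≤ δ * C * (S * ξ ^ σ) := by gcongr
      _ = δ * (C * S) * ξ ^ σ := by ring
      _ ≤ 1 * ξ ^ σ := by gcongr
      _ = _ := one_mul _
  set X := ξ ^ (i + 2) with hX
  have hX0 : 0 < X := by positivity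
  set w := δ * (X * (ξ0 - ξ)) with hw
  have hw0 : 0 < w := by have : 0 < ξ0 - ξ := by linarith
                         positivity
  have hwle : w ≤ δ * X * ξ0 := by rw [hw, mul_assoc]; gcongr; linarith
  set w1 := δ * ((i + 2) * ξ0 * ξ ^ (i + 1) - (i + 3) * X) with hw1
  have hw1' : -((i + 3) * X * δ) ≤ w1 := by
    have : 0 ≤ δ * ((i + 2) * ξ0 * ξ ^ (i + 1)) := by positivity
    rw [hw1]; linarith
  have hw2' : -((i + 3) * (i + 2) * ξ ^ (i + 1)) ≤
      δ * ((i + 2) * (i + 1) * ξ0 * ξ ^ i - (i + 3) * (i + 2) * ξ ^ (i + 1)) := by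
    have h1 : 0 ≤ δ * ((i + 2) * (i + 1) * ξ0 * ξ ^ i) := by positivity
    have h2 : δ * ((i + 3) * (i + 2) * ξ ^ (i + 1)) ≤ 1 * ((i + 3) * (i + 2) * ξ ^ (i + 1)) := by
      gcongr
    linarith
  have hY : ξ ^ (i + 1) ≤ ξ0 ^ (i + 1) := by gcongr
  have hXY : X = ξ ^ (i + 1) * ξ := by rw [hX]; ring
  have hξ0p : ξ0 ^ (i + 2) = ξ0 ^ (i + 1) * ξ0 := by ring
  have hwY : w * ξ ^ (i + 1) ≤ δ * X * ξ0 ^ (i + 2) := by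
    calc w * ξ ^ (i + 1) ≤ (δ * X * ξ0) * ξ0 ^ (i + 1) := by gcongr
      _ = _ := by ring
  have t1 : -(n * (r + 1) * (i + 3) * (δ * X * ξ0 ^ (i + 2))) ≤ n / ξ * (r + 1) * (w * w1) := by
    have a1 : n / ξ * (r + 1) * (w * (-((i + 3) * X * δ))) ≤ n / ξ * (r + 1) * (w * w1) := by gcongr
    have a2 : n / ξ * (r + 1) * (w * (-((i + 3) * X * δ)))
        = - (n * (r + 1) * (i + 3) * (δ * (w * ξ ^ (i + 1)))) := by
      rw [hXY]; field_simp
    have a3 : δ * (w * ξ ^ (i + 1)) ≤ δ * X * ξ0 ^ (i + 2) := by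
      refine le_trans ?_ hwY
      exact mul_le_of_le_one_left (by positivity) hδ1
    have a4 : n * (r + 1) * (i + 3) * (δ * (w * ξ ^ (i + 1))) ≤
      n * (r + 1) * (i + 3) * (δ * X * ξ0 ^ (i + 2)) := by gcongr
    linarith
  have t2 : 0 ≤ r * (r + 1) * w1 ^ 2 := by positivity
  have t3 : -(r * β * (i + 3) * ξ0 * (δ * X)) ≤ r * β * ξ * w1 := by
    have a1 : r * β * ξ * (-((i + 3) * X * δ)) ≤ r * β * ξ * w1 := by gcongr
    have a2 : r * β * ξ * ((i + 3) * X * δ) ≤ r * β * ξ0 * ((i + 3) * X * δ) := by gcongr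
    linarith
  have t4 : -((r + 1) * ((i + 3) * (i + 2)) * (δ * X * ξ0 ^ (i + 2))) ≤ (r + 1) * (w *
      (δ * ((i + 2) * (i + 1) * ξ0 * ξ ^ i - (i + 3) * (i + 2) * ξ ^ (i + 1)))) := by
    have a1 : (r + 1) * (w * (-((i + 3) * (i + 2) * ξ ^ (i + 1)))) ≤ (r + 1) * (w *
      (δ * ((i + 2) * (i + 1) * ξ0 * ξ ^ i - (i + 3) * (i + 2) * ξ ^ (i + 1)))) := by gcongr
    have a4 : (r + 1) * ((i + 3) * (i + 2)) * (w * ξ ^ (i + 1)) ≤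
      (r + 1) * ((i + 3) * (i + 2)) * (δ * X * ξ0 ^ (i + 2)) := by gcongr
    linarith
  have t5 : α * w ≤ α * (δ * X * ξ0) := by gcongr
  have : δ * C * X = (n * (r + 1) * (i + 3) * (δ * X * ξ0 ^ (i + 2))) + (r * β * (i + 3) * ξ0 * (δ * X))
    + ((r + 1) * ((i + 3) * (i + 2)) * (δ * X * ξ0 ^ (i + 2))) + α * (δ * X * ξ0) := by
    rw [hC]; ring
  linarith

lemma clampM_gt (M G F : ℝ) (h1 : -M ≤ G) (h2 : G < M) : G < max (-M) (min F M) ↔ G < F := by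
  constructor
  · intro h
    rcases lt_max_iff.1 h with h | h
    · linarith
    · exact h.trans_le (min_le_left _ _)
  · intro h
    exact lt_max_of_lt_right (lt_min h h2)

lemma clampM_lt (M G F : ℝ) (h1 : -M < G) (h2 : G ≤ M) : max (-M) (min F M) < G ↔ F < G := by
  constructor
  · intro h
    rcases min_lt_iff.1 ((le_max_right _ _).trans_lt h) with h | h
    · exact h
    · linarith
  · intro h
    exact max_lt h1 ((min_le_left _ _).trans_lt h)

set_option maxHeartbeats 2000000 in
lemma core_exists (n : ℕ) (r q s σ β α c ξ0 : ℝ) (hr : 1 < r) (hq : (r + 1) * q = r)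
    (hs : (r + 1) * s = r - 1) (hσ : 0 < σ) (hβ : 0 < β) (hα : 0 < α)
    (hc : c = α + (n + 1) * β) (hξ0 : 0 < ξ0)
    (hb : ∀ ξ, 0 < ξ → ξ < ξ0 → ξ ^ σ ≤ r * β ^ 2 / (4 * (r + 1)) * ξ ^ 2) :
    ∃ (Φ F : ℝ → ℝ) (M μ : ℝ), 0 < μ ∧ ∀ ξ ∈ Ioo 0 ξ0,
      HasDerivAt Φ (F ξ / ξ ^ n - β * ξ * Φ ξ ^ q) ξ ∧
      HasDerivAt F (ξ ^ n * (c * Φ ξ ^ q - ξ ^ σ * Φ ξ ^ s)) ξ ∧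
      0 < Φ ξ ∧ Φ ξ ≤ (μ / 2 * (ξ0 ^ 2 - ξ ^ 2)) ^ (r + 1) ∧ |F ξ| ≤ M * ξ ^ (n + 1) := by
  have hr1 : 0 < r + 1 := by linarith
  have hq0 : 0 < q := by by_contra h; push Not at h; nlinarith
  have hq1 : q ≤ 1 := by by_contra h; push Not at h; nlinarith
  have hs0 : 0 < s := by by_contra h; push Not at h; nlinarith
  have hs1 : s ≤ 1 := by by_contra h; push Not at h; nlinarith
  have hc0 : 0 < c := by rw [hc]; positivity
  obtain ⟨i, hi⟩ := exists_nat_ge σ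
  obtain ⟨μ, hμ⟩ : ∃ μ, μ = β / (2 * (r + 1)) := ⟨_, rfl⟩
  have hμ0 : 0 < μ := by rw [hμ]; positivity
  obtain ⟨δ0, hδ0, hδ01, hG⟩ := lower_G n i r β α σ ξ0 hr hβ hα (by linarith) hξ0
  obtain ⟨δ, hδ⟩ : ∃ δ, δ = min δ0 (μ * ξ0 / 2 / ξ0 ^ (i + 2)) := ⟨_, rfl⟩
  have hδp : 0 < δ := by rw [hδ]; positivity
  have hδl : δ ≤ δ0 := by rw [hδ]; exact min_le_left _ _
  have hδ2 : δ * ξ0 ^ (i + 2) ≤ μ * ξ0 / 2 := by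
    rw [← le_div_iff₀ (by positivity), hδ]; exact min_le_right _ _
  obtain ⟨wP, hwP⟩ : ∃ w : ℝ → ℝ, w = fun t => μ / 2 * (ξ0 ^ 2 - t ^ 2) := ⟨_, rfl⟩
  obtain ⟨wP1, hwP1⟩ : ∃ w : ℝ → ℝ, w = fun t => -μ * t := ⟨_, rfl⟩
  obtain ⟨wM, hwM⟩ : ∃ w : ℝ → ℝ, w = fun t => δ * (t ^ (i + 2) * (ξ0 - t)) := ⟨_, rfl⟩
  obtain ⟨wM1, hwM1⟩ : ∃ w : ℝ → ℝ, w = fun t =>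
    δ * ((i + 2) * ξ0 * t ^ (i + 1) - (i + 3) * t ^ (i + 2)) := ⟨_, rfl⟩
  have hwPpos : ∀ t ∈ Ioo 0 ξ0, 0 < wP t := by
    intro t ht
    have : 0 < ξ0 ^ 2 - t ^ 2 := by nlinarith [ht.1, ht.2]
    simp only [hwP]; positivity
  have hwMpos : ∀ t ∈ Ioo 0 ξ0, 0 < wM t := by
    intro t ht
    have h1 : 0 < ξ0 - t := by linarith [ht.2]
    have h2 := ht.1
    simp only [hwM]; positivity
  have hwle : ∀ t ∈ Ioo 0 ξ0, wM t ≤ wP t := by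
    intro t ht
    have h1 : 0 < ξ0 - t := by linarith [ht.2]
    have h2 := ht.1
    have h3 : t ^ (i + 2) ≤ ξ0 ^ (i + 2) := by
      have := ht.2.le
      gcongr
    simp only [hwP, hwM]
    calc δ * (t ^ (i + 2) * (ξ0 - t)) ≤ δ * (ξ0 ^ (i + 2) * (ξ0 - t)) := by gcongr
      _ = δ * ξ0 ^ (i + 2) * (ξ0 - t) := by ring
      _ ≤ μ * ξ0 / 2 * (ξ0 - t) := by gcongr
      _ ≤ _ := by nlinarith [mul_pos hμ0 (mul_pos h1 h2)]
  have dP : ∀ t, HasDerivAt wP (wP1 t) t := by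
    intro t
    simp only [hwP, hwP1]
    refine (((hasDerivAt_const t (ξ0 ^ 2)).sub (hasDerivAt_pow 2 t)).const_mul (μ / 2)).congr_deriv ?_
    push_cast; ring
  have dP1 : ∀ t, HasDerivAt wP1 (-μ) t := by
    intro t
    simp only [hwP1]
    simpa using (hasDerivAt_id t).const_mul (-μ)
  have dM : ∀ t, HasDerivAt wM (wM1 t) t := by
    intro t
    simp only [hwM, hwM1]
    refine (((hasDerivAt_pow (i + 2) t).mul
      ((hasDerivAt_const t ξ0).sub (hasDerivAt_id t))).const_mul δ).congr_deriv ?_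
    simp only [id, Pi.sub_apply, Nat.add_succ_sub_one]
    push_cast; ring
  have dM1 : ∀ t, HasDerivAt wM1 (δ * ((i + 2) * (i + 1) * ξ0 * t ^ i -
      (i + 3) * (i + 2) * t ^ (i + 1))) t := by
    intro t
    simp only [hwM1]
    refine ((((hasDerivAt_pow (i + 1) t).const_mul ((i + 2) * ξ0)).sub
      ((hasDerivAt_pow (i + 2) t).const_mul ((i : ℝ) + 3))).const_mul δ).congr_deriv ?_
    simp only [Nat.add_succ_sub_one]
    push_cast; ring
  obtain ⟨up, hup⟩ : ∃ f : ℝ → ℝ, f = fun t => wP t ^ (r + 1) := ⟨_, rfl⟩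
  obtain ⟨lo, hlo⟩ : ∃ f : ℝ → ℝ, f = fun t => wM t ^ (r + 1) := ⟨_, rfl⟩
  obtain ⟨Fup, hFup⟩ : ∃ f : ℝ → ℝ, f = fun t => t ^ n * (wP t ^ r * ((r + 1) * wP1 t + β * t)) :=
    ⟨_, rfl⟩
  obtain ⟨Flo, hFlo⟩ : ∃ f : ℝ → ℝ, f = fun t => t ^ n * (wM t ^ r * ((r + 1) * wM1 t + β * t)) :=
    ⟨_, rfl⟩
  have cP : Continuous wP := continuous_iff_continuousAt.2 fun t => (dP t).continuousAt
  have cP1 : Continuous wP1 := continuous_iff_continuousAt.2 fun t => (dP1 t).continuousAt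
  have cM : Continuous wM := continuous_iff_continuousAt.2 fun t => (dM t).continuousAt
  have cM1 : Continuous wM1 := continuous_iff_continuousAt.2 fun t => (dM1 t).continuousAt
  have cup : Continuous up := by
    rw [hup]; exact cP.rpow_const fun _ => Or.inr hr1.le
  have clo : Continuous lo := by
    rw [hlo]; exact cM.rpow_const fun _ => Or.inr hr1.le
  have cFup : Continuous Fup := by
    have h1 : Continuous fun t => wP t ^ r := cP.rpow_const fun _ => Or.inr (by linarith)
    rw [hFup]; fun_prop
  have cFlo : Continuous Flo := by
    have h1 : Continuous fun t => wM t ^ r := cM.rpow_const fun _ => Or.inr (by linarith)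
    rw [hFlo]; fun_prop
  obtain ⟨B1, hB1⟩ := (isCompact_Icc (a := 0) (b := ξ0)).exists_bound_of_continuousOn cFup.continuousOn
  obtain ⟨B2, hB2⟩ := (isCompact_Icc (a := 0) (b := ξ0)).exists_bound_of_continuousOn cFlo.continuousOn
  obtain ⟨U, hU⟩ := (isCompact_Icc (a := 0) (b := ξ0)).exists_bound_of_continuousOn cup.continuousOn
  have hupq : ∀ t ∈ Ioo 0 ξ0, up t ^ q = wP t ^ r := by
    intro t ht
    simp only [hup]; rw [← Real.rpow_mul (hwPpos t ht).le, hq]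
  have hups : ∀ t ∈ Ioo 0 ξ0, up t ^ s = wP t ^ (r - 1) := by
    intro t ht
    simp only [hup]; rw [← Real.rpow_mul (hwPpos t ht).le, hs]
  have hloq : ∀ t ∈ Ioo 0 ξ0, lo t ^ q = wM t ^ r := by
    intro t ht
    simp only [hlo]; rw [← Real.rpow_mul (hwMpos t ht).le, hq]
  have hlos : ∀ t ∈ Ioo 0 ξ0, lo t ^ s = wM t ^ (r - 1) := by
    intro t ht
    simp only [hlo]; rw [← Real.rpow_mul (hwMpos t ht).le, hs]
  have hlopos : ∀ t ∈ Ioo 0 ξ0, 0 < lo t := by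
    intro t ht
    simp only [hlo]; exact Real.rpow_pos_of_pos (hwMpos t ht) _
  have hlu : ∀ t ∈ Ioo 0 ξ0, lo t ≤ up t := by
    intro t ht
    simp only [hlo, hup]; exact Real.rpow_le_rpow (hwMpos t ht).le (hwle t ht) hr1.le
  have hupU : ∀ t ∈ Ioo 0 ξ0, up t ≤ |U| := fun t ht =>
    (le_abs_self _).trans ((hU t (Ioo_subset_Icc_self ht)).trans (le_abs_self _))
  -- bound on F
  obtain ⟨D, hD⟩ : ∃ D, D = c * |U| ^ q + ξ0 ^ σ * |U| ^ s + β * |U| ^ q := ⟨_, rfl⟩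
  have hD0 : 0 ≤ D := by rw [hD]; positivity
  obtain ⟨M, hM⟩ : ∃ M, M = D * ξ0 ^ (n + 1) + |B1| + |B2| + 1 := ⟨_, rfl⟩
  have hM0 : 0 ≤ M := by rw [hM]; positivity
  have hDξ : 0 ≤ D * ξ0 ^ (n + 1) := by positivity
  have hFupM : ∀ t ∈ Ioo 0 ξ0, |Fup t| < M := fun t ht => by
    have := (hB1 t (Ioo_subset_Icc_self ht)).trans (le_abs_self _)
    rw [Real.norm_eq_abs] at this
    have h2 := abs_nonneg B2
    rw [hM]; linarith
  have hFloM : ∀ t ∈ Ioo 0 ξ0, |Flo t| < M := fun t ht => by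
    have := (hB2 t (Ioo_subset_Icc_self ht)).trans (le_abs_self _)
    rw [Real.norm_eq_abs] at this
    have h2 := abs_nonneg B1
    rw [hM]; linarith
  obtain ⟨V, hV⟩ : ∃ V, V = vfield n β c σ q s M lo up := ⟨_, rfl⟩
  have hVn : ∀ a b, 0 < a → b < ξ0 → VNice V a b := by
    intro a b ha hb
    have hsub : ∀ t ∈ Icc a b, t ∈ Ioo 0 ξ0 := fun t ht => ⟨ha.trans_le ht.1, ht.2.trans_lt hb⟩
    rw [hV]
    exact vfield_nice n β c σ q s M lo up a b ha hq0.le hq1 hs0.le hs1 hM0 clo.continuousOn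
      cup.continuousOn (fun t ht => hlopos t (hsub t ht)) (fun t ht => hlu t (hsub t ht))
  obtain ⟨C, hC⟩ : ∃ C : ℝ → Set (ℝ × ℝ), C = fun t => {z | lo t ≤ z.1 ∧ z.1 ≤ up t ∧
    |z.2| ≤ D * t ^ (n + 1)} := ⟨_, rfl⟩
  have hVeq : ∀ t ∈ Ioo 0 ξ0, ∀ z : ℝ × ℝ, lo t ≤ z.1 → z.1 ≤ up t → 
      (V t z).2 = t ^ n * (c * z.1 ^ q - t ^ σ * z.1 ^ s) := by
    intro t ht z h1 h2
    have : clampF lo up t z.1 = z.1 := by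
      rw [clampF, min_eq_left h2, max_eq_right h1]
    rw [hV]; simp only [vfield, this]
  obtain ⟨cc, hcc⟩ : ∃ cc, cc = ξ0 / 2 := ⟨_, rfl⟩
  obtain ⟨X, hX⟩ := limit_sol V cc ξ0 (by linarith) (by linarith) hVn C
    (by
      intro t ht
      rw [hC]
      have h1 : IsClosed {z : ℝ × ℝ | lo t ≤ z.1} := isClosed_le continuous_const continuous_fst
      have h2 : IsClosed {z : ℝ × ℝ | z.1 ≤ up t} := isClosed_le continuous_fst continuous_const
      have h3 : IsClosed {z : ℝ × ℝ | |z.2| ≤ D * t ^ (n + 1)} :=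
        isClosed_le continuous_snd.abs continuous_const
      exact h1.inter (h2.inter h3))
    (by
      refine (Metric.isBounded_Icc ((lo cc, -(D * cc ^ (n + 1))) : ℝ × ℝ)
        (up cc, D * cc ^ (n + 1))).subset ?_
      rw [hC]
      rintro z ⟨h1, h2, h3⟩
      exact ⟨⟨h1, (abs_le.1 h3).1⟩, ⟨h2, (abs_le.1 h3).2⟩⟩)
    (by
      intro a b ha hac hcb hbξ
      have hsub : ∀ t ∈ Icc a b, t ∈ Ioo 0 ξ0 := fun t ht => ⟨ha.trans_le ht.1, ht.2.trans_lt hbξ⟩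
      have haI : a ∈ Icc a b := left_mem_Icc.2 (by linarith)
      have ha0 := hsub a haI
      have hBP := fun t ht => barrier_deriv n r β α c σ hc wP wP1 (-μ) t (hsub t ht).1
        (hwPpos t (hsub t ht)) (dP t) (dP1 t)
      have hBM := fun t ht => barrier_deriv n r β α c σ hc wM wM1 _ t (hsub t ht).1
        (hwMpos t (hsub t ht)) (dM t) (dM1 t)
      obtain ⟨X, hX1, hX2, hX3⟩ := shoot V a b (by linarith) (hVn a b ha hbξ) lo up Flo Fup _ _ _ _
        (fun x => β * a ^ (n + 1) * x ^ q)
        (fun t ht => by rw [hlo]; exact (hBM t ht).1)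
        (fun t ht => by rw [hup]; exact (hBP t ht).1)
        (fun t ht => by rw [hFlo]; exact (hBM t ht).2)
        (fun t ht => by rw [hFup]; exact (hBP t ht).2)
        (by
          intro t ht x F hx
          have ht' := hsub t ht
          have hcl : clampF lo up t x = up t := by
            rw [clampF, min_eq_right hx, max_eq_right (hlu t ht')]
          have h1 : (V t (x, F)).1 = max (-M) (min F M) / t ^ n - β * t * wP t ^ r := by
            rw [hV]; simp only [vfield, hcl, hupq t ht']
          have htn : 0 < t ^ n := pow_pos ht'.1 _
          have h2 : (r + 1) * wP t ^ r * wP1 t = Fup t / t ^ n - β * t * wP t ^ r := by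
            simp only [hFup]; field_simp; ring
          have h3 := abs_lt.1 (hFupM t ht')
          rw [h1, h2, sub_lt_sub_iff_right, div_lt_div_iff_of_pos_right htn]
          exact clampM_gt M _ _ h3.1.le h3.2)
        (by
          intro t ht x F hx
          have ht' := hsub t ht
          have hcl : clampF lo up t x = up t := by
            rw [clampF, min_eq_right hx, max_eq_right (hlu t ht')]
          have h1 : (V t (x, F)).2 = t ^ n * (c * wP t ^ r - t ^ σ * wP t ^ (r - 1)) := by
            rw [hV]; simp only [vfield, hcl, hupq t ht', hups t ht']
          have h2 := upper_G n r β α σ μ ξ0 t hr hβ hα hμ ht'.1 ht'.2 (hb t ht'.1 ht'.2)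
          have h3 : 0 ≤ t ^ n * wP t ^ (r - 1) :=
            mul_nonneg (pow_nonneg ht'.1.le _) (Real.rpow_nonneg (hwPpos t ht').le _)
          rw [h1]
          have h4 := mul_nonpos_of_nonneg_of_nonpos h3 h2
          have e1 : wP t = μ / 2 * (ξ0 ^ 2 - t ^ 2) := by rw [hwP]
          have e2 : wP1 t = -μ * t := by rw [hwP1]
          rw [← e1, ← e2] at h4
          linarith)
        (by
          intro t ht x F hx
          have ht' := hsub t ht
          have hcl : clampF lo up t x = lo t := by
            rw [clampF, min_eq_left (hx.trans (hlu t ht')), max_eq_left hx]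
          have h1 : (V t (x, F)).1 = max (-M) (min F M) / t ^ n - β * t * wM t ^ r := by
            rw [hV]; simp only [vfield, hcl, hloq t ht']
          have htn : 0 < t ^ n := pow_pos ht'.1 _
          have h2 : (r + 1) * wM t ^ r * wM1 t = Flo t / t ^ n - β * t * wM t ^ r := by
            simp only [hFlo]; field_simp; ring
          have h3 := abs_lt.1 (hFloM t ht')
          rw [h1, h2, sub_lt_sub_iff_right, div_lt_div_iff_of_pos_right htn]
          exact clampM_lt M _ _ h3.1 h3.2.le)
        (by
          intro t ht x F hx
          have ht' := hsub t ht
          have hcl : clampF lo up t x = lo t := by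
            rw [clampF, min_eq_left (hx.trans (hlu t ht')), max_eq_left hx]
          have h1 : (V t (x, F)).2 = t ^ n * (c * wM t ^ r - t ^ σ * wM t ^ (r - 1)) := by
            rw [hV]; simp only [vfield, hcl, hloq t ht', hlos t ht']
          have h2 := hG δ hδp hδl t ht'.1 ht'.2
          have h3 : 0 ≤ t ^ n * wM t ^ (r - 1) :=
            mul_nonneg (pow_nonneg ht'.1.le _) (Real.rpow_nonneg (hwMpos t ht').le _)
          rw [h1]
          have h4 := mul_nonneg h3 h2
          have e1 : wM t = δ * (t ^ (i + 2) * (ξ0 - t)) := by rw [hwM]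
          have e2 : wM1 t = δ * ((i + 2) * ξ0 * t ^ (i + 1) - (i + 3) * t ^ (i + 2)) := by rw [hwM1]
          rw [← e1, ← e2] at h4
          linarith)
        (fun t ht => hlu t (hsub t ht))
        (by
          exact continuousOn_const.mul (continuousOn_id.rpow_const fun _ _ => Or.inr hq0.le))
        (by
          have hp := Real.rpow_pos_of_pos (hwPpos a ha0) r
          have e : Fup a = β * a ^ (n + 1) * wP a ^ r / 2 := by
            simp only [hFup, hwP1, hμ]; field_simp; ring
          rw [hupq a ha0, e]
          have : 0 < β * a ^ (n + 1) * wP a ^ r := by positivity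
          linarith)
        (by
          have hp := Real.rpow_pos_of_pos (hwMpos a ha0) r
          have e : Flo a = β * a ^ (n + 1) * wM a ^ r + a ^ n * wM a ^ r * (r + 1) * wM1 a := by
            simp only [hFlo]; ring
          have h1 : 0 < wM1 a := by
            simp only [hwM1]
            have h2 : a ^ (i + 2) = a ^ (i + 1) * a := by ring
            have h3 : 0 < a ^ (i + 1) := by positivity
            have h4 : 0 < (i + 2) * ξ0 - (i + 3) * a := by
              have : (0 : ℝ) ≤ i := Nat.cast_nonneg i
              nlinarith
            have : (i + 2) * ξ0 * a ^ (i + 1) - (i + 3) * a ^ (i + 2)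
              = a ^ (i + 1) * ((i + 2) * ξ0 - (i + 3) * a) := by rw [h2]; ring
            rw [this]; positivity
          rw [hloq a ha0, e]
          have : 0 < a ^ n * wM a ^ r * (r + 1) * wM1 a := by positivity
          linarith)
      refine ⟨X, hX1, ?_⟩
      have hXnn : ∀ t ∈ Icc a b, 0 ≤ (X t).1 := fun t ht =>
        (hlopos t (hsub t ht)).le.trans (hX2 t ht).1
      have hXp : ∀ t ∈ Icc a b, ∀ e : ℝ, 0 ≤ e → (X t).1 ^ e ≤ |U| ^ e := fun t ht e he =>
        Real.rpow_le_rpow (hXnn t ht) ((hX2 t ht).2.trans (hupU t (hsub t ht))) he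
      have hF0 : |(X a).2| ≤ D * a ^ (n + 1) := by
        rw [hX3, abs_of_nonneg (by have := hXnn a haI; positivity), mul_right_comm]
        gcongr
        rw [hD]
        have := hXp a haI q hq0.le
        have h2 : 0 ≤ c * |U| ^ q + ξ0 ^ σ * |U| ^ s := by positivity
        have h3 : β * (X a).1 ^ q ≤ β * |U| ^ q := by gcongr
        linarith
      have hder : ∀ t ∈ Icc a b, |(V t (X t)).2| ≤ D * ((n + 1 : ℕ) * t ^ n) := by
        intro t ht
        have ht' := hsub t ht
        have htp := ht'.1
        rw [hVeq t ht' _ (hX2 t ht).1 (hX2 t ht).2, abs_mul, abs_of_pos (pow_pos ht'.1 n)]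
        have h1 : |c * (X t).1 ^ q - t ^ σ * (X t).1 ^ s| ≤ D := by
          have a0 := hXnn t ht
          have a1 : c * (X t).1 ^ q ≤ c * |U| ^ q := by have := hXp t ht q hq0.le; gcongr
          have a2 : t ^ σ * (X t).1 ^ s ≤ ξ0 ^ σ * |U| ^ s := by
            have h5 := hXp t ht s hs0.le
            have h6 := ht'.2.le
            gcongr
          have a3 : 0 ≤ c * (X t).1 ^ q := by positivity
          have a4 : 0 ≤ t ^ σ * (X t).1 ^ s := by positivity
          have a5 : 0 ≤ β * |U| ^ q := by positivity
          rw [abs_le, hD]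
          constructor <;> linarith
        have h2 : (1 : ℝ) ≤ (n + 1 : ℕ) := by push_cast; linarith [Nat.cast_nonneg (α := ℝ) n]
        have h3 : 0 < t ^ n := pow_pos ht'.1 n
        calc t ^ n * |c * (X t).1 ^ q - t ^ σ * (X t).1 ^ s| ≤ t ^ n * D := by gcongr
          _ = D * (1 * t ^ n) := by ring
          _ ≤ _ := by gcongr
      have hFd : ∀ t ∈ Icc a b, HasDerivWithinAt (fun t => (X t).2) (V t (X t)).2 (Icc a b) t :=
        fun t ht => (hX1 t ht).snd
      have hpd : ∀ t, HasDerivAt (fun t => D * t ^ (n + 1)) (D * ((n + 1 : ℕ) * t ^ n)) t := fun t => by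
        simpa using (hasDerivAt_pow (n + 1) t).const_mul D
      have hnb := image_norm_le_of_norm_deriv_right_le_deriv_boundary (f := fun t => (X t).2)
        (f' := fun t => (V t (X t)).2) (a := a) (b := b) (B := fun t => D * t ^ (n + 1))
        (B' := fun t => D * ((n + 1 : ℕ) * t ^ n)) (fun t ht => (hFd t ht).continuousWithinAt)
        (fun t ht => (hFd t (Ico_subset_Icc_self ht)).mono_of_mem_nhdsWithin
          (Icc_mem_nhdsGE_of_mem ht)) hF0 hpd
        (fun t ht => hder t (Ico_subset_Icc_self ht))
      intro t ht
      rw [hC]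
      exact ⟨(hX2 t ht).1, (hX2 t ht).2, hnb ht⟩)
  refine ⟨fun t => (X t).1, fun t => (X t).2, D, μ, hμ0, fun t ht => ?_⟩
  obtain ⟨h1, h2⟩ := hX t ht
  rw [hC] at h2
  obtain ⟨h3, h4, h5⟩ := h2
  refine ⟨?_, ?_, (hlopos t ht).trans_le h3, ?_, h5⟩
  · have h6 : HasDerivAt (fun t => (X t).1) (V t (X t)).1 t :=
      hasDerivWithinAt_univ.1 (h1.hasDerivWithinAt (s := univ)).fst
    refine h6.congr_deriv ?_
    have hcl : clampF lo up t (X t).1 = (X t).1 := by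
      rw [clampF, min_eq_left h4, max_eq_right h3]
    have h8 := ht.1.le
    have h9 := ht.2.le
    have hb' : |(X t).2| ≤ M := by
      refine h5.trans ?_
      have : D * t ^ (n + 1) ≤ D * ξ0 ^ (n + 1) := by gcongr
      rw [hM]; linarith [abs_nonneg B1, abs_nonneg B2]
    have h7 := abs_le.1 hb'
    rw [hV]; simp only [vfield, hcl, min_eq_left h7.2, max_eq_right h7.1]
  · have h6 : HasDerivAt (fun t => (X t).2) (V t (X t)).2 t :=
      hasDerivWithinAt_univ.1 (h1.hasDerivWithinAt (s := univ)).snd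
    exact h6.congr_deriv (hVeq t ht _ h3 h4)
  · simpa only [hup, hwP] using h4

/-- slow variation from a Lyapunov functional -/
lemma slow_var (φ y Q Q' : ℝ → ℝ) (t0 BQ : ℝ)
    (dφ : ∀ t < t0, HasDerivAt φ (y t) t) (dQ : ∀ t < t0, HasDerivAt Q (Q' t) t)
    (hQ' : ∀ t < t0, Q' t ≤ -(y t) ^ 2) (hQb : ∀ t < t0, |Q t| ≤ BQ) (τ δ : ℝ) (hτ : 0 < τ)
    (hδ : 0 < δ) :
    ∀ᶠ t in atBot, ∀ u ∈ Icc t (t + τ), |φ u - φ t| ≤ δ := by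
  have hanti : ∀ (G G' : ℝ → ℝ), (∀ t < t0, HasDerivAt G (G' t) t) → (∀ t < t0, G' t ≤ 0) →
      ∀ s t, s ≤ t → t < t0 → G t ≤ G s := by
    intro G G' h1 h2 s t hst ht
    have : AntitoneOn G (Iio t0) := by
      refine antitoneOn_of_deriv_nonpos (convex_Iio t0)
        (fun x hx => (h1 x hx).continuousAt.continuousWithinAt) ?_ ?_
      · rw [interior_Iio]; exact fun x hx => (h1 x hx).differentiableAt.differentiableWithinAt
      · rw [interior_Iio]; intro x hx; rw [(h1 x hx).deriv]; exact h2 x hx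
    exact this (hst.trans_lt ht) ht hst
  have hQanti := hanti Q Q' dQ (fun t ht => (hQ' t ht).trans (neg_nonpos.2 (sq_nonneg _)))
  obtain ⟨ε, hε⟩ : ∃ ε, ε = δ / (2 * τ) := ⟨_, rfl⟩
  have hε0 : 0 < ε := by rw [hε]; positivity
  -- Q cauchy
  obtain ⟨S, hS⟩ : ∃ S, IsLUB (Q '' Iio t0) S := by
    refine ⟨_, isLUB_csSup ⟨Q (t0 - 1), mem_image_of_mem _ (by simp)⟩ ⟨BQ, ?_⟩⟩
    rintro _ ⟨t, ht, rfl⟩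
    exact (le_abs_self _).trans (hQb t ht)
  obtain ⟨_, ⟨t1, ht1, rfl⟩, hlt, -⟩ := hS.exists_between (b := S - 2 * ε * δ) (by
    have : 0 < 2 * ε * δ := by positivity
    linarith)
  have ht1' : t1 < t0 := ht1
  filter_upwards [eventually_le_atBot (t1 - τ)] with t ht u hu
  have hu1 : u ≤ t1 := by linarith [hu.2]
  have hu0 : u < t0 := by linarith
  have q1 : Q t1 ≤ Q u := hQanti u t1 hu1 ht1'
  have q2 : Q t ≤ S := hS.1 (mem_image_of_mem _ (show t < t0 by linarith))
  have k1 := hanti (fun t => φ t + Q t / (4 * ε) - ε * t) (fun t => y t + Q' t / (4 * ε) - ε * 1)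
    (fun t ht => ((dφ t ht).add ((dQ t ht).div_const _)).sub ((hasDerivAt_id t).const_mul ε))
    (fun t ht => by
      have h1 : Q' t / (4 * ε) ≤ -(y t) ^ 2 / (4 * ε) := by gcongr; exact hQ' t ht
      have h2 : y t + -(y t) ^ 2 / (4 * ε) - ε * 1 = -(y t - 2 * ε) ^ 2 / (4 * ε) := by
        field_simp; ring
      have h3 : -(y t - 2 * ε) ^ 2 / (4 * ε) ≤ 0 :=
        div_nonpos_of_nonpos_of_nonneg (neg_nonpos.2 (sq_nonneg _)) (by positivity)
      linarith) t u hu.1 hu0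
  have k2 := hanti (fun t => -φ t + Q t / (4 * ε) - ε * t) (fun t => -y t + Q' t / (4 * ε) - ε * 1)
    (fun t ht => ((dφ t ht).neg.add ((dQ t ht).div_const _)).sub ((hasDerivAt_id t).const_mul ε))
    (fun t ht => by
      have h1 : Q' t / (4 * ε) ≤ -(y t) ^ 2 / (4 * ε) := by gcongr; exact hQ' t ht
      have h2 : -y t + -(y t) ^ 2 / (4 * ε) - ε * 1 = -(y t + 2 * ε) ^ 2 / (4 * ε) := by
        field_simp; ring
      have h3 : -(y t + 2 * ε) ^ 2 / (4 * ε) ≤ 0 :=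
        div_nonpos_of_nonpos_of_nonneg (neg_nonpos.2 (sq_nonneg _)) (by positivity)
      linarith) t u hu.1 hu0
  have h5 : Q t / (4 * ε) - Q u / (4 * ε) ≤ δ / 2 := by
    rw [← sub_div, div_le_iff₀ (by positivity)]; nlinarith
  have h6 : ε * u - ε * t ≤ δ / 2 := by
    have : ε * τ = δ / 2 := by rw [hε]; field_simp
    nlinarith [hu.2]
  rw [abs_le]; constructor <;> linarith

lemma avoid_set (φ Ψ : ℝ → ℝ) (R : ℝ → ℝ) (e : ℝ → ℝ) (t0 B BΨ : ℝ)
    (hR : ContinuousOn R (Icc 0 B)) (he : Tendsto e atBot (𝓝 0))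
    (hφ : ∀ t < t0, φ t ∈ Icc 0 B) (dΨ : ∀ t < t0, HasDerivAt Ψ (R (φ t) - e t) t)
    (hΨ : ∀ t < t0, |Ψ t| ≤ BΨ)
    (hslow : ∀ τ δ, 0 < τ → 0 < δ → ∀ᶠ t in atBot, ∀ u ∈ Icc t (t + τ), |φ u - φ t| ≤ δ) :
    Tendsto (fun t => R (φ t)) atBot (𝓝 0) := by
  have hBΨ : 0 ≤ BΨ := (abs_nonneg _).trans (hΨ (t0 - 1) (by linarith))
  have huc : UniformContinuousOn R (Icc 0 B) := isCompact_Icc.uniformContinuousOn_of_continuous hR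
  rw [Metric.uniformContinuousOn_iff] at huc
  rw [Metric.tendsto_nhds]
  intro ε hε
  obtain ⟨δ, hδ, hδR⟩ := huc (ε / 4) (by positivity)
  obtain ⟨τ, hτ⟩ : ∃ τ, τ = (2 * BΨ + 1) / (ε / 2) := ⟨_, rfl⟩
  have hτ0 : 0 < τ := by rw [hτ]; positivity
  have hτε : τ * (ε / 2) = 2 * BΨ + 1 := by rw [hτ]; field_simp
  rw [Metric.tendsto_nhds] at he
  have he' := he (ε / 4) (by positivity)
  obtain ⟨T, hT⟩ := eventually_atBot.1 he'
  filter_upwards [hslow τ (δ / 2) hτ0 (by positivity), eventually_lt_atBot (min t0 T - τ)] with t h1 h2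
  rw [Real.dist_eq, sub_zero]
  by_contra hcon
  push Not at hcon
  have hlt0 : ∀ u ∈ Icc t (t + τ), u < t0 := fun u hu => by
    have := min_le_left t0 T; linarith [hu.2]
  have hltT : ∀ u ∈ Icc t (t + τ), u ≤ T := fun u hu => by
    have := min_le_right t0 T; linarith [hu.2]
  have htI : t ∈ Icc t (t + τ) := ⟨le_rfl, by linarith⟩
  have hclose : ∀ u ∈ Icc t (t + τ), |R (φ u) - e u - R (φ t)| ≤ ε / 2 := by
    intro u hu
    have h3 := hδR (φ u) (hφ u (hlt0 u hu)) (φ t) (hφ t (hlt0 t htI)) (by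
      rw [Real.dist_eq]; linarith [h1 u hu])
    have h4 := hT u (hltT u hu)
    rw [Real.dist_eq] at h3 h4
    rw [sub_zero] at h4
    have h3' := abs_lt.1 h3
    have h4' := abs_lt.1 h4
    rw [abs_le]; constructor <;> linarith [h3'.1, h3'.2, h4'.1, h4'.2]
  obtain ⟨u, hu, hmv⟩ := exists_hasDerivAt_eq_slope Ψ (fun u => R (φ u) - e u)
    (show t < t + τ by linarith) (fun u hu => (dΨ u (hlt0 u hu)).continuousAt.continuousWithinAt)
    (fun u hu => dΨ u (hlt0 u (Ioo_subset_Icc_self hu)))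
  have h5 := hclose u (Ioo_subset_Icc_self hu)
  have h6 : ε / 2 ≤ |R (φ u) - e u| := by
    have := abs_sub_abs_le_abs_sub (R (φ t)) (R (φ u) - e u)
    rw [abs_sub_comm (R (φ t))] at this
    linarith
  rw [hmv, add_sub_cancel_left, abs_div, abs_of_pos hτ0, le_div_iff₀ hτ0] at h6
  have h7 := hΨ (t + τ) (hlt0 _ ⟨by linarith, le_rfl⟩)
  have h8 := hΨ t (hlt0 t htI)
  have h9 := abs_sub (Ψ (t + τ)) (Ψ t)
  linarith

lemma dichotomy (φ h : ℝ → ℝ) (t0 β q s c κ k2 γ B φs : ℝ) (hq0 : 0 < q) (hq1 : q < 1)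
    (hs0 : 0 < s) (hβ : 0 < β) (hκ : 1 ≤ κ) (hk2 : 0 < k2) (hγ : 0 < γ)
    (hφ : ∀ t < t0, HasDerivAt φ (h t - β * φ t ^ q - k2 * φ t) t)
    (hh : ∀ t < t0, HasDerivAt h (c * φ t ^ q - exp (γ * t) * φ t ^ s - κ * h t) t)
    (hpos : ∀ t < t0, 0 < φ t) (hB : ∀ t < t0, φ t ≤ B) (hhB : ∀ t < t0, |h t| ≤ B)
    (hc4 : 0 < c - κ * β) (hφs : 0 < φs) (hφs2 : (c - κ * β) * φs ^ q = κ * k2 * φs) :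
    Tendsto φ atBot (𝓝 0) ∨ Tendsto φ atBot (𝓝 φs) := by
  obtain ⟨c4, hc4e⟩ : ∃ c4, c4 = c - κ * β := ⟨_, rfl⟩
  obtain ⟨c5, hc5e⟩ : ∃ c5, c5 = κ * k2 := ⟨_, rfl⟩
  rw [← hc4e] at hc4 hφs2
  rw [← hc5e] at hφs2
  have hc5 : 0 < c5 := by rw [hc5e]; positivity
  have hB0 : 0 ≤ B := (abs_nonneg _).trans (hhB (t0 - 1) (by linarith))
  obtain ⟨y, hy⟩ : ∃ y : ℝ → ℝ, y = fun t => h t - β * φ t ^ q - k2 * φ t := ⟨_, rfl⟩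
  have hyt : ∀ t, y t = h t - β * φ t ^ q - k2 * φ t := fun t => by rw [hy]
  have hφy : ∀ t < t0, HasDerivAt φ (y t) t := fun t ht => by rw [hyt]; exact hφ t ht
  have hpw : ∀ t < t0, ∀ e : ℝ, 0 ≤ e → φ t ^ e ≤ B ^ e := fun t ht e he =>
    Real.rpow_le_rpow (hpos t ht).le (hB t ht) he
  obtain ⟨Y, hY⟩ : ∃ Y, Y = B + β * B ^ q + k2 * B := ⟨_, rfl⟩
  have hY0 : 0 ≤ Y := by rw [hY]; positivity
  have hyY : ∀ t < t0, |y t| ≤ Y := by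
    intro t ht
    have h1 := abs_le.1 (hhB t ht)
    have h2 := hpw t ht q hq0.le
    have h3 := hB t ht
    have h4 := hpos t ht
    have h5 : β * φ t ^ q ≤ β * B ^ q := by gcongr
    have h6 : k2 * φ t ≤ k2 * B := by gcongr
    have h7 : 0 ≤ β * φ t ^ q := by positivity
    have h8 : 0 ≤ k2 * φ t := by positivity
    have h9 : 0 ≤ β * B ^ q := by positivity
    have h10 : 0 ≤ k2 * B := by positivity
    rw [abs_le, hyt, hY]; constructor <;> linarith
  have hdq : ∀ t < t0, ∀ e : ℝ, HasDerivAt (fun t => φ t ^ e) (y t * e * φ t ^ (e - 1)) t :=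
    fun t ht e => (hφy t ht).rpow_const (Or.inl (hpos t ht).ne')
  have dy : ∀ t < t0, HasDerivAt y (c4 * φ t ^ q - c5 * φ t - exp (γ * t) * φ t ^ s -
      (κ + k2 + β * q * φ t ^ (q - 1)) * y t) t := by
    intro t ht
    have := ((hh t ht).sub ((hdq t ht q).const_mul β)).sub ((hφy t ht).const_mul k2)
    have e : y = (h - fun t => β * φ t ^ q) - fun t => k2 * φ t := by rw [hy]; rfl
    rw [e]
    refine this.congr_deriv ?_
    rw [← e]
    have e2 : h t = y t + β * φ t ^ q + k2 * φ t := by rw [hyt]; ring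
    rw [e2, hc4e, hc5e]; ring
  obtain ⟨B2, hB2⟩ : ∃ B2, B2 = B ^ s * Y := ⟨_, rfl⟩
  have hB20 : 0 ≤ B2 := by rw [hB2]; positivity
  obtain ⟨E, hE⟩ : ∃ E : ℝ → ℝ, E = fun t => y t ^ 2 / 2 - c4 / (q + 1) * φ t ^ (q + 1)
      + c5 / 2 * φ t ^ 2 - B2 / γ * exp (γ * t) := ⟨_, rfl⟩
  have dE : ∀ t < t0, HasDerivAt E (y t * (c4 * φ t ^ q - c5 * φ t - exp (γ * t) * φ t ^ s -
      (κ + k2 + β * q * φ t ^ (q - 1)) * y t) - c4 * φ t ^ q * y t + c5 * φ t * y t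
      - B2 * exp (γ * t)) t := by
    intro t ht
    have h1 := ((dy t ht).pow 2).div_const 2
    have h2 := (hdq t ht (q + 1)).const_mul (c4 / (q + 1))
    have h3 := ((hφy t ht).pow 2).const_mul (c5 / 2)
    have h4 : HasDerivAt (fun t => exp (γ * t)) (exp (γ * t) * (γ * 1)) t :=
      ((hasDerivAt_id t).const_mul γ).exp
    rw [hE]
    refine (((h1.sub h2).add h3).sub (h4.const_mul (B2 / γ))).congr_deriv ?_
    rw [add_sub_cancel_right]
    field_simp
    ring
  have hslow : ∀ τ δ, 0 < τ → 0 < δ → ∀ᶠ t in atBot, ∀ u ∈ Icc t (t + τ), |φ u - φ t| ≤ δ := by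
    intro τ δ hτ hδ
    refine slow_var φ y E _ t0 (Y ^ 2 / 2 + c4 / (q + 1) * B ^ (q + 1) + c5 / 2 * B ^ 2 +
      B2 / γ * exp (γ * t0)) hφy dE ?_ ?_ τ δ hτ hδ
    · intro t ht
      have h1 := hyY t ht
      have h2 := hpw t ht s hs0.le
      have h3 := hpos t ht
      have h4 : φ t ^ s * |y t| ≤ B2 := by rw [hB2]; gcongr
      have h5 : -(φ t ^ s * y t) ≤ B2 := by
        have h6 : -(φ t ^ s * y t) ≤ |φ t ^ s * y t| := neg_le_abs _
        rw [abs_mul, abs_of_nonneg (by positivity)] at h6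
        linarith
      have h7 : exp (γ * t) * -(φ t ^ s * y t) ≤ exp (γ * t) * B2 := by gcongr
      have h8 : 0 ≤ β * q * φ t ^ (q - 1) * y t ^ 2 := by positivity
      have h9 : 0 ≤ (κ - 1 + k2) * y t ^ 2 := mul_nonneg (by linarith) (sq_nonneg _)
      nlinarith
    · intro t ht
      have h1 := hyY t ht
      have h2 := hpw t ht (q + 1) (by linarith)
      have h3 := hpos t ht
      have h0 := hB t ht
      have a1 : y t ^ 2 ≤ Y ^ 2 := sq_le_sq' (by linarith [(abs_le.1 h1).1]) (abs_le.1 h1).2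
      have a2 : c4 / (q + 1) * φ t ^ (q + 1) ≤ c4 / (q + 1) * B ^ (q + 1) := by gcongr
      have a3 : c5 / 2 * φ t ^ 2 ≤ c5 / 2 * B ^ 2 := by gcongr
      have a4 : B2 / γ * exp (γ * t) ≤ B2 / γ * exp (γ * t0) := by gcongr
      have b1 : 0 ≤ y t ^ 2 := sq_nonneg _
      have b2 : 0 ≤ c4 / (q + 1) * φ t ^ (q + 1) := by positivity
      have b3 : 0 ≤ c5 / 2 * φ t ^ 2 := by positivity
      have b4 : 0 ≤ B2 / γ * exp (γ * t) := by positivity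
      rw [hE, abs_le]; constructor <;> linarith
  obtain ⟨R, hR⟩ : ∃ R : ℝ → ℝ, R = fun x => c4 * x ^ q - c5 * x := ⟨_, rfl⟩
  have hRc : Continuous R := by
    rw [hR]
    exact (continuous_const.mul (continuous_id.rpow_const fun _ => Or.inr hq0.le)).sub
      (continuous_const.mul continuous_id)
  have hexp : Tendsto (fun t => exp (γ * t)) atBot (𝓝 0) :=
    Real.tendsto_exp_atBot.comp ((tendsto_const_mul_atBot_of_pos hγ).2 tendsto_id)
  have he : Tendsto (fun t => exp (γ * t) * φ t ^ s) atBot (𝓝 0) := by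
    have h1 : Tendsto (fun t => exp (γ * t) * B ^ s) atBot (𝓝 0) := by
      simpa using hexp.mul_const (B ^ s)
    refine squeeze_zero' ?_ ?_ h1
    · filter_upwards [eventually_lt_atBot t0] with t ht
      have := hpos t ht
      positivity
    · filter_upwards [eventually_lt_atBot t0] with t ht
      have := hpw t ht s hs0.le
      gcongr
  have hR0 : Tendsto (fun t => R (φ t)) atBot (𝓝 0) := by
    refine avoid_set φ (fun t => h t + κ * φ t) R _ t0 B (B + κ * B) hRc.continuousOn he
      (fun t ht => ⟨(hpos t ht).le, hB t ht⟩) ?_ ?_ hslow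
    · intro t ht
      refine ((hh t ht).add ((hφ t ht).const_mul κ)).congr_deriv ?_
      rw [hR, hc4e, hc5e]; ring
    · intro t ht
      have h1 := abs_le.1 (hhB t ht)
      have h2 := hpos t ht
      have h3 : κ * φ t ≤ κ * B := by have := hB t ht; gcongr
      have h4 : 0 ≤ κ * φ t := by positivity
      rw [abs_le]; constructor <;> linarith
  have hRne : ∀ x, 0 < x → x ≠ φs → R x ≠ 0 := by
    intro x hx hxs h0
    apply hxs
    have h1 : c4 * x ^ q = c5 * x := by rw [hR] at h0; simp only at h0; linarith
    have key : ∀ z, 0 < z → c4 * z ^ q = c5 * z → z ^ (1 - q) = c4 / c5 := by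
      intro z hz hzz
      rw [Real.rpow_sub hz, Real.rpow_one, div_eq_div_iff (Real.rpow_pos_of_pos hz _).ne' hc5.ne']
      linarith
    have := (key x hx h1).trans (key φs hφs hφs2).symm
    exact (Real.rpow_left_inj hx.le hφs.le (by linarith : (1 - q) ≠ 0)).1 this
  have havoid : ∀ K : Set ℝ, IsCompact K → (∀ x ∈ K, 0 < x ∧ x ≠ φs) → ∀ᶠ t in atBot, φ t ∉ K := by
    intro K hK hKne
    obtain ⟨ρ, hρ, hρK⟩ := hK.exists_forall_le' (f := fun x => |R x|) (a := 0) hRc.abs.continuousOn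
      (fun x hx => abs_pos.2 (hRne x (hKne x hx).1 (hKne x hx).2))
    have := (Metric.tendsto_nhds.1 hR0) ρ hρ
    filter_upwards [this] with t ht hmem
    rw [Real.dist_eq, sub_zero] at ht
    exact absurd (hρK _ hmem) (not_le.2 ht)
  obtain ⟨T0, hT0⟩ := eventually_atBot.1 (havoid {φs / 2} isCompact_singleton (by
    rintro x rfl; exact ⟨by positivity, by linarith⟩))
  obtain ⟨T, hT⟩ : ∃ T, T = min T0 t0 - 1 := ⟨_, rfl⟩
  have hTt0 : T < t0 := by have := min_le_right T0 t0; linarith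
  have hTT0 : T ≤ T0 := by have := min_le_left T0 t0; linarith
  have hφc : ContinuousOn φ (Iic T) := fun t ht =>
    (hφ t (lt_of_le_of_lt ht hTt0)).continuousAt.continuousWithinAt
  have hivt : ∀ u ≤ T, ∀ v ≤ T, φ u < φs / 2 → ¬ φs / 2 < φ v := by
    intro u hu v hv h1 h2
    obtain ⟨w, hw, hw2⟩ := isPreconnected_Iic.intermediate_value (s := Iic T) hu hv hφc ⟨h1.le, h2.le⟩
    exact hT0 w (le_trans hw hTT0) hw2
  rcases lt_or_ge (φ T) (φs / 2) with hcase | hcase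
  · left
    have hall : ∀ v ≤ T, φ v ≤ φs / 2 := fun v hv => not_lt.1 (hivt T le_rfl v hv hcase)
    rw [Metric.tendsto_nhds]
    intro η hη
    filter_upwards [havoid (Icc η (φs / 2)) isCompact_Icc (by
      intro x hx; exact ⟨by linarith [hx.1], by linarith [hx.2]⟩), eventually_le_atBot T] with t h1 h2
    have h3 := hpos t (h2.trans_lt hTt0)
    rw [Real.dist_eq, sub_zero, abs_of_pos h3]
    by_contra h4
    exact h1 ⟨not_lt.1 h4, hall t h2⟩
  · right
    have hcase' : φs / 2 < φ T := lt_of_le_of_ne hcase (fun h => hT0 T hTT0 h.symm)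
    have hall : ∀ v ≤ T, φs / 2 ≤ φ v := fun v hv => by
      by_contra h
      exact hivt v hv T le_rfl (not_le.1 h) hcase'
    rw [Metric.tendsto_nhds]
    intro η hη
    filter_upwards [havoid (Icc (φs / 2) (φs - η)) isCompact_Icc (by
      intro x hx; exact ⟨by linarith [hx.1], by linarith [hx.2]⟩),
      havoid (Icc (φs + η) B) isCompact_Icc (by
      intro x hx; exact ⟨by linarith [hx.1], by linarith [hx.1]⟩), eventually_le_atBot T] with t h1 h1' h2
    rw [Real.dist_eq, abs_lt]
    constructor
    · by_contra h4
      exact h1 ⟨hall t h2, by linarith⟩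
    · by_contra h4
      exact h1' ⟨by linarith, hB t (h2.trans_lt hTt0)⟩

lemma anti_Iic (G G' : ℝ → ℝ) (T : ℝ) (h1 : ∀ t ≤ T, HasDerivAt G (G' t) t)
    (h2 : ∀ t ≤ T, G' t ≤ 0) : ∀ s t, s ≤ t → t ≤ T → G t ≤ G s := by
  intro s t hst ht
  have : AntitoneOn G (Iic T) := by
    refine antitoneOn_of_deriv_nonpos (convex_Iic T)
      (fun x hx => (h1 x hx).continuousAt.continuousWithinAt) ?_ ?_
    · intro x hx
      have hx' : x ∈ Iic T := interior_subset hx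
      exact (h1 x hx').differentiableAt.differentiableWithinAt
    · intro x hx
      have hx' : x ∈ Iic T := interior_subset hx
      rw [(h1 x hx').deriv]; exact h2 x hx'
  exact this (hst.trans ht) ht hst

lemma back_persist (A B A' B' : ℝ → ℝ) (T : ℝ) (dA : ∀ t ≤ T, HasDerivAt A (A' t) t)
    (dB : ∀ t ≤ T, HasDerivAt B (B' t) t)
    (h : ∀ t ≤ T, A t ≤ 0 → B t ≤ 0 → 0 < A' t ∧ 0 < B' t) (hA : A T ≤ 0) (hB : B T ≤ 0) :
    ∀ t ≤ T, A t ≤ 0 ∧ B t ≤ 0 := by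
  intro t0 ht0
  have hright : ∀ (G : ℝ → ℝ) (g x : ℝ), HasDerivAt G g (-x) → 0 < g →
      ∀ᶠ u in 𝓝[>] x, G (-u) < G (-x) := by
    intro G g x hd hg
    have h1 : HasDerivAt (fun u => G (-u)) (g * -1) x :=
      HasDerivAt.comp x hd (hasDerivAt_neg x)
    have h2 := h1.hasDerivWithinAt (s := Ioi x)
    rw [hasDerivWithinAt_iff_tendsto_slope' (by simp)] at h2
    have h3 := h2.eventually (gt_mem_nhds (show g * -1 < 0 by linarith))
    filter_upwards [h3, self_mem_nhdsWithin] with u hu hux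
    have hux' : 0 < u - x := sub_pos.2 hux
    rw [slope_def_field, div_lt_iff₀ hux', zero_mul] at hu
    linarith
  have hsub : Icc (-T) (-t0) ⊆ {u | A (-u) ≤ 0 ∧ B (-u) ≤ 0} := by
    refine IsClosed.Icc_subset_of_forall_mem_nhdsWithin ?_ ?_ ?_
    · have hc : ∀ (G G' : ℝ → ℝ), (∀ t ≤ T, HasDerivAt G (G' t) t) →
          IsClosed (Icc (-T) (-t0) ∩ (fun u => G (-u)) ⁻¹' Iic 0) := by
        intro G G' hG
        refine ContinuousOn.preimage_isClosed_of_isClosed ?_ isClosed_Icc isClosed_Iic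
        intro u hu
        have h1 : ContinuousAt G (-u) := (hG (-u) (by linarith [hu.1])).continuousAt
        exact (ContinuousAt.comp (f := fun u => -u) h1 continuous_neg.continuousAt).continuousWithinAt
      have : {u | A (-u) ≤ 0 ∧ B (-u) ≤ 0} ∩ Icc (-T) (-t0) =
        (Icc (-T) (-t0) ∩ (fun u => A (-u)) ⁻¹' Iic 0) ∩
        (Icc (-T) (-t0) ∩ (fun u => B (-u)) ⁻¹' Iic 0) := by
        ext u; simp only [mem_inter_iff, mem_ofPred_eq, mem_preimage, mem_Iic]; tauto
      rw [this]
      exact (hc A A' dA).inter (hc B B' dB)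
    · simpa using ⟨hA, hB⟩
    · rintro x ⟨⟨h1, h2⟩, hx⟩
      have hxT : -x ≤ T := by linarith [hx.1]
      have h3 := h (-x) hxT h1 h2
      filter_upwards [hright A _ x (dA _ hxT) h3.1, hright B _ x (dB _ hxT) h3.2] with u a b
      exact ⟨by linarith, by linarith⟩
  have := hsub ⟨by linarith, le_rfl⟩ (a := -t0)
  simpa using this

lemma hasDerivAt_exp_mul (a t : ℝ) : HasDerivAt (fun t => exp (a * t)) (exp (a * t) * a) t := by
  simpa using ((hasDerivAt_id t).const_mul a).exp

lemma hasDerivAt_exp_neg_mul (a t : ℝ) :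
    HasDerivAt (fun t => exp (-(a * t))) (exp (-(a * t)) * (-(a * 1))) t :=
  ((hasDerivAt_id t).const_mul a).neg.exp

lemma b3_step1 (Z J : ℝ → ℝ) (t0 β q s θ c' c3 : ℝ) (hq0 : 0 < q) (hq1 : q < 1)
    (hs1 : s ≤ 1) (hβ : 0 < β) (hθ : 0 < θ) (hc' : 0 < c') (hc3 : 0 < c3)
    (hZ : ∀ t < t0, 0 < Z t)
    (dZ : ∀ t < t0, HasDerivAt Z (exp (-(θ * t)) * (J t - β * Z t ^ q) - c' * Z t) t)
    (dJ : ∀ t < t0, HasDerivAt J (-(c3 * Z t + Z t ^ s) * exp (θ * t)) t)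
    (hv : Tendsto (fun t => Z t ^ (1 - q) * exp (θ * t)) atBot (𝓝 0)) :
    ∀ᶠ t in atBot, 1 ≤ Z t → β / 2 * Z t ^ q < J t := by
  obtain ⟨κ, hκ⟩ : ∃ κ, κ = (1 - q) * β / (2 * θ) := ⟨_, rfl⟩
  have hκ0 : 0 < κ := by
    have : 0 < 1 - q := by linarith
    rw [hκ]; positivity
  have hv2 : Tendsto (fun t => (c3 + 1) * (Z t ^ (1 - q) * exp (θ * t)) ^ 2) atBot (𝓝 0) := by
    simpa using (hv.pow 2).const_mul (c3 + 1)
  have hev := hv2.eventually (gt_mem_nhds (show (0 : ℝ) < β ^ 2 * q / 4 by positivity))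
  obtain ⟨T, hT⟩ := eventually_atBot.1 hev
  filter_upwards [eventually_le_atBot T, eventually_lt_atBot t0] with t2 ht2 ht20 hZ1
  by_contra hcon
  push Not at hcon
  have hlt : ∀ t ≤ t2, t < t0 := fun t ht => ht.trans_lt ht20
  have hdq : ∀ t ≤ t2, ∀ e : ℝ, HasDerivAt (fun t => Z t ^ e)
      ((exp (-(θ * t)) * (J t - β * Z t ^ q) - c' * Z t) * e * Z t ^ (e - 1)) t :=
    fun t ht e => (dZ t (hlt t ht)).rpow_const (Or.inl (hZ t (hlt t ht)).ne')
  have hpers := back_persist (fun t => J t - β / 2 * Z t ^ q) (fun t => 1 - Z t) _ _ t2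
    (fun t ht => (dJ t (hlt t ht)).sub ((hdq t ht q).const_mul (β / 2)))
    (fun t ht => (hasDerivAt_const t (1 : ℝ)).sub (dZ t (hlt t ht)))
    (by
      intro t ht hA hB
      have hZt := hZ t (hlt t ht)
      have hZ1' : 1 ≤ Z t := by linarith
      have hZq : 0 < Z t ^ q := Real.rpow_pos_of_pos hZt _
      have hE : 0 < exp (-(θ * t)) := exp_pos _
      have hE2 : exp (-(θ * t)) * exp (θ * t) = 1 := by rw [← Real.exp_add]; simp
      have hE3 : 0 < exp (θ * t) := exp_pos _
      have hZd : exp (-(θ * t)) * (J t - β * Z t ^ q) - c' * Z t ≤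
          -(exp (-(θ * t)) * (β / 2 * Z t ^ q)) := by
        have h1 : exp (-(θ * t)) * (J t - β * Z t ^ q) ≤ exp (-(θ * t)) * (-(β / 2 * Z t ^ q)) := by
          gcongr; linarith
        have h2 : 0 < c' * Z t := by positivity
        linarith
      have hpos1 : 0 < exp (-(θ * t)) * (β / 2 * Z t ^ q) := by positivity
      refine ⟨?_, by linarith⟩
      have hZs : Z t ^ s ≤ Z t := by
        calc Z t ^ s ≤ Z t ^ (1 : ℝ) := Real.rpow_le_rpow_of_exponent_le hZ1' hs1
          _ = Z t := Real.rpow_one _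
      have h3 := hT t (ht.trans ht2)
      have hZm : 0 < Z t ^ (q - 1) := Real.rpow_pos_of_pos hZt _
      set P := Z t ^ q with hP
      set E := exp (θ * t) with hEE
      set E' := exp (-(θ * t)) with hEE'
      set U := Z t ^ (1 - q) with hU
      set Um := Z t ^ (q - 1) with hUm
      have hUU : Um * U = 1 := by rw [hUm, hU, ← Real.rpow_add hZt]; simp
      have hUP : U * P = Z t := by rw [hU, hP, ← Real.rpow_add hZt]; simp
      have hU0 : 0 < U := Real.rpow_pos_of_pos hZt _
      have h4 : β / 2 * ((E' * (J t - β * P) - c' * Z t) * q * Um) ≤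
          β / 2 * (-(E' * (β / 2 * P)) * q * Um) := by gcongr
      have h5 : -(c3 * Z t + Z t ^ s) * E ≥ -((c3 + 1) * Z t) * E := by
        have : -(c3 * Z t + Z t ^ s) ≥ -((c3 + 1) * Z t) := by linarith
        gcongr
      have h6 : 0 < E' * P * Um * (β ^ 2 * q / 4 - (c3 + 1) * (U * E) ^ 2) := by
        have : 0 < β ^ 2 * q / 4 - (c3 + 1) * (U * E) ^ 2 := by linarith
        positivity
      have h7 : E' * P * Um * ((c3 + 1) * (U * E) ^ 2) = (c3 + 1) * Z t * E := by
        rw [← hUP]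
        calc E' * P * Um * ((c3 + 1) * (U * E) ^ 2)
            = (E' * E) * (Um * U) * ((c3 + 1) * (U * P) * E) := by ring
          _ = _ := by rw [hE2, hUU]; ring
      nlinarith) (by linarith) (by linarith)
  have hanti := anti_Iic (fun t => Z t ^ (1 - q) - κ * exp (-(θ * t))) _ t2
    (fun t ht => (hdq t ht (1 - q)).sub
      ((hasDerivAt_exp_neg_mul θ t).const_mul κ)) (by
      intro t ht
      obtain ⟨hA, hB⟩ := hpers t ht
      have hZt := hZ t (hlt t ht)
      have hZq : 0 < Z t ^ q := Real.rpow_pos_of_pos hZt _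
      have hE : 0 < exp (-(θ * t)) := exp_pos _
      have hZd : exp (-(θ * t)) * (J t - β * Z t ^ q) - c' * Z t ≤
          -(exp (-(θ * t)) * (β / 2 * Z t ^ q)) := by
        have h1 : exp (-(θ * t)) * (J t - β * Z t ^ q) ≤ exp (-(θ * t)) * (-(β / 2 * Z t ^ q)) := by
          gcongr; linarith
        have h2 : 0 < c' * Z t := by positivity
        linarith
      have e1 : Z t ^ (1 - q - 1) * Z t ^ q = 1 := by
        rw [← Real.rpow_add hZt]; simp
      have hm0 : 0 < Z t ^ (1 - q - 1) := Real.rpow_pos_of_pos hZt _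
      have h1q : 0 < 1 - q := by linarith
      have h4 : (exp (-(θ * t)) * (J t - β * Z t ^ q) - c' * Z t) * (1 - q) * Z t ^ (1 - q - 1) ≤
          -(exp (-(θ * t)) * (β / 2 * Z t ^ q)) * (1 - q) * Z t ^ (1 - q - 1) := by gcongr
      have h5 : -(exp (-(θ * t)) * (β / 2 * Z t ^ q)) * (1 - q) * Z t ^ (1 - q - 1)
          = -(exp (-(θ * t)) * (β / 2) * (1 - q)) := by
        calc _ = -(exp (-(θ * t)) * (β / 2) * (1 - q)) * (Z t ^ (1 - q - 1) * Z t ^ q) := by ring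
          _ = _ := by rw [e1, mul_one]
      have h6 : κ * (exp (-(θ * t)) * (-(θ * 1))) = -(exp (-(θ * t)) * (β / 2) * (1 - q)) := by
        rw [hκ]; field_simp
      linarith)
  have hlim : Tendsto (fun t => κ - κ * exp (-(θ * t2)) * exp (θ * t)) atBot (𝓝 κ) := by
    have h1 : Tendsto (fun t => exp (θ * t)) atBot (𝓝 0) :=
      Real.tendsto_exp_atBot.comp ((tendsto_const_mul_atBot_of_pos hθ).2 tendsto_id)
    simpa using (h1.const_mul (κ * exp (-(θ * t2)))).const_sub κ
  have := le_of_tendsto_of_tendsto hlim hv (by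
    filter_upwards [eventually_le_atBot t2] with t ht
    have h1 := hanti t t2 ht le_rfl
    have h2 : 0 < Z t2 ^ (1 - q) := Real.rpow_pos_of_pos (hZ t2 ht20) _
    have hE2 : exp (-(θ * t)) * exp (θ * t) = 1 := by rw [← Real.exp_add]; simp
    have h3 : κ * exp (-(θ * t)) - κ * exp (-(θ * t2)) ≤ Z t ^ (1 - q) := by linarith
    calc κ - κ * exp (-(θ * t2)) * exp (θ * t)
        = (κ * exp (-(θ * t)) - κ * exp (-(θ * t2))) * exp (θ * t) := by
          rw [sub_mul, mul_assoc κ (exp (-(θ * t))), hE2, mul_one]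
      _ ≤ _ := by gcongr)
  linarith

lemma b3_Jbdd (Z J : ℝ → ℝ) (t0 β q s θ c3 : ℝ) (hq0 : 0 < q) (hq1 : q < 1)
    (hs0 : 0 ≤ s) (hs1 : s ≤ 1) (hβ : 0 < β) (hθ : 0 < θ) (hc3 : 0 < c3)
    (hZ : ∀ t < t0, 0 < Z t)
    (dJ : ∀ t < t0, HasDerivAt J (-(c3 * Z t + Z t ^ s) * exp (θ * t)) t)
    (hv : Tendsto (fun t => Z t ^ (1 - q) * exp (θ * t)) atBot (𝓝 0))
    (h1 : ∀ᶠ t in atBot, 1 ≤ Z t → β / 2 * Z t ^ q < J t) :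
    ∃ T M, T < t0 ∧ ∀ t ≤ T, J t ≤ M := by
  obtain ⟨T1, hT1⟩ := eventually_atBot.1 h1
  obtain ⟨ε, hε⟩ : ∃ ε, ε = θ * q / 2 := ⟨_, rfl⟩
  have hε0 : 0 < ε := by rw [hε]; positivity
  have hexp : Tendsto (fun t => exp (θ * t)) atBot (𝓝 0) :=
    Real.tendsto_exp_atBot.comp ((tendsto_const_mul_atBot_of_pos hθ).2 tendsto_id)
  have hlim : Tendsto (fun t => (c3 + 1) * (exp (θ * t) + 2 / β * (Z t ^ (1 - q) * exp (θ * t))))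
      atBot (𝓝 0) := by
    simpa using (hexp.add (hv.const_mul (2 / β))).const_mul (c3 + 1)
  obtain ⟨T2, hT2⟩ := eventually_atBot.1 (hlim.eventually (gt_mem_nhds hε0))
  obtain ⟨T, hT⟩ : ∃ T, T = min (min T1 T2) (min (t0 - 1) 0) := ⟨_, rfl⟩
  have hTT1 : T ≤ T1 := by rw [hT]; exact (min_le_left _ _).trans (min_le_left _ _)
  have hTT2 : T ≤ T2 := by rw [hT]; exact (min_le_left _ _).trans (min_le_right _ _)
  have hTt0 : T < t0 := by
    have : T ≤ t0 - 1 := by rw [hT]; exact (min_le_right _ _).trans (min_le_left _ _)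
    linarith
  have hT0 : T ≤ 0 := by rw [hT]; exact (min_le_right _ _).trans (min_le_right _ _)
  have hlt : ∀ t ≤ T, t < t0 := fun t ht => ht.trans_lt hTt0
  obtain ⟨C0, hC0⟩ : ∃ C0, C0 = 1 + |J T| := ⟨_, rfl⟩
  have hC00 : 0 ≤ C0 := by rw [hC0]; positivity
  have hJanti := anti_Iic J _ T (fun t ht => dJ t (hlt t ht)) (by
    intro t ht
    have := hZ t (hlt t ht)
    have h2 : 0 ≤ (c3 * Z t + Z t ^ s) * exp (θ * t) := by positivity
    linarith)
  have hJC : ∀ t ≤ T, 1 ≤ J t + C0 := by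
    intro t ht
    have := hJanti t T ht le_rfl
    have h2 := neg_abs_le (J T)
    rw [hC0]; linarith
  have hsum : ∀ t ≤ T, c3 * Z t + Z t ^ s ≤ (c3 + 1) * max 1 (Z t) := by
    intro t ht
    have hz := hZ t (hlt t ht)
    have h2 : Z t ^ s ≤ max 1 (Z t) := by
      rcases le_total (Z t) 1 with h | h
      · exact (Real.rpow_le_one hz.le h hs0).trans (le_max_left _ _)
      · calc Z t ^ s ≤ Z t ^ (1 : ℝ) := Real.rpow_le_rpow_of_exponent_le h hs1
          _ = Z t := Real.rpow_one _
          _ ≤ _ := le_max_right _ _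
    have h3 : c3 * Z t ≤ c3 * max 1 (Z t) := by
      have := le_max_right 1 (Z t)
      gcongr
    linarith
  have hder1 : ∀ t ≤ T, (c3 * Z t + Z t ^ s) * exp (θ * t) ≤ ε * (J t + C0) := by
    intro t ht
    have hz := hZ t (hlt t ht)
    have hE := exp_pos (θ * t)
    have hU : 0 < Z t ^ (1 - q) := Real.rpow_pos_of_pos hz _
    have hJ1 := hJC t ht
    have h3 : max 1 (Z t) * exp (θ * t) ≤
        (exp (θ * t) + 2 / β * (Z t ^ (1 - q) * exp (θ * t))) * (J t + C0) := by
      rcases le_total (Z t) 1 with h | h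
      · rw [max_eq_left h]
        have a1 : 0 ≤ 2 / β * (Z t ^ (1 - q) * exp (θ * t)) := by positivity
        nlinarith
      · rw [max_eq_right h]
        have a1 := hT1 t (ht.trans hTT1) h
        have a2 : Z t ^ (1 - q) * Z t ^ q = Z t := by rw [← Real.rpow_add hz]; simp
        have a3 : Z t ^ q ≤ 2 / β * (J t + C0) := by
          rw [div_mul_eq_mul_div, le_div_iff₀ hβ]; linarith
        calc Z t * exp (θ * t) = (Z t ^ (1 - q) * exp (θ * t)) * Z t ^ q := by
              rw [mul_right_comm, a2]
          _ ≤ (Z t ^ (1 - q) * exp (θ * t)) * (2 / β * (J t + C0)) := by gcongr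
          _ = (0 + 2 / β * (Z t ^ (1 - q) * exp (θ * t))) * (J t + C0) := by ring
          _ ≤ _ := by gcongr
    calc (c3 * Z t + Z t ^ s) * exp (θ * t) ≤ (c3 + 1) * max 1 (Z t) * exp (θ * t) := by
          have := hsum t ht
          gcongr
      _ = (c3 + 1) * (max 1 (Z t) * exp (θ * t)) := by ring
      _ ≤ (c3 + 1) * ((exp (θ * t) + 2 / β * (Z t ^ (1 - q) * exp (θ * t))) * (J t + C0)) := by
          gcongr
      _ = (c3 + 1) * (exp (θ * t) + 2 / β * (Z t ^ (1 - q) * exp (θ * t))) * (J t + C0) := by ring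
      _ ≤ ε * (J t + C0) := by
          have := (hT2 t (ht.trans hTT2)).le
          gcongr
  have hA := anti_Iic (fun t => -((J t + C0) * exp (ε * t))) _ T
    (fun t ht => (((dJ t (hlt t ht)).add_const C0).mul (hasDerivAt_exp_mul ε t)).neg) (by
      intro t ht
      have h2 := hder1 t ht
      have hE := exp_pos (ε * t)
      have : -(-(c3 * Z t + Z t ^ s) * exp (θ * t) * exp (ε * t) + (J t + C0) * (exp (ε * t) * ε))
        = exp (ε * t) * ((c3 * Z t + Z t ^ s) * exp (θ * t) - ε * (J t + C0)) := by ring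
      rw [this]
      exact mul_nonpos_of_nonneg_of_nonpos hE.le (by linarith))
  obtain ⟨A, hAe⟩ : ∃ A, A = (J T + C0) * exp (ε * T) := ⟨_, rfl⟩
  have hA0 : 0 < A := by
    have := hJC T le_rfl
    rw [hAe]; positivity
  have hJA : ∀ t ≤ T, J t ≤ A * exp (-(ε * t)) := by
    intro t ht
    have h2 := hA t T ht le_rfl
    have hE2 : exp (ε * t) * exp (-(ε * t)) = 1 := by rw [← Real.exp_add]; simp
    have h3 : J t + C0 ≤ A * exp (-(ε * t)) := by
      calc J t + C0 = (J t + C0) * exp (ε * t) * exp (-(ε * t)) := by rw [mul_assoc, hE2, mul_one]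
        _ ≤ _ := by gcongr; rw [hAe]; linarith
    linarith
  obtain ⟨D, hD⟩ : ∃ D, D = max 1 ((2 / β * A) ^ (1 / q)) := ⟨_, rfl⟩
  have hD1 : 1 ≤ D := by rw [hD]; exact le_max_left _ _
  have hZD : ∀ t ≤ T, max 1 (Z t) * exp (θ * t) ≤ D * exp (θ / 2 * t) := by
    intro t ht
    have hz := hZ t (hlt t ht)
    have ht0 : t ≤ 0 := ht.trans hT0
    rcases le_total (Z t) 1 with h | h
    · rw [max_eq_left h]
      have : exp (θ * t) ≤ exp (θ / 2 * t) := exp_le_exp.2 (by nlinarith)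
      gcongr
    · rw [max_eq_right h]
      have a1 := hT1 t (ht.trans hTT1) h
      have a3 : Z t ^ q ≤ (2 / β * A) * exp (-(ε * t)) := by
        have := hJA t ht
        rw [mul_assoc, div_mul_eq_mul_div, le_div_iff₀ hβ]; linarith
      have a4 : Z t ≤ (2 / β * A) ^ (1 / q) * exp (-(θ / 2 * t)) := by
        calc Z t = (Z t ^ q) ^ (1 / q) := by
              rw [← Real.rpow_mul hz.le, mul_one_div_cancel hq0.ne', Real.rpow_one]
          _ ≤ ((2 / β * A) * exp (-(ε * t))) ^ (1 / q) := by gcongr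
          _ = _ := by
              rw [Real.mul_rpow (by positivity) (exp_pos _).le, ← Real.exp_mul]
              congr 2
              rw [hε]; field_simp
      have a5 : exp (θ * t) = exp (θ / 2 * t) * exp (θ / 2 * t) := by
        rw [← Real.exp_add]; congr 1; ring
      have a6 : exp (-(θ / 2 * t)) * exp (θ / 2 * t) = 1 := by rw [← Real.exp_add]; simp
      calc Z t * exp (θ * t) ≤ (2 / β * A) ^ (1 / q) * exp (-(θ / 2 * t)) * exp (θ * t) := by gcongr
        _ = (2 / β * A) ^ (1 / q) * (exp (-(θ / 2 * t)) * exp (θ / 2 * t)) * exp (θ / 2 * t) := by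
            rw [a5]; ring
        _ = (2 / β * A) ^ (1 / q) * exp (θ / 2 * t) := by rw [a6, mul_one]
        _ ≤ _ := by gcongr; rw [hD]; exact le_max_right _ _
  obtain ⟨D2, hD2⟩ : ∃ D2, D2 = (c3 + 1) * D := ⟨_, rfl⟩
  have hD20 : 0 < D2 := by rw [hD2]; positivity
  have hfin := anti_Iic (fun t => -(J t + D2 / (θ / 2) * exp (θ / 2 * t))) _ T
    (fun t ht => ((dJ t (hlt t ht)).add ((hasDerivAt_exp_mul (θ / 2) t).const_mul
      (D2 / (θ / 2)))).neg) (by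
      intro t ht
      have a1 : (c3 * Z t + Z t ^ s) * exp (θ * t) ≤ D2 * exp (θ / 2 * t) := by
        calc (c3 * Z t + Z t ^ s) * exp (θ * t) ≤ (c3 + 1) * max 1 (Z t) * exp (θ * t) := by
              have := hsum t ht
              gcongr
          _ = (c3 + 1) * (max 1 (Z t) * exp (θ * t)) := by ring
          _ ≤ (c3 + 1) * (D * exp (θ / 2 * t)) := by
              have := hZD t ht
              gcongr
          _ = _ := by rw [hD2]; ring
      have a2 : D2 / (θ / 2) * (exp (θ / 2 * t) * (θ / 2)) = D2 * exp (θ / 2 * t) := by field_simp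
      linarith)
  refine ⟨T, J T + D2 / (θ / 2) * exp (θ / 2 * T), hTt0, fun t ht => ?_⟩
  have h2 := hfin t T ht le_rfl
  have h3 : 0 < D2 / (θ / 2) * exp (θ / 2 * t) := by positivity
  linarith

lemma b3_main (Z J : ℝ → ℝ) (t0 β q s θ c' c3 : ℝ) (hq0 : 0 < q) (hq1 : q < 1)
    (hs0 : 0 ≤ s) (hs1 : s ≤ 1) (hβ : 0 < β) (hθ : 0 < θ) (hc' : 0 < c') (hc3 : 0 < c3)
    (hZ : ∀ t < t0, 0 < Z t)
    (dZ : ∀ t < t0, HasDerivAt Z (exp (-(θ * t)) * (J t - β * Z t ^ q) - c' * Z t) t)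
    (dJ : ∀ t < t0, HasDerivAt J (-(c3 * Z t + Z t ^ s) * exp (θ * t)) t)
    (hv : Tendsto (fun t => Z t ^ (1 - q) * exp (θ * t)) atBot (𝓝 0)) :
    ∃ K, 0 < K ∧ Tendsto (fun t => Z t ^ q) atBot (𝓝 K) := by
  have h1 := b3_step1 Z J t0 β q s θ c' c3 hq0 hq1 hs1 hβ hθ hc' hc3 hZ dZ dJ hv
  obtain ⟨T3, M, hT3, hM⟩ := b3_Jbdd Z J t0 β q s θ c3 hq0 hq1 hs0 hs1 hβ hθ hc3 hZ dJ hv h1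
  obtain ⟨T1, hT1⟩ := eventually_atBot.1 h1
  obtain ⟨T, hT⟩ : ∃ T, T = min (min T1 T3) 0 := ⟨_, rfl⟩
  have hTT1 : T ≤ T1 := by rw [hT]; exact (min_le_left _ _).trans (min_le_left _ _)
  have hTT3 : T ≤ T3 := by rw [hT]; exact (min_le_left _ _).trans (min_le_right _ _)
  have hT0 : T ≤ 0 := by rw [hT]; exact min_le_right _ _
  have hlt : ∀ t ≤ T, t < t0 := fun t ht => (ht.trans hTT3).trans_lt hT3
  have hJanti := anti_Iic J _ T (fun t ht => dJ t (hlt t ht)) (by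
    intro t ht
    have := hZ t (hlt t ht)
    have h2 : 0 ≤ (c3 * Z t + Z t ^ s) * exp (θ * t) := by positivity
    linarith)
  -- limit of J
  obtain ⟨J0, hJ0⟩ : ∃ S, IsLUB (J '' Iic T) S := by
    refine ⟨_, isLUB_csSup ⟨J T, mem_image_of_mem _ (by simp)⟩ ⟨M, ?_⟩⟩
    rintro _ ⟨t, ht, rfl⟩
    exact hM t (le_trans ht hTT3)
  have hJle : ∀ t ≤ T, J t ≤ J0 := fun t ht => hJ0.1 (mem_image_of_mem _ ht)
  have hJge : ∀ ε > 0, ∃ T' ≤ T, ∀ t ≤ T', J0 - ε < J t := by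
    intro ε hε
    obtain ⟨_, ⟨t1, ht1, rfl⟩, hl, -⟩ := hJ0.exists_between (b := J0 - ε) (by linarith)
    exact ⟨t1, ht1, fun t ht => hl.trans_le (hJanti t t1 ht ht1)⟩
  -- Z bounded
  obtain ⟨Zb, hZb⟩ : ∃ Zb, Zb = max 1 ((2 / β * |M|) ^ (1 / q)) := ⟨_, rfl⟩
  have hZb0 : 0 < Zb := by rw [hZb]; positivity
  have hZle : ∀ t ≤ T, Z t ≤ Zb := by
    intro t ht
    have hz := hZ t (hlt t ht)
    rcases le_total (Z t) 1 with h | h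
    · rw [hZb]; exact h.trans (le_max_left _ _)
    · have a1 := hT1 t (ht.trans hTT1) h
      have a3 : Z t ^ q ≤ 2 / β * |M| := by
        have h2 := hM t (ht.trans hTT3)
        have h3 := le_abs_self M
        rw [div_mul_eq_mul_div, le_div_iff₀ hβ]; linarith
      calc Z t = (Z t ^ q) ^ (1 / q) := by
            rw [← Real.rpow_mul hz.le, mul_one_div_cancel hq0.ne', Real.rpow_one]
        _ ≤ (2 / β * |M|) ^ (1 / q) := by gcongr
        _ ≤ _ := by rw [hZb]; exact le_max_right _ _
  have hdq : ∀ t ≤ T, HasDerivAt (fun t => Z t ^ q)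
      ((exp (-(θ * t)) * (J t - β * Z t ^ q) - c' * Z t) * q * Z t ^ (q - 1)) t :=
    fun t ht => (dZ t (hlt t ht)).rpow_const (Or.inl (hZ t (hlt t ht)).ne')
  have hexp : Tendsto (fun t => exp (θ * t)) atBot (𝓝 0) :=
    Real.tendsto_exp_atBot.comp ((tendsto_const_mul_atBot_of_pos hθ).2 tendsto_id)
  have hupper : ∀ ε > 0, ∀ t2 ≤ T, β * Z t2 ^ q < J0 + ε := by
    intro ε hε t2 ht2
    by_contra hcon
    push Not at hcon
    have hZd : ∀ t ≤ t2, J0 + ε - β * Z t ^ q ≤ 0 →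
        exp (-(θ * t)) * (J t - β * Z t ^ q) - c' * Z t ≤ -ε := by
      intro t ht h
      have hz := hZ t (hlt t (ht.trans ht2))
      have hj := hJle t (ht.trans ht2)
      have hE : 1 ≤ exp (-(θ * t)) := one_le_exp (by nlinarith)
      have a1 : 0 < c' * Z t := by positivity
      have a2 : J t - β * Z t ^ q ≤ -ε := by linarith
      nlinarith
    have hp := back_persist (fun t => J0 + ε - β * Z t ^ q) (fun t => J0 + ε - β * Z t ^ q) _ _ t2
      (fun t ht => ((hdq t (ht.trans ht2)).const_mul β).const_sub (J0 + ε))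
      (fun t ht => ((hdq t (ht.trans ht2)).const_mul β).const_sub (J0 + ε)) (by
        intro t ht hA _
        have hz := hZ t (hlt t (ht.trans ht2))
        have h2 := hZd t ht hA
        have h3 : 0 < Z t ^ (q - 1) := Real.rpow_pos_of_pos hz _
        have h4 : 0 < β * (-(exp (-(θ * t)) * (J t - β * Z t ^ q) - c' * Z t) * q * Z t ^ (q - 1)) := by
          have : 0 < -(exp (-(θ * t)) * (J t - β * Z t ^ q) - c' * Z t) := by linarith
          positivity
        constructor <;> linarith) (by linarith) (by linarith)
    have ha := anti_Iic (fun t => Z t + ε * t) _ t2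
      (fun t ht => (dZ t (hlt t (ht.trans ht2))).add ((hasDerivAt_id t).const_mul ε)) (by
        intro t ht
        have := hZd t ht (hp t ht).1
        linarith)
    have h5 := ha (t2 - Zb / ε) t2 (by have : 0 < Zb / ε := by positivity
                                       linarith) le_rfl
    have h6 := hZle (t2 - Zb / ε) (by have : 0 < Zb / ε := by positivity
                                      linarith)
    have h7 := hZ t2 (hlt t2 ht2)
    have h8 : ε * (Zb / ε) = Zb := by field_simp
    nlinarith
  have hlower : ∀ ε > 0, ∀ᶠ t2 in atBot, J0 - 3 * ε < β * Z t2 ^ q := by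
    intro ε hε
    obtain ⟨T', hT', hJT'⟩ := hJge ε hε
    have hlim : Tendsto (fun t => c' * Zb * exp (θ * t)) atBot (𝓝 0) := by
      simpa using hexp.const_mul (c' * Zb)
    obtain ⟨T'', hT''⟩ := eventually_atBot.1 (hlim.eventually (gt_mem_nhds hε))
    filter_upwards [eventually_le_atBot T', eventually_le_atBot T''] with t2 ht2 ht2'
    by_contra hcon
    push Not at hcon
    have hZd : ∀ t ≤ t2, β * Z t ^ q - (J0 - 3 * ε) ≤ 0 →
        ε ≤ exp (-(θ * t)) * (J t - β * Z t ^ q) - c' * Z t := by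
      intro t ht h
      have htT : t ≤ T := (ht.trans ht2).trans hT'
      have hz := hZ t (hlt t htT)
      have hj := hJT' t (ht.trans ht2)
      have hE : 1 ≤ exp (-(θ * t)) := one_le_exp (by nlinarith)
      have hE2 : exp (-(θ * t)) * exp (θ * t) = 1 := by rw [← Real.exp_add]; simp
      have a1 : c' * Z t ≤ exp (-(θ * t)) * ε := by
        have b1 := (hT'' t (ht.trans ht2')).le
        have b2 := hZle t htT
        calc c' * Z t ≤ c' * Zb := by gcongr
          _ = exp (-(θ * t)) * (c' * Zb * exp (θ * t)) := by
            rw [mul_comm (exp (-(θ * t))), mul_assoc, mul_comm (exp (θ * t)), hE2, mul_one]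
          _ ≤ _ := by gcongr
      have a2 : 2 * ε ≤ J t - β * Z t ^ q := by linarith
      have a3 : exp (-(θ * t)) * (2 * ε) ≤ exp (-(θ * t)) * (J t - β * Z t ^ q) := by gcongr
      nlinarith
    have hp := back_persist (fun t => β * Z t ^ q - (J0 - 3 * ε))
      (fun t => β * Z t ^ q - (J0 - 3 * ε)) _ _ t2
      (fun t ht => ((hdq t ((ht.trans ht2).trans hT')).const_mul β).sub_const (J0 - 3 * ε))
      (fun t ht => ((hdq t ((ht.trans ht2).trans hT')).const_mul β).sub_const (J0 - 3 * ε)) (by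
        intro t ht hA _
        have hz := hZ t (hlt t ((ht.trans ht2).trans hT'))
        have h2 := hZd t ht hA
        have h3 : 0 < Z t ^ (q - 1) := Real.rpow_pos_of_pos hz _
        have h4 : 0 < β * ((exp (-(θ * t)) * (J t - β * Z t ^ q) - c' * Z t) * q * Z t ^ (q - 1)) := by
          have : 0 < (exp (-(θ * t)) * (J t - β * Z t ^ q) - c' * Z t) := by linarith
          positivity
        exact ⟨h4, h4⟩) (by linarith) (by linarith)
    have ha := anti_Iic (fun t => ε * t - Z t) _ t2
      (fun t ht => ((hasDerivAt_id t).const_mul ε).sub (dZ t (hlt t ((ht.trans ht2).trans hT')))) (by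
        intro t ht
        have := hZd t ht (hp t ht).1
        linarith)
    have hpos : 0 < Zb / ε := by positivity
    have h5 := ha (t2 - Zb / ε) t2 (by linarith) le_rfl
    have h6 := hZle t2 (ht2.trans hT')
    have h7 := hZ (t2 - Zb / ε) (hlt _ (by linarith))
    have h8 : ε * (Zb / ε) = Zb := by field_simp
    nlinarith
  have hlimZ : Tendsto (fun t => β * Z t ^ q) atBot (𝓝 J0) := by
    rw [Metric.tendsto_nhds]
    intro ε hε
    filter_upwards [hlower (ε / 3) (by positivity), eventually_le_atBot T] with t a b
    have := hupper ε hε t b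
    rw [Real.dist_eq, abs_lt]
    constructor <;> linarith
  have hJ0nn : 0 ≤ J0 := ge_of_tendsto hlimZ (by
    filter_upwards [eventually_le_atBot T] with t ht
    have := hZ t (hlt t ht)
    positivity)
  have hJ0pos : 0 < J0 := by
    rcases hJ0nn.lt_or_eq with h | h
    · exact h
    exfalso
    have hZanti := anti_Iic Z _ T (fun t ht => dZ t (hlt t ht)) (by
      intro t ht
      have hz := hZ t (hlt t ht)
      have hj := hJle t ht
      have a1 : 0 < c' * Z t := by positivity
      have a2 : 0 < β * Z t ^ q := by positivity
      have a3 : exp (-(θ * t)) * (J t - β * Z t ^ q) ≤ 0 :=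
        mul_nonpos_of_nonneg_of_nonpos (exp_pos _).le (by linarith)
      linarith)
    have hzT := hZ T (hlt T le_rfl)
    have : β * Z T ^ q ≤ J0 := ge_of_tendsto hlimZ (by
      filter_upwards [eventually_le_atBot T] with t ht
      have := hZanti t T ht le_rfl
      gcongr)
    have h9 : 0 < β * Z T ^ q := by positivity
    linarith
  refine ⟨J0 / β, by positivity, ?_⟩
  have := hlimZ.div_const β
  refine this.congr fun t => ?_
  field_simp

lemma le_of_deriv_nonpos_lim (g g' : ℝ → ℝ) (b l : ℝ) (hg : ∀ x ∈ Ioo 0 b, HasDerivAt g (g' x) x)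
    (h : ∀ x ∈ Ioo 0 b, g' x ≤ 0) (hl : Tendsto g (𝓝[>] 0) (𝓝 l)) : ∀ x ∈ Ioo 0 b, g x ≤ l := by
  intro x hx
  have hanti : AntitoneOn g (Ioo 0 b) := by
    apply antitoneOn_of_deriv_nonpos (convex_Ioo 0 b)
    · exact fun y hy => (hg y hy).continuousAt.continuousWithinAt
    · intro y hy
      rw [interior_Ioo] at hy
      exact (hg y hy).differentiableAt.differentiableWithinAt
    · intro y hy
      rw [interior_Ioo] at hy
      rw [(hg y hy).deriv]; exact h y hy
  apply ge_of_tendsto hl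
  filter_upwards [Ioo_mem_nhdsGT hx.1] with y hy
  exact hanti ⟨hy.1, hy.2.trans hx.2⟩ hx hy.2.le

lemma tendsto_zero_of_abs_le_pow (F : ℝ → ℝ) (M b : ℝ) (n : ℕ) (hb : 0 < b)
    (h : ∀ x ∈ Ioo 0 b, |F x| ≤ M * x ^ (n + 1)) : Tendsto F (𝓝[>] 0) (𝓝 0) := by
  have h1 : Tendsto (fun x : ℝ => M * x ^ (n + 1)) (𝓝[>] 0) (𝓝 0) := by
    have : Tendsto (fun x : ℝ => M * x ^ (n + 1)) (𝓝 0) (𝓝 (M * 0 ^ (n + 1))) := by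
      apply Continuous.tendsto; fun_prop
    simp at this
    exact this.mono_left nhdsWithin_le_nhds
  apply squeeze_zero_norm' _ h1
  filter_upwards [Ioo_mem_nhdsGT hb] with x hx
  exact h x hx

lemma tendsto_rpow_zero_right (e : ℝ) (he : 0 < e) (C : ℝ) :
    Tendsto (fun x : ℝ => C * x ^ e) (𝓝[>] 0) (𝓝 0) := by
  have h := (Real.continuousAt_rpow_const 0 e (Or.inr he.le)).tendsto
  rw [Real.zero_rpow he.ne'] at h
  have h2 := (h.mono_left (nhdsWithin_le_nhds (s := Ioi (0:ℝ)))).const_mul C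
  simpa using h2

/-- Growth bounds near the origin for the vanishing profile. -/
lemma zero_bounds (n : ℕ) (q s σ β c k ξ0 M : ℝ) (Φ F : ℝ → ℝ)
    (hq0 : 0 < q) (hq1 : q < 1) (hs0 : 0 < s) (hσ : 2 < σ) (hβ : 0 < β) (hc : 0 < c) (hk : 0 < k)
    (hkq : q * (k + 2) = k) (hks : s * (k + 2) = k - 2) (hξ0 : 0 < ξ0)
    (dΦ : ∀ ξ ∈ Ioo 0 ξ0, HasDerivAt Φ (F ξ / ξ ^ n - β * ξ * Φ ξ ^ q) ξ)
    (dF : ∀ ξ ∈ Ioo 0 ξ0, HasDerivAt F (ξ ^ n * (c * Φ ξ ^ q - ξ ^ σ * Φ ξ ^ s)) ξ)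
    (hpos : ∀ ξ ∈ Ioo 0 ξ0, 0 < Φ ξ)
    (hFM : ∀ ξ ∈ Ioo 0 ξ0, |F ξ| ≤ M * ξ ^ (n + 1))
    (hlim : Tendsto Φ (𝓝[>] 0) (𝓝 0)) :
    ∃ B ξ1, 0 < ξ1 ∧ ξ1 ≤ ξ0 ∧ ∀ ξ ∈ Ioo 0 ξ1, Φ ξ ≤ B * ξ ^ (k + 2) ∧
      |F ξ| ≤ B * ξ ^ ((n:ℝ) + 1 + k) := by
  have hF0 := tendsto_zero_of_abs_le_pow F M ξ0 n hξ0 hFM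
  obtain ⟨ε, hε, hε1⟩ : ∃ ε > 0, ∀ x ∈ Ioo 0 ε, Φ x < 1 := by
    have := hlim.eventually (gt_mem_nhds (zero_lt_one))
    rw [eventually_nhdsWithin_iff, Metric.eventually_nhds_iff] at this
    obtain ⟨ε, hε, h⟩ := this
    refine ⟨ε, hε, fun x hx => h ?_ hx.1⟩
    rw [Real.dist_eq, sub_zero, abs_of_pos hx.1]; exact hx.2
  obtain ⟨ξ1, hξ1def⟩ : ∃ ξ1, ξ1 = min ξ0 (min ε 1) := ⟨_, rfl⟩
  have hξ1 : 0 < ξ1 := by rw [hξ1def]; positivity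
  have h10 : ξ1 ≤ ξ0 := by rw [hξ1def]; exact min_le_left _ _
  have h1ε : ξ1 ≤ ε := by rw [hξ1def]; exact (min_le_right _ _).trans (min_le_left _ _)
  have h11 : ξ1 ≤ 1 := by rw [hξ1def]; exact (min_le_right _ _).trans (min_le_right _ _)
  have hn1 : (0:ℝ) < n + 1 := by positivity
  -- sup bound
  have key : ∀ x ∈ Ioo 0 ξ1, ∀ S, 0 < S → (∀ y ∈ Ioo 0 x, Φ y ≤ S) →
      ∀ y ∈ Ioo 0 x, Φ y ≤ c * S ^ q * x ^ 2 := by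
    intro x hx S hS hyS
    have hF1 : ∀ y ∈ Ioo 0 x, F y - c * S ^ q * y ^ (n + 1) / (n + 1) ≤ 0 := by
      apply le_of_deriv_nonpos_lim (fun y => F y - c * S ^ q * y ^ (n + 1) / (n + 1))
        (fun y => y ^ n * (c * Φ y ^ q - y ^ σ * Φ y ^ s) - c * S ^ q * y ^ n)
      · intro y hy
        have hd := (dF y ⟨hy.1, by linarith [hy.2, hx.2]⟩).sub
          (((hasDerivAt_pow (n + 1) y).const_mul (c * S ^ q)).div_const ((n:ℝ) + 1))
        refine hd.congr_deriv ?_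
        push_cast
        field_simp
      · intro y hy
        have hyp := hpos y ⟨hy.1, by linarith [hy.2, hx.2]⟩
        have e1 : Φ y ^ q ≤ S ^ q := Real.rpow_le_rpow hyp.le (hyS y hy) hq0.le
        have e2 : 0 ≤ y ^ σ * Φ y ^ s :=
          mul_nonneg (Real.rpow_nonneg hy.1.le _) (Real.rpow_nonneg hyp.le _)
        have e3 : 0 ≤ y ^ n := pow_nonneg hy.1.le _
        have e4 : c * Φ y ^ q - y ^ σ * Φ y ^ s ≤ c * S ^ q := by nlinarith
        nlinarith [mul_le_mul_of_nonneg_left e4 e3]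
      · have := (tendsto_zero_of_abs_le_pow (fun y => c * S ^ q * y ^ (n + 1) / (n + 1))
          (c * S ^ q / (n + 1)) 1 n one_pos (by
            intro y hy
            have : 0 < S ^ q := Real.rpow_pos_of_pos hS q
            have : 0 < y := hy.1
            rw [abs_of_pos (by positivity)]
            apply le_of_eq; ring))
        simpa using hF0.sub this
    have hP1 : ∀ y ∈ Ioo 0 x, Φ y - c * S ^ q * y ^ 2 ≤ 0 := by
      apply le_of_deriv_nonpos_lim (fun y => Φ y - c * S ^ q * y ^ 2)
        (fun y => F y / y ^ n - β * y * Φ y ^ q - c * S ^ q * (2 * y))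
      · intro y hy
        have hd := (dΦ y ⟨hy.1, by linarith [hy.2, hx.2]⟩).sub
          ((hasDerivAt_pow 2 y).const_mul (c * S ^ q))
        refine hd.congr_deriv ?_
        norm_num
      · intro y hy
        have hyp := hpos y ⟨hy.1, by linarith [hy.2, hx.2]⟩
        have e0 : 0 < y := hy.1
        have e1 : F y / y ^ n ≤ c * S ^ q * y := by
          rw [div_le_iff₀ (pow_pos e0 n)]
          have := hF1 y hy
          have e5 : c * S ^ q * y ^ (n + 1) / (n + 1) ≤ c * S ^ q * y ^ (n + 1) := by
            apply div_le_self
            · have : 0 < S ^ q := Real.rpow_pos_of_pos hS q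
              positivity
            · have : (0:ℝ) ≤ n := Nat.cast_nonneg n
              linarith
          calc F y ≤ c * S ^ q * y ^ (n + 1) := by linarith
            _ = c * S ^ q * y * y ^ n := by ring
        have e2 : 0 ≤ β * y * Φ y ^ q := by
          have := Real.rpow_nonneg hyp.le q
          positivity
        have e3 : 0 ≤ c * S ^ q * y := by
          have := Real.rpow_nonneg hS.le q
          positivity
        linarith
      · have h2 : Tendsto (fun y : ℝ => c * S ^ q * y ^ 2) (𝓝[>] 0) (𝓝 (c * S ^ q * 0 ^ 2)) := by
          apply Tendsto.mono_left _ nhdsWithin_le_nhds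
          apply Continuous.tendsto; fun_prop
        simpa using hlim.sub h2
    intro y hy
    have h1 := hP1 y hy
    have h2 : c * S ^ q * y ^ 2 ≤ c * S ^ q * x ^ 2 := by
      have : 0 < S ^ q := Real.rpow_pos_of_pos hS q
      have := hy.1
      have := hy.2.le
      gcongr
    linarith
  obtain ⟨C, hCdef⟩ : ∃ C, C = c ^ ((k + 2) / 2) := ⟨_, rfl⟩
  have hC : 0 < C := by rw [hCdef]; exact Real.rpow_pos_of_pos hc _
  have hΦ1 : ∀ x ∈ Ioo 0 ξ1, ∀ y ∈ Ioo 0 x, Φ y ≤ C * x ^ (k + 2) := by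
    intro x hx y hy
    have hne : (Φ '' Ioo 0 x).Nonempty := ⟨Φ y, y, hy, rfl⟩
    have hbd : BddAbove (Φ '' Ioo 0 x) := by
      refine ⟨1, ?_⟩
      rintro _ ⟨z, hz, rfl⟩
      exact (hε1 z ⟨hz.1, by linarith [hz.2, hx.2]⟩).le
    obtain ⟨S, hSdef⟩ : ∃ S, S = sSup (Φ '' Ioo 0 x) := ⟨_, rfl⟩
    have hle : ∀ z ∈ Ioo 0 x, Φ z ≤ S := by
      intro z hz; rw [hSdef]; exact le_csSup hbd ⟨z, hz, rfl⟩
    have hS : 0 < S := (hpos y ⟨hy.1, by linarith [hy.2, hx.2]⟩).trans_le (hle y hy)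
    have h2 : S ≤ c * S ^ q * x ^ 2 := by
      conv_lhs => rw [hSdef]
      apply csSup_le hne
      rintro _ ⟨z, hz, rfl⟩
      exact key x hx S hS hle z hz
    have h3 : S ^ (1 - q) ≤ c * x ^ 2 := by
      rw [Real.rpow_sub hS, Real.rpow_one, div_le_iff₀ (Real.rpow_pos_of_pos hS q)]
      linarith
    have h4 : (S ^ (1 - q)) ^ ((k + 2) / 2) ≤ (c * x ^ 2) ^ ((k + 2) / 2) :=
      Real.rpow_le_rpow (Real.rpow_nonneg hS.le _) h3 (by positivity)
    rw [← Real.rpow_mul hS.le, Real.mul_rpow hc.le (sq_nonneg x), ← hCdef,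
      ← Real.rpow_natCast, ← Real.rpow_mul hx.1.le] at h4
    have e1 : (1 - q) * ((k + 2) / 2) = 1 := by linarith
    have e2 : ((2:ℕ):ℝ) * ((k + 2) / 2) = k + 2 := by push_cast; ring
    rw [e1, e2, Real.rpow_one] at h4
    exact (hle y hy).trans h4
  have hΦ2 : ∀ x ∈ Ioo 0 ξ1, Φ x ≤ C * x ^ (k + 2) := by
    intro y hy
    have ht : Tendsto (fun x : ℝ => C * x ^ (k + 2)) (𝓝[>] y) (𝓝 (C * y ^ (k + 2))) := by
      apply Tendsto.mono_left _ nhdsWithin_le_nhds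
      exact (Real.continuousAt_rpow_const y (k + 2) (Or.inl hy.1.ne')).tendsto.const_mul C
    apply ge_of_tendsto ht
    filter_upwards [Ioo_mem_nhdsGT hy.2] with x hx
    exact hΦ1 x ⟨hy.1.trans hx.1, hx.2⟩ y ⟨hy.1, hx.1⟩
  have hpw : ∀ x ∈ Ioo 0 ξ1, ∀ e, 0 < e → Φ x ^ e ≤ C ^ e * x ^ (e * (k + 2)) := by
    intro x hx e he
    have := Real.rpow_le_rpow (hpos x ⟨hx.1, hx.2.trans_le h10⟩).le (hΦ2 x hx) he.le
    rwa [Real.mul_rpow hC.le (Real.rpow_nonneg hx.1.le _), ← Real.rpow_mul hx.1.le,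
      mul_comm (k + 2) e] at this
  obtain ⟨B1, hB1⟩ : ∃ B1, B1 = c * C ^ q + C ^ s := ⟨_, rfl⟩
  have hCq : 0 < C ^ q := Real.rpow_pos_of_pos hC q
  have hCs : 0 < C ^ s := Real.rpow_pos_of_pos hC s
  have hB1p : 0 < B1 := by rw [hB1]; positivity
  have he : 0 < (n:ℝ) + 1 + k := by positivity
  have hdp : ∀ y, 0 < y → HasDerivAt (fun y : ℝ => B1 * y ^ ((n:ℝ) + 1 + k))
      (B1 * (((n:ℝ) + 1 + k) * (y ^ n * y ^ k))) y := by
    intro y hy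
    have := (Real.hasDerivAt_rpow_const (x := y) (p := (n:ℝ) + 1 + k) (Or.inl hy.ne')).const_mul B1
    refine this.congr_deriv ?_
    rw [← Real.rpow_natCast, ← Real.rpow_add hy]
    congr 3; ring
  have hbd : ∀ y ∈ Ioo 0 ξ1, |c * Φ y ^ q - y ^ σ * Φ y ^ s| ≤ B1 * y ^ k := by
    intro y hy
    have hyp := hpos y ⟨hy.1, hy.2.trans_le h10⟩
    have e1 := hpw y hy q hq0
    have e2 := hpw y hy s hs0
    rw [hkq] at e1
    rw [hks] at e2
    have e3 : y ^ σ * Φ y ^ s ≤ C ^ s * y ^ k := by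
      calc y ^ σ * Φ y ^ s ≤ y ^ (2:ℝ) * (C ^ s * y ^ (k - 2)) := by
            apply mul_le_mul _ e2 (Real.rpow_nonneg hyp.le _) (Real.rpow_nonneg hy.1.le _)
            exact Real.rpow_le_rpow_of_exponent_ge hy.1 (hy.2.le.trans h11) hσ.le
        _ = C ^ s * (y ^ (2:ℝ) * y ^ (k - 2)) := by ring
        _ = C ^ s * y ^ k := by
          rw [← Real.rpow_add hy.1]; congr 2; ring
    have e4 : 0 ≤ y ^ σ * Φ y ^ s :=
          mul_nonneg (Real.rpow_nonneg hy.1.le _) (Real.rpow_nonneg hyp.le _)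
    have e5 : 0 ≤ Φ y ^ q := (Real.rpow_nonneg hyp.le _)
    have e6 : 0 < y ^ k := Real.rpow_pos_of_pos hy.1 _
    rw [abs_le, hB1]
    constructor <;> nlinarith [mul_pos hCs e6, mul_pos hCq e6]
  have hlim2 : Tendsto (fun y : ℝ => B1 * y ^ ((n:ℝ) + 1 + k)) (𝓝[>] 0) (𝓝 0) :=
    tendsto_rpow_zero_right _ he _
  have habs : ∀ y ∈ Ioo 0 ξ1, |y ^ n * (c * Φ y ^ q - y ^ σ * Φ y ^ s)| ≤
      B1 * (((n:ℝ) + 1 + k) * (y ^ n * y ^ k)) := by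
    intro y hy
    have e3 : 0 ≤ y ^ n := pow_nonneg hy.1.le _
    have e6 : 0 < y ^ k := Real.rpow_pos_of_pos hy.1 _
    rw [abs_mul, abs_of_nonneg e3]
    calc y ^ n * |c * Φ y ^ q - y ^ σ * Φ y ^ s| ≤ y ^ n * (B1 * y ^ k) :=
          mul_le_mul_of_nonneg_left (hbd y hy) e3
      _ = 1 * (B1 * (y ^ n * y ^ k)) := by ring
      _ ≤ ((n:ℝ) + 1 + k) * (B1 * (y ^ n * y ^ k)) := by
          apply mul_le_mul_of_nonneg_right _ (by positivity)
          have : (0:ℝ) ≤ n := Nat.cast_nonneg n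
          linarith
      _ = _ := by ring
  have hFu : ∀ y ∈ Ioo 0 ξ1, F y - B1 * y ^ ((n:ℝ) + 1 + k) ≤ 0 := by
    apply le_of_deriv_nonpos_lim (fun y => F y - B1 * y ^ ((n:ℝ) + 1 + k)) _ ξ1 0
      (fun y hy => (dF y ⟨hy.1, hy.2.trans_le h10⟩).sub (hdp y hy.1))
    · intro y hy
      have := (abs_le.1 (habs y hy)).2
      linarith
    · simpa using hF0.sub hlim2
  have hFl : ∀ y ∈ Ioo 0 ξ1, -F y - B1 * y ^ ((n:ℝ) + 1 + k) ≤ 0 := by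
    apply le_of_deriv_nonpos_lim (fun y => -F y - B1 * y ^ ((n:ℝ) + 1 + k)) _ ξ1 0
      (fun y hy => (dF y ⟨hy.1, hy.2.trans_le h10⟩).neg.sub (hdp y hy.1))
    · intro y hy
      have := (abs_le.1 (habs y hy)).1
      linarith
    · simpa using hF0.neg.sub hlim2
  refine ⟨max C B1, ξ1, hξ1, h10, fun x hx => ⟨?_, ?_⟩⟩
  · have e6 : 0 < x ^ (k + 2) := Real.rpow_pos_of_pos hx.1 _
    exact (hΦ2 x hx).trans (mul_le_mul_of_nonneg_right (le_max_left _ _) e6.le)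
  · have e6 : 0 < x ^ ((n:ℝ) + 1 + k) := Real.rpow_pos_of_pos hx.1 _
    refine le_trans ?_ (mul_le_mul_of_nonneg_right (le_max_right _ _) e6.le)
    rw [abs_le]
    constructor
    · linarith [hFl x hx]
    · linarith [hFu x hx]

lemma log_deriv (G : ℝ → ℝ) (d e t : ℝ) (h : HasDerivAt G d (exp t)) :
    HasDerivAt (fun t => G (exp t) * exp (-(e * t)))
      (d * exp t * exp (-(e * t)) - e * (G (exp t) * exp (-(e * t)))) t := by
  have h1 : HasDerivAt (fun t => G (exp t)) (d * exp t) t := h.comp t (Real.hasDerivAt_exp t)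
  have h2 := h1.mul (hasDerivAt_exp_neg_mul e t)
  refine h2.congr_deriv ?_
  ring

lemma mul_exp_rpow (A x q : ℝ) (hA : 0 ≤ A) : (A * exp x) ^ q = A ^ q * exp (q * x) := by
  rw [Real.mul_rpow hA (exp_pos x).le, ← Real.exp_mul, mul_comm x q]

lemma back_to_xi (G : ℝ → ℝ) (q e e2 ξ0 K : ℝ) (hξ0 : 0 < ξ0) (hG : ∀ ξ ∈ Ioo 0 ξ0, 0 < G ξ)
    (he : q * e = e2)
    (h : Tendsto (fun t => (G (exp t) * exp (-(e * t))) ^ q) atBot (𝓝 K)) :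
    Tendsto (fun ξ => G ξ ^ q * ξ ^ (-e2)) (𝓝[>] 0) (𝓝 K) := by
  refine (h.comp Real.tendsto_log_nhdsGT_zero).congr' ?_
  filter_upwards [Ioo_mem_nhdsGT hξ0] with x hx
  simp only [Function.comp]
  rw [Real.exp_log hx.1, mul_exp_rpow _ _ _ (hG x hx).le, Real.rpow_def_of_pos hx.1]
  congr 2
  rw [← he]; ring

lemma zero_case (n : ℕ) (q s σ β c k a a2 θ ξ0 M φs : ℝ) (Φ F : ℝ → ℝ)
    (hq0 : 0 < q) (hq1 : q < 1) (hs0 : 0 < s) (hs1 : s ≤ 1) (hθ : 0 < θ) (hσ : σ = 2 + 2 * θ)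
    (hβ : 0 < β) (hk : 0 < k) (hka : k < a)
    (hkq : q * (k + 2) = k) (hks : s * (k + 2) = k - 2)
    (haq : q * a2 = a) (has : s * a2 = a - 2 - θ) (ha2 : a2 = a + 2 + θ)
    (hc : c = β * (a + (n + 1))) (hξ0 : 0 < ξ0) (hφs : 0 < φs)
    (hφs2 : β * (a - k) * φs ^ q = (n + 1 + k) * (k + 2) * φs)
    (dΦ : ∀ ξ ∈ Ioo 0 ξ0, HasDerivAt Φ (F ξ / ξ ^ n - β * ξ * Φ ξ ^ q) ξ)
    (dF : ∀ ξ ∈ Ioo 0 ξ0, HasDerivAt F (ξ ^ n * (c * Φ ξ ^ q - ξ ^ σ * Φ ξ ^ s)) ξ)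
    (hpos : ∀ ξ ∈ Ioo 0 ξ0, 0 < Φ ξ)
    (hFM : ∀ ξ ∈ Ioo 0 ξ0, |F ξ| ≤ M * ξ ^ (n + 1))
    (hlim : Tendsto Φ (𝓝[>] 0) (𝓝 0)) :
    Tendsto (fun ξ => Φ ξ ^ q * ξ ^ (-k)) (𝓝[>] 0) (𝓝 (φs ^ q)) ∨
    ∃ K, 0 < K ∧ Tendsto (fun ξ => Φ ξ ^ q * ξ ^ (-a)) (𝓝[>] 0) (𝓝 K) := by
  have hcp : 0 < c := by rw [hc]; have := hk.trans hka; positivity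
  obtain ⟨B, ξ1, hξ1, h10, hB⟩ := zero_bounds n q s σ β c k ξ0 M Φ F hq0 hq1 hs0 (by linarith) hβ
    hcp hk hkq hks hξ0 dΦ dF hpos hFM hlim
  have hmem : ∀ t < log ξ1, exp t ∈ Ioo 0 ξ1 := fun t ht =>
    ⟨exp_pos t, by rwa [Real.lt_log_iff_exp_lt hξ1] at ht⟩
  have hmem0 : ∀ t < log ξ1, exp t ∈ Ioo 0 ξ0 := fun t ht =>
    ⟨exp_pos t, (hmem t ht).2.trans_le h10⟩
  have hexn : ∀ t, (exp t) ^ n = exp (n * t) := fun t => by rw [Real.exp_nat_mul]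
  have hexr : ∀ t e, (exp t) ^ (e:ℝ) = exp (e * t) := fun t e => by
    rw [← Real.exp_mul, mul_comm]
  have hφpos : ∀ t < log ξ1, 0 < Φ (exp t) * exp (-((k + 2) * t)) := fun t ht =>
    mul_pos (hpos _ (hmem0 t ht)) (exp_pos _)
  have hdic := dichotomy (fun t => Φ (exp t) * exp (-((k + 2) * t)))
    (fun t => F (exp t) * exp (-((n + 1 + k) * t))) (log ξ1) β q s c (n + 1 + k) (k + 2) (σ - 2)
    B φs hq0 hq1 hs0 hβ (by have : (0:ℝ) ≤ n := Nat.cast_nonneg n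
                            linarith) (by linarith) (by linarith)
    (by
      intro t ht
      refine (log_deriv Φ _ (k + 2) t (dΦ _ (hmem0 t ht))).congr_deriv ?_
      rw [mul_exp_rpow _ _ _ (hpos _ (hmem0 t ht)).le, hexn, div_eq_mul_inv, ← Real.exp_neg]
      have e1 : exp (-(n * t)) * exp t * exp (-((k + 2) * t)) = exp (-((n + 1 + k) * t)) := by
        rw [← exp_add, ← exp_add]; congr 1; ring
      have e2 : exp t * exp t * exp (-((k + 2) * t)) = exp (q * (-((k + 2) * t))) := by
        rw [← exp_add, ← exp_add]; congr 1; linear_combination (t * hkq)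
      linear_combination F (exp t) * e1 - β * Φ (exp t) ^ q * e2)
    (by
      intro t ht
      refine (log_deriv F _ (n + 1 + k) t (dF _ (hmem0 t ht))).congr_deriv ?_
      rw [mul_exp_rpow _ _ _ (hpos _ (hmem0 t ht)).le, mul_exp_rpow _ _ _ (hpos _ (hmem0 t ht)).le,
        hexn, hexr]
      have e1 : exp (n * t) * exp t * exp (-((n + 1 + k) * t)) = exp (q * (-((k + 2) * t))) := by
        rw [← exp_add, ← exp_add]; congr 1; linear_combination (t * hkq)
      have e2 : exp (n * t) * exp (σ * t) * exp t * exp (-((n + 1 + k) * t)) =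
          exp ((σ - 2) * t) * exp (s * (-((k + 2) * t))) := by
        rw [← exp_add, ← exp_add, ← exp_add, ← exp_add]; congr 1; linear_combination (t * hks)
      linear_combination c * Φ (exp t) ^ q * e1 - Φ (exp t) ^ s * e2)
    hφpos
    (by
      intro t ht
      have := (hB _ (hmem t ht)).1
      rw [hexr] at this
      have h2 := mul_le_mul_of_nonneg_right this (exp_pos (-((k + 2) * t))).le
      rwa [mul_assoc, ← exp_add, add_neg_cancel, exp_zero, mul_one] at h2)
    (by
      intro t ht
      have := (hB _ (hmem t ht)).2
      rw [hexr] at this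
      have h2 := mul_le_mul_of_nonneg_right this (exp_pos (-((n + 1 + k) * t))).le
      rw [mul_assoc, ← exp_add, add_neg_cancel, exp_zero, mul_one] at h2
      rwa [abs_mul, abs_of_pos (exp_pos _)])
    (by
      have : c - (n + 1 + k) * β = β * (a - k) := by rw [hc]; ring
      rw [this]; exact mul_pos hβ (by linarith))
    hφs
    (by
      rw [← hφs2, hc]; ring)
  rcases hdic with h0 | h1
  · right
    have hpw : Tendsto (fun t => (Φ (exp t) * exp (-((k + 2) * t))) ^ (1 - q)) atBot (𝓝 0) := by
      have := h0.rpow_const (p := 1 - q) (Or.inr (by linarith))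
      rwa [Real.zero_rpow (by linarith)] at this
    obtain ⟨K, hK, hK2⟩ := b3_main (fun t => Φ (exp t) * exp (-(a2 * t)))
      (fun t => F (exp t) * exp (-((n + 1 + a) * t)) +
        (a + n + 1) * (Φ (exp t) * exp (-((a + 2) * t)))) (log ξ1) β q s θ (a2 + a + n + 1)
      ((a + n + 1) * (a + 2)) hq0 hq1 hs0.le hs1 hβ hθ
      (by have : 0 < a := by linarith
          rw [ha2]; positivity)
      (by have : 0 < a := by linarith
          positivity)
      (fun t ht => mul_pos (hpos _ (hmem0 t ht)) (exp_pos _))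
      (by
        intro t ht
        refine (log_deriv Φ _ a2 t (dΦ _ (hmem0 t ht))).congr_deriv ?_
        rw [mul_exp_rpow _ _ _ (hpos _ (hmem0 t ht)).le, hexn, div_eq_mul_inv, ← Real.exp_neg]
        have e1 : exp (-(n * t)) * exp t * exp (-(a2 * t)) =
            exp (-(θ * t)) * exp (-((n + 1 + a) * t)) := by
          rw [← exp_add, ← exp_add, ← exp_add]; congr 1; rw [ha2]; ring
        have e2 : exp t * exp t * exp (-(a2 * t)) = exp (-(θ * t)) * exp (q * (-(a2 * t))) := by
          rw [← exp_add, ← exp_add, ← exp_add]; congr 1; linear_combination (t * haq - t * ha2)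
        have e3 : exp (-(θ * t)) * exp (-((a + 2) * t)) = exp (-(a2 * t)) := by
          rw [← exp_add]; congr 1; rw [ha2]; ring
        linear_combination F (exp t) * e1 - β * Φ (exp t) ^ q * e2 - (a + n + 1) * Φ (exp t) * e3)
      (by
        intro t ht
        refine ((log_deriv F _ (n + 1 + a) t (dF _ (hmem0 t ht))).add
          ((log_deriv Φ _ (a + 2) t (dΦ _ (hmem0 t ht))).const_mul (a + n + 1))).congr_deriv ?_
        rw [mul_exp_rpow _ _ _ (hpos _ (hmem0 t ht)).le, hexn, hexr, div_eq_mul_inv, ← Real.exp_neg]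
        have e1 : exp (n * t) * exp t * exp (-((n + 1 + a) * t)) = exp (-(a * t)) := by
          rw [← exp_add, ← exp_add]; congr 1; ring
        have e2 : exp t * exp t * exp (-((a + 2) * t)) = exp (-(a * t)) := by
          rw [← exp_add, ← exp_add]; congr 1; ring
        have e3 : exp (n * t) * exp (σ * t) * exp t * exp (-((n + 1 + a) * t)) =
            exp (θ * t) * exp (s * (-(a2 * t))) := by
          rw [← exp_add, ← exp_add, ← exp_add, ← exp_add]; congr 1
          linear_combination t * hσ + t * has
        have e4 : exp (-(n * t)) * exp t * exp (-((a + 2) * t)) = exp (-((n + 1 + a) * t)) := by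
          rw [← exp_add, ← exp_add]; congr 1; ring
        have e5 : exp (θ * t) * exp (-(a2 * t)) = exp (-((a + 2) * t)) := by
          rw [← exp_add]; congr 1; rw [ha2]; ring
        linear_combination c * Φ (exp t) ^ q * e1 - Φ (exp t) ^ s * e3
          + (a + n + 1) * F (exp t) * e4 - β * (a + n + 1) * Φ (exp t) ^ q * e2
          + (a + n + 1) * (a + 2) * Φ (exp t) * e5 + Φ (exp t) ^ q * exp (-(a * t)) * hc)
      (by
        refine hpw.congr' ?_
        filter_upwards [eventually_lt_atBot (log ξ1)] with t ht
        rw [mul_exp_rpow _ _ _ (hpos _ (hmem0 t ht)).le, mul_exp_rpow _ _ _ (hpos _ (hmem0 t ht)).le,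
          mul_assoc, ← exp_add]
        congr 2
        linear_combination (t * hkq - t * haq + t * ha2))
    exact ⟨K, hK, back_to_xi Φ q a2 a ξ0 K hξ0 hpos haq hK2⟩
  · left
    exact back_to_xi Φ q (k + 2) k ξ0 _ hξ0 hpos hkq (h1.rpow_const (Or.inr hq0.le))

lemma lip_extend (G G' : ℝ → ℝ) (a b C : ℝ) (hG : ∀ x ∈ Ioo a b, HasDerivAt G (G' x) x)
    (hC : ∀ x ∈ Ioo a b, |G' x| ≤ C) : ∃ g : ℝ → ℝ, Continuous g ∧ EqOn G g (Ioo a b) := by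
  have h : LipschitzOnWith (Real.toNNReal (max C 0)) G (Ioo a b) := by
    apply Convex.lipschitzOnWith_of_nnnorm_hasDerivWithin_le (convex_Ioo a b)
      (fun x hx => (hG x hx).hasDerivWithinAt)
    intro x hx
    rw [← NNReal.coe_le_coe, coe_nnnorm, Real.norm_eq_abs, Real.coe_toNNReal _ (le_max_right _ _)]
    exact (hC x hx).trans (le_max_left _ _)
  obtain ⟨g, hg, he⟩ := h.extend_real
  exact ⟨g, hg.continuous, he⟩

lemma b1_case (n : ℕ) (q s σ β α c ξ0 M A : ℝ) (Φ F : ℝ → ℝ)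
    (hq0 : 0 < q) (hq1 : q < 1) (hσ : 0 < σ)
    (hc : c = α + (n + 1) * β) (hξ0 : 0 < ξ0)
    (dΦ : ∀ ξ ∈ Ioo 0 ξ0, HasDerivAt Φ (F ξ / ξ ^ n - β * ξ * Φ ξ ^ q) ξ)
    (dF : ∀ ξ ∈ Ioo 0 ξ0, HasDerivAt F (ξ ^ n * (c * Φ ξ ^ q - ξ ^ σ * Φ ξ ^ s)) ξ)
    (hpos : ∀ ξ ∈ Ioo 0 ξ0, 0 < Φ ξ)
    (hFM : ∀ ξ ∈ Ioo 0 ξ0, |F ξ| ≤ M * ξ ^ (n + 1))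
    (hA : 0 < A) (hlim : Tendsto Φ (𝓝[>] 0) (𝓝 A)) :
    Tendsto (fun ξ => (Φ ξ ^ (1 - q) - A ^ (1 - q)) / ξ ^ 2) (𝓝[>] 0)
      (𝓝 ((1 - q) * α / (2 * (n + 1)))) := by
  have hF0 := tendsto_zero_of_abs_le_pow F M ξ0 n hξ0 hFM
  have hn1 : (0:ℝ) < n + 1 := by positivity
  have hev : ∀ᶠ ξ in 𝓝[>] (0:ℝ), ξ ∈ Ioo 0 ξ0 := Ioo_mem_nhdsGT hξ0
  have hΦq : ∀ e : ℝ, Tendsto (fun ξ => Φ ξ ^ e) (𝓝[>] 0) (𝓝 (A ^ e)) := fun e =>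
    hlim.rpow_const (Or.inl hA.ne')
  have hF1 : Tendsto (fun ξ => F ξ / ξ ^ (n + 1)) (𝓝[>] 0) (𝓝 (c * A ^ q / (n + 1))) := by
    refine HasDerivAt.lhopital_zero_nhdsGT
      (f' := fun ξ => ξ ^ n * (c * Φ ξ ^ q - ξ ^ σ * Φ ξ ^ s))
      (g' := fun ξ => ((n:ℝ) + 1) * ξ ^ n) ?_ ?_ ?_ hF0 ?_ ?_
    · filter_upwards [hev] with x hx using dF x hx
    · filter_upwards [hev] with x hx
      have := hasDerivAt_pow (n + 1) x
      refine this.congr_deriv ?_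
      push_cast; simp
    · filter_upwards [hev] with x hx
      have := hx.1
      positivity
    · exact tendsto_zero_of_abs_le_pow _ 1 1 n one_pos (fun x hx => by
        have := hx.1
        rw [abs_of_pos (by positivity), one_mul])
    · have h1 : Tendsto (fun ξ : ℝ => (c * Φ ξ ^ q - (1 * ξ ^ σ) * Φ ξ ^ s) / (n + 1)) (𝓝[>] 0)
          (𝓝 ((c * A ^ q - 0 * A ^ s) / (n + 1))) :=
        (((hΦq q).const_mul c).sub ((tendsto_rpow_zero_right σ hσ 1).mul (hΦq s))).div_const _
      rw [zero_mul, sub_zero] at h1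
      refine h1.congr' ?_
      filter_upwards [hev] with x hx
      have := hx.1
      field_simp
  refine HasDerivAt.lhopital_zero_nhdsGT
      (f' := fun ξ => (F ξ / ξ ^ n - β * ξ * Φ ξ ^ q) * (1 - q) * Φ ξ ^ (1 - q - 1))
      (g' := fun ξ => 2 * ξ) ?_ ?_ ?_ ?_ ?_ ?_
  · filter_upwards [hev] with x hx
    exact ((dΦ x hx).rpow_const (Or.inl (hpos x hx).ne')).sub_const _
  · filter_upwards [hev] with x hx
    have := hasDerivAt_pow 2 x
    refine this.congr_deriv ?_
    norm_num
  · filter_upwards [hev] with x hx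
    have := hx.1
    positivity
  · simpa using (hΦq (1 - q)).sub_const (A ^ (1 - q))
  · exact tendsto_zero_of_abs_le_pow _ 1 1 1 one_pos (fun x hx => by
        have := hx.1
        rw [abs_of_pos (by positivity), one_mul])
  · have h1 : Tendsto (fun ξ : ℝ => (F ξ / ξ ^ (n + 1) - β * Φ ξ ^ q) * (1 - q) / 2 * Φ ξ ^ (-q))
        (𝓝[>] 0) (𝓝 ((c * A ^ q / (n + 1) - β * A ^ q) * (1 - q) / 2 * A ^ (-q))) :=
      (((hF1.sub ((hΦq q).const_mul β)).mul_const _).div_const _).mul (hΦq (-q))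
    have e1 : (c * A ^ q / (n + 1) - β * A ^ q) * (1 - q) / 2 * A ^ (-q) =
        (1 - q) * α / (2 * (n + 1)) := by
      have : A ^ q * A ^ (-q) = 1 := by rw [← Real.rpow_add hA]; simp
      rw [hc]
      have e2 : ((α + (n + 1) * β) * A ^ q / (n + 1) - β * A ^ q) * (1 - q) / 2 * A ^ (-q)
        = (A ^ q * A ^ (-q)) * ((1 - q) * α / (2 * (n + 1))) := by
        field_simp
        ring
      rw [e2, this, one_mul]
    rw [e1] at h1
    refine h1.congr' ?_
    filter_upwards [hev] with x hx
    have := hx.1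
    have e3 : 1 - q - 1 = -q := by ring
    rw [e3, pow_succ]
    field_simp

lemma interface_deriv (n : ℕ) (q β r μ ξ0 M : ℝ) (Φ F F' : ℝ → ℝ)
    (hq0 : 0 < q) (hr : 1 < r) (hξ0 : 0 < ξ0)
    (dΦ : ∀ ξ ∈ Ioo 0 ξ0, HasDerivAt Φ (F ξ / ξ ^ n - β * ξ * Φ ξ ^ q) ξ)
    (dF : ∀ ξ ∈ Ioo 0 ξ0, HasDerivAt F (F' ξ) ξ)
    (hF' : ∀ ξ ∈ Ioo 0 ξ0, |F' ξ| ≤ M)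
    (hμ : 0 < μ)
    (hpos : ∀ ξ ∈ Ioo 0 ξ0, 0 < Φ ξ)
    (hup : ∀ ξ ∈ Ioo 0 ξ0, Φ ξ ≤ (μ / 2 * (ξ0 ^ 2 - ξ ^ 2)) ^ (r + 1)) :
    Tendsto Φ (𝓝[<] ξ0) (𝓝 0) ∧
    Tendsto (fun ξ => F ξ / ξ ^ n - β * ξ * Φ ξ ^ q) (𝓝[<] ξ0) (𝓝 0) := by
  have hev : ∀ᶠ ξ in 𝓝[<] ξ0, ξ ∈ Ioo 0 ξ0 := Ioo_mem_nhdsLT hξ0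
  obtain ⟨g, hg, hgF⟩ := lip_extend F F' 0 ξ0 M dF hF'
  obtain ⟨C, hCd⟩ : ∃ C, C = μ / 2 * (2 * ξ0) := ⟨_, rfl⟩
  have hC : 0 < C := by rw [hCd]; positivity
  have hup2 : ∀ ξ ∈ Ioo 0 ξ0, Φ ξ ≤ C ^ (r + 1) * (ξ0 - ξ) ^ (r + 1) := by
    intro x hx
    have hx1 := hx.1
    have hx2 := hx.2
    refine (hup x hx).trans ?_
    rw [← Real.mul_rpow hC.le (by linarith)]
    apply Real.rpow_le_rpow
    · have : 0 ≤ ξ0 ^ 2 - x ^ 2 := by nlinarith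
      positivity
    · rw [hCd]
      have : ξ0 ^ 2 - x ^ 2 ≤ 2 * ξ0 * (ξ0 - x) := by nlinarith [sq_nonneg (ξ0 - x)]
      calc μ / 2 * (ξ0 ^ 2 - x ^ 2) ≤ μ / 2 * (2 * ξ0 * (ξ0 - x)) := by gcongr
        _ = _ := by ring
    · linarith
  have hpl : ∀ e : ℝ, 0 < e → Tendsto (fun ξ => C ^ (r + 1) * (ξ0 - ξ) ^ e) (𝓝[<] ξ0) (𝓝 0) := by
    intro e he
    have h1 : Tendsto (fun ξ : ℝ => ξ0 - ξ) (𝓝[<] ξ0) (𝓝 0) := by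
      have : Tendsto (fun ξ : ℝ => ξ0 - ξ) (𝓝 ξ0) (𝓝 (ξ0 - ξ0)) := by
        apply Continuous.tendsto; fun_prop
      rw [sub_self] at this
      exact this.mono_left nhdsWithin_le_nhds
    have h2 := (h1.rpow_const (p := e) (Or.inr he.le)).const_mul (C ^ (r + 1))
    rwa [Real.zero_rpow he.ne', mul_zero] at h2
  have hΦ0 : Tendsto Φ (𝓝[<] ξ0) (𝓝 0) := by
    refine squeeze_zero' ?_ ?_ (hpl (r + 1) (by linarith))
    · filter_upwards [hev] with x hx using (hpos x hx).le
    · filter_upwards [hev] with x hx using hup2 x hx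
  refine ⟨hΦ0, ?_⟩
  have hid : Tendsto (fun ξ : ℝ => ξ) (𝓝[<] ξ0) (𝓝 ξ0) := tendsto_id.mono_left nhdsWithin_le_nhds
  have hFl : Tendsto F (𝓝[<] ξ0) (𝓝 (g ξ0)) := by
    refine ((hg.tendsto ξ0).mono_left nhdsWithin_le_nhds).congr' ?_
    filter_upwards [hev] with x hx using (hgF hx).symm
  have hD : Tendsto (fun ξ => F ξ / ξ ^ n - β * ξ * Φ ξ ^ q) (𝓝[<] ξ0)
      (𝓝 (g ξ0 / ξ0 ^ n - β * ξ0 * 0 ^ q)) :=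
    (hFl.div (hid.pow n) (by positivity)).sub
      ((hid.const_mul β).mul (hΦ0.rpow_const (Or.inr hq0.le)))
  have hlh : Tendsto (fun ξ => Φ ξ / (ξ0 - ξ)) (𝓝[<] ξ0)
      (𝓝 ((g ξ0 / ξ0 ^ n - β * ξ0 * 0 ^ q) / (-1))) := by
    refine HasDerivAt.lhopital_zero_nhdsLT (f' := fun ξ => F ξ / ξ ^ n - β * ξ * Φ ξ ^ q)
      (g' := fun ξ => -1) ?_ ?_ ?_ hΦ0 ?_ (hD.div_const _)
    · filter_upwards [hev] with x hx using dΦ x hx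
    · filter_upwards [hev] with x hx
      exact (hasDerivAt_id x).const_sub ξ0
    · filter_upwards [hev] with x hx
      norm_num
    · simpa using hid.const_sub ξ0
  have hz : Tendsto (fun ξ => Φ ξ / (ξ0 - ξ)) (𝓝[<] ξ0) (𝓝 0) := by
    refine squeeze_zero' ?_ ?_ (hpl r (by linarith))
    · filter_upwards [hev] with x hx
      exact div_nonneg (hpos x hx).le (by linarith [hx.2])
    · filter_upwards [hev] with x hx
      have h3 : 0 < ξ0 - x := by linarith [hx.2]
      rw [div_le_iff₀ h3, mul_assoc]
      have := hup2 x hx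
      rwa [Real.rpow_add h3, Real.rpow_one] at this
  have := tendsto_nhds_unique hlh hz
  have e : g ξ0 / ξ0 ^ n - β * ξ0 * 0 ^ q = 0 := by linarith
  rwa [e] at hD

lemma profile_of_system (n : ℕ) (m p q s σ r μ A ξ0 M2 : ℝ) (Φ F : ℝ → ℝ)
    (hm : 1 < m) (hq : q = 1 / m) (hs : s = p / m) (hr : 1 < r) (hξ0 : 0 < ξ0) (hμ : 0 < μ)
    (dΦ : ∀ ξ ∈ Ioo 0 ξ0, HasDerivAt Φ (F ξ / ξ ^ n - betaC m p σ * ξ * Φ ξ ^ q) ξ)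
    (dF : ∀ ξ ∈ Ioo 0 ξ0, HasDerivAt F (ξ ^ n * ((alphaC m p σ + (n + 1) * betaC m p σ) * Φ ξ ^ q
      - ξ ^ σ * Φ ξ ^ s)) ξ)
    (hF' : ∀ ξ ∈ Ioo 0 ξ0, |ξ ^ n * ((alphaC m p σ + (n + 1) * betaC m p σ) * Φ ξ ^ q
      - ξ ^ σ * Φ ξ ^ s)| ≤ M2)
    (hpos : ∀ ξ ∈ Ioo 0 ξ0, 0 < Φ ξ)
    (hup : ∀ ξ ∈ Ioo 0 ξ0, Φ ξ ≤ (μ / 2 * (ξ0 ^ 2 - ξ ^ 2)) ^ (r + 1))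
    (hlim : Tendsto Φ (𝓝[>] 0) (𝓝 A)) (f : ℝ → ℝ)
    (hf0 : f 0 = A ^ q) (hfξ0 : f ξ0 = 0) (hf : ∀ ξ ∈ Ioo 0 ξ0, f ξ = Φ ξ ^ q) :
    ProfileWithInterface (n + 1) m p σ f ξ0 := by
  have hm0 : 0 < m := by linarith
  have hq0 : 0 < q := by rw [hq]; positivity
  have hqm : q * m = 1 := by rw [hq]; field_simp
  have hqp : q * p = s := by rw [hq, hs]; ring
  obtain ⟨hI1, hI2⟩ := interface_deriv n q (betaC m p σ) r μ ξ0 M2 Φ F _ hq0 hr hξ0 dΦ dF hF' hμ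
    hpos hup
  obtain ⟨D, hD⟩ : ∃ D : ℝ → ℝ, D = fun ξ => F ξ / ξ ^ n - betaC m p σ * ξ * Φ ξ ^ q := ⟨_, rfl⟩
  have hnb : ∀ ξ ∈ Ioo 0 ξ0, ∀ᶠ x in 𝓝 ξ, x ∈ Ioo 0 ξ0 := fun ξ hξ => isOpen_Ioo.mem_nhds hξ
  have hfe : ∀ ξ ∈ Ioo 0 ξ0, f =ᶠ[𝓝 ξ] fun x => Φ x ^ q := by
    intro ξ hξ
    filter_upwards [hnb ξ hξ] with x hx using hf x hx
  have hfm : ∀ ξ ∈ Ioo 0 ξ0, (fun x => f x ^ m) =ᶠ[𝓝 ξ] Φ := by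
    intro ξ hξ
    filter_upwards [hnb ξ hξ] with x hx
    rw [hf x hx, ← Real.rpow_mul (hpos x hx).le, hqm, Real.rpow_one]
  have hdfm : ∀ ξ ∈ Ioo 0 ξ0, deriv (fun x => f x ^ m) ξ = D ξ := by
    intro ξ hξ
    rw [(hfm ξ hξ).deriv_eq, (dΦ ξ hξ).deriv, hD]
  have hΦq : ∀ ξ ∈ Ioo 0 ξ0, HasDerivAt (fun x => Φ x ^ q) (D ξ * q * Φ ξ ^ (q - 1)) ξ := by
    intro ξ hξ
    have := (dΦ ξ hξ).rpow_const (p := q) (Or.inl (hpos ξ hξ).ne')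
    rw [hD]; exact this
  refine ⟨hξ0, ?_, ?_, ?_, ?_, hfξ0, ?_⟩
  · intro x hx
    rcases eq_or_lt_of_le hx.1 with h0 | h0
    · rw [← h0]
      have h1 : Tendsto f (𝓝[>] 0) (𝓝 (f 0)) := by
        rw [hf0]
        refine (hlim.rpow_const (Or.inr hq0.le)).congr' ?_
        filter_upwards [Ioo_mem_nhdsGT hξ0] with x hx using (hf x hx).symm
      have h2 : ContinuousWithinAt f (Ioi 0) 0 := h1
      have h3 := continuousWithinAt_insert_self.2 h2
      rw [Ioi_insert] at h3
      exact h3.mono Icc_subset_Ici_self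
    · rcases eq_or_lt_of_le hx.2 with h4 | h4
      · rw [h4]
        have h1 : Tendsto f (𝓝[<] ξ0) (𝓝 (f ξ0)) := by
          rw [hfξ0]
          have := (hI1.rpow_const (p := q) (Or.inr hq0.le))
          rw [Real.zero_rpow hq0.ne'] at this
          refine this.congr' ?_
          filter_upwards [Ioo_mem_nhdsLT hξ0] with x hx using (hf x hx).symm
        have h2 : ContinuousWithinAt f (Iio ξ0) ξ0 := h1
        have h3 := continuousWithinAt_insert_self.2 h2
        rw [Iio_insert] at h3
        exact h3.mono Icc_subset_Iic_self
      · exact ((hΦq x ⟨h0, h4⟩).continuousAt.congr (hfe x ⟨h0, h4⟩).symm).continuousWithinAt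
  · intro x hx
    rw [hf x hx]; exact Real.rpow_pos_of_pos (hpos x hx) q
  · have hne : ∀ x ∈ Ioo 0 ξ0, Φ x ≠ 0 := fun x hx => (hpos x hx).ne'
    have hxn : ContDiffOn ℝ 1 (fun x : ℝ => x ^ n) (Ioo 0 ξ0) := by fun_prop
    have step : ∀ (G G' : ℝ → ℝ) (j : ℕ), (∀ x ∈ Ioo 0 ξ0, HasDerivAt G (G' x) x) →
        ContDiffOn ℝ j G' (Ioo 0 ξ0) → ContDiffOn ℝ (j + 1) G (Ioo 0 ξ0) := by
      intro G G' j h1 h2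
      rw [contDiffOn_succ_iff_deriv_of_isOpen isOpen_Ioo]
      refine ⟨fun x hx => (h1 x hx).differentiableAt.differentiableWithinAt, fun h => ?_,
        h2.congr fun x hx => (h1 x hx).deriv⟩
      exact absurd h (by simp)
    have hΦc : ContinuousOn Φ (Ioo 0 ξ0) := fun x hx => (dΦ x hx).continuousAt.continuousWithinAt
    have hFc : ContinuousOn F (Ioo 0 ξ0) := fun x hx => (dF x hx).continuousAt.continuousWithinAt
    have hpc : ∀ e : ℝ, ContinuousOn (fun x => Φ x ^ e) (Ioo 0 ξ0) := fun e =>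
      hΦc.rpow_const (fun x hx => Or.inl (hne x hx))
    have hσc : ContinuousOn (fun x : ℝ => x ^ σ) (Ioo 0 ξ0) :=
      continuousOn_id.rpow_const (fun x hx => Or.inl (ne_of_gt hx.1))
    have hpn : ∀ x ∈ Ioo 0 ξ0, x ^ n ≠ 0 := fun x hx => pow_ne_zero _ hx.1.ne'
    have hF1 : ContDiffOn ℝ ((0:ℕ) + 1) F (Ioo 0 ξ0) := by
      refine step F _ 0 dF ?_
      rw [Nat.cast_zero, contDiffOn_zero]
      exact (continuousOn_id.pow n).mul (((hpc q).const_mul _).sub (hσc.mul (hpc s)))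
    have hΦ1 : ContDiffOn ℝ ((0:ℕ) + 1) Φ (Ioo 0 ξ0) := by
      refine step Φ _ 0 dΦ ?_
      rw [Nat.cast_zero, contDiffOn_zero]
      exact (hFc.div (continuousOn_id.pow n) hpn).sub
        ((continuousOn_id.const_mul _).mul (hpc q))
    rw [Nat.cast_zero, zero_add] at hF1 hΦ1
    have hΦ2 : ContDiffOn ℝ ((1:ℕ) + 1) Φ (Ioo 0 ξ0) := by
      refine step Φ _ 1 dΦ ?_
      rw [Nat.cast_one]
      exact (hF1.div hxn hpn).sub
        ((contDiffOn_const.mul contDiffOn_id).mul (hΦ1.rpow_const_of_ne hne))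
    have h2 : (((1:ℕ):WithTop ℕ∞) + 1) = 2 := by norm_num
    rw [h2] at hΦ2
    exact (hΦ2.rpow_const_of_ne hne).congr hf
  · intro ξ hξ
    have hξ1 := hξ.1
    unfold SSODE
    have h2 : deriv (fun x => f x ^ m) =ᶠ[𝓝 ξ] D := by
      filter_upwards [hnb ξ hξ] with x hx using hdfm x hx
    rw [h2.deriv_eq, hdfm ξ hξ, (hfe ξ hξ).deriv_eq, (hΦq ξ hξ).deriv, hf ξ hξ,
      ← Real.rpow_mul (hpos ξ hξ).le, hqp]
    have hDd := ((dF ξ hξ).div (hasDerivAt_pow n ξ) (pow_ne_zero _ hξ1.ne')).sub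
      (((hasDerivAt_id ξ).const_mul (betaC m p σ)).mul (hΦq ξ hξ))
    have hDe : D = ((F / fun x => x ^ n) - (fun y => betaC m p σ * id y) * fun x => Φ x ^ q) := by
      rw [hD]; rfl
    rw [← hDe] at hDd
    rw [hDd.deriv]
    have hDξ : D ξ = F ξ / ξ ^ n - betaC m p σ * ξ * Φ ξ ^ q := by rw [hD]
    generalize D ξ * q * Φ ξ ^ (q - 1) = Y
    rw [hDξ]
    generalize Φ ξ ^ q = X
    generalize Φ ξ ^ s = W
    generalize ξ ^ σ = U
    simp only [id]
    push_cast
    have hpow : (n:ℝ) * ξ ^ (n - 1) = n * ξ ^ n / ξ := by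
      cases n with
      | zero => simp
      | succ j => rw [Nat.add_sub_cancel, pow_succ]; field_simp
    rw [hpow]
    have hz : ξ ^ n ≠ 0 := pow_ne_zero _ hξ1.ne'
    field_simp
    ring
  · refine hI2.congr' ?_
    filter_upwards [Ioo_mem_nhdsLT hξ0] with x hx
    rw [hdfm x hx, hD]

theorem exists_good_profile_any_interface_point (m p σ : ℝ) (N : ℕ) (hm : 1 < m) (hp0 : 0 < p) (hp1 : p < 1)
    (hσ : 2 * (1 - p) / (m - 1) < σ) (hN : 1 ≤ N)
    (hmp : m + p = 2) :
    ∀ ξ0 : ℝ, 0 < ξ0 → ξ0 ≤ xiMax m p σ → ∃ f : ℝ → ℝ, GoodProfile N m p σ f ξ0 := by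
  intro ξ0 hξ0 hmax
  obtain ⟨n, rfl⟩ : ∃ n, N = n + 1 := ⟨N - 1, by omega⟩
  have hp : p = 2 - m := by linarith
  have hm1 : 0 < m - 1 := by linarith
  have hm0 : 0 < m := by linarith
  have hσ2 : 2 < σ := by
    have : 2 * (1 - p) / (m - 1) = 2 := by
      rw [hp]; field_simp; ring
    linarith
  have hσ3 : 0 < σ - 2 := by linarith
  have hL : σ * (m - 1) + 2 * (p - 1) = (m - 1) * (σ - 2) := by rw [hp]; ring
  obtain ⟨β, hβd⟩ : ∃ β, β = betaC m p σ := ⟨_, rfl⟩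
  obtain ⟨α, hαd⟩ : ∃ α, α = alphaC m p σ := ⟨_, rfl⟩
  have hβ1 : β = 2 / (σ - 2) := by
    rw [hβd, betaC, hL, hp]; field_simp; ring
  have hα1 : α = (σ + 2) / ((m - 1) * (σ - 2)) := by
    rw [hαd, alphaC, hL]
  have hβ : 0 < β := by rw [hβ1]; positivity
  have hα : 0 < α := by rw [hα1]; positivity
  have hr : 1 < 1 / (m - 1) := by rw [lt_div_iff₀ hm1]; linarith
  have hq0 : 0 < 1 / m := by positivity
  have hq1 : 1 / m < 1 := by rw [div_lt_one hm0]; exact hm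
  have hs0 : 0 < p / m := by positivity
  have hs1 : p / m ≤ 1 := by rw [div_le_one hm0]; linarith
  obtain ⟨c, hc⟩ : ∃ c, c = α + (n + 1) * β := ⟨_, rfl⟩
  have hcp : 0 < c := by rw [hc]; positivity
  have hb : ∀ ξ, 0 < ξ → ξ < ξ0 →
      ξ ^ σ ≤ (1 / (m - 1)) * β ^ 2 / (4 * (1 / (m - 1) + 1)) * ξ ^ 2 := by
    intro ξ h1 h2
    have e1 : (1 / (m - 1)) * β ^ 2 / (4 * (1 / (m - 1) + 1)) = β ^ 2 / (4 * m) := by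
      have : 1 / (m - 1) + 1 = m / (m - 1) := by field_simp; ring
      rw [this]; field_simp
    rw [e1]
    have e2 : ξ ^ (σ - 2) ≤ β ^ 2 / (4 * m) := by
      have hle : ξ ≤ (β ^ 2 / (4 * m)) ^ (1 / (σ - 2)) := by
        rw [hβd]; exact (h2.le.trans hmax)
      have := Real.rpow_le_rpow h1.le hle hσ3.le
      rwa [← Real.rpow_mul (by positivity), one_div, inv_mul_cancel₀ hσ3.ne', Real.rpow_one] at this
    have e3 : ξ ^ σ = ξ ^ (σ - 2) * ξ ^ 2 := by
      rw [← Real.rpow_natCast, ← Real.rpow_add h1]; congr 1; push_cast; ring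
    rw [e3]
    gcongr
  obtain ⟨Φ, F, M, μ, hμ, hsys⟩ := core_exists n (1 / (m - 1)) (1 / m) (p / m) σ β α c ξ0 hr
    (by field_simp; ring) (by rw [hp]; field_simp; ring) (by linarith) hβ hα hc hξ0 hb
  have dΦ := fun ξ hξ => (hsys ξ hξ).1
  have dF := fun ξ hξ => (hsys ξ hξ).2.1
  have hpos := fun ξ hξ => (hsys ξ hξ).2.2.1
  have hup := fun ξ hξ => (hsys ξ hξ).2.2.2.1
  have hFM := fun ξ hξ => (hsys ξ hξ).2.2.2.2
  obtain ⟨P, hP⟩ : ∃ P, P = (μ / 2 * ξ0 ^ 2) ^ (1 / (m - 1) + 1) := ⟨_, rfl⟩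
  have hPp : 0 < P := by rw [hP]; positivity
  have hΦP : ∀ ξ ∈ Ioo 0 ξ0, Φ ξ ≤ P := by
    intro ξ hξ
    refine (hup ξ hξ).trans ?_
    rw [hP]
    have h1 : 0 ≤ ξ0 ^ 2 - ξ ^ 2 := by nlinarith [hξ.1, hξ.2]
    apply Real.rpow_le_rpow (by positivity) _ (by positivity)
    gcongr
    nlinarith [sq_nonneg ξ]
  have hΦe : ∀ ξ ∈ Ioo 0 ξ0, ∀ e : ℝ, 0 < e → Φ ξ ^ e ≤ P ^ e := fun ξ hξ e he =>
    Real.rpow_le_rpow (hpos ξ hξ).le (hΦP ξ hξ) he.le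
  have hΦn : ∀ ξ ∈ Ioo 0 ξ0, ∀ e : ℝ, 0 ≤ Φ ξ ^ e := fun ξ hξ e =>
    Real.rpow_nonneg (hpos ξ hξ).le e
  obtain ⟨g, hg, hgΦ⟩ := lip_extend Φ _ 0 ξ0 (|M| * ξ0 + β * ξ0 * P ^ (1 / m)) dΦ (by
    intro ξ hξ
    have hξ1 := hξ.1
    have hξ2 := hξ.2
    refine (abs_sub _ _).trans (add_le_add ?_ ?_)
    · rw [abs_div, abs_of_pos (pow_pos hξ1 n), div_le_iff₀ (pow_pos hξ1 n)]
      calc |F ξ| ≤ M * ξ ^ (n + 1) := hFM ξ hξ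
        _ ≤ |M| * ξ ^ (n + 1) := by gcongr; exact le_abs_self M
        _ = |M| * ξ * ξ ^ n := by ring
        _ ≤ |M| * ξ0 * ξ ^ n := by gcongr
    · have := hΦn ξ hξ (1 / m)
      rw [abs_of_nonneg (by positivity)]
      have := hΦe ξ hξ (1 / m) hq0
      gcongr)
  have hlim : Tendsto Φ (𝓝[>] 0) (𝓝 (g 0)) := by
    refine ((hg.tendsto 0).mono_left nhdsWithin_le_nhds).congr' ?_
    filter_upwards [Ioo_mem_nhdsGT hξ0] with x hx using (hgΦ hx).symm
  have hA0 : 0 ≤ g 0 := by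
    apply ge_of_tendsto hlim
    filter_upwards [Ioo_mem_nhdsGT hξ0] with x hx using (hpos x hx).le
  obtain ⟨f, hfd⟩ : ∃ f : ℝ → ℝ, f = fun x => if x ≤ 0 then g 0 ^ (1 / m) else
    if x < ξ0 then Φ x ^ (1 / m) else 0 := ⟨_, rfl⟩
  have hf0 : f 0 = g 0 ^ (1 / m) := by rw [hfd]; simp
  have hfξ0 : f ξ0 = 0 := by rw [hfd]; simp [hξ0]
  have hf : ∀ ξ ∈ Ioo 0 ξ0, f ξ = Φ ξ ^ (1 / m) := by
    intro ξ hξ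
    rw [hfd]
    simp only [not_le.2 hξ.1, hξ.2, if_true, if_false]
  have hprof : ProfileWithInterface (n + 1) m p σ f ξ0 := by
    apply profile_of_system n m p (1 / m) (p / m) σ (1 / (m - 1)) μ (g 0) ξ0
      (ξ0 ^ n * (c * P ^ (1 / m) + ξ0 ^ σ * P ^ (p / m))) Φ F hm rfl rfl hr hξ0 hμ
      (by rw [← hβd]; exact dΦ) (by rw [← hβd, ← hαd, ← hc]; exact dF)
      _ hpos hup hlim f hf0 hfξ0 hf
    rw [← hβd, ← hαd, ← hc]
    intro ξ hξ
    have hξ1 := hξ.1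
    have hξ2 := hξ.2
    have := hΦn ξ hξ (1 / m)
    have := hΦn ξ hξ (p / m)
    have := hΦe ξ hξ (1 / m) hq0
    have := hΦe ξ hξ (p / m) hs0
    rw [abs_mul, abs_of_pos (pow_pos hξ1 n)]
    have h3 : |c * Φ ξ ^ (1 / m) - ξ ^ σ * Φ ξ ^ (p / m)| ≤
        c * P ^ (1 / m) + ξ0 ^ σ * P ^ (p / m) := by
      refine (abs_sub _ _).trans (add_le_add ?_ ?_)
      · rw [abs_of_nonneg (by positivity)]; gcongr
      · rw [abs_of_nonneg (by positivity)]; gcongr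
    gcongr
  refine ⟨f, hprof, ?_⟩
  rcases eq_or_lt_of_le hA0 with h0 | hA
  · right
    rw [← h0] at hlim hf0
    rw [Real.zero_rpow hq0.ne'] at hf0
    obtain ⟨φs, hφsd⟩ : ∃ φs, φs =
      ((m - 1) / (2 * m * (m * ((n + 1 : ℕ) : ℝ) - ((n + 1 : ℕ) : ℝ) + 2))) ^ (m / (m - 1)) :=
        ⟨_, rfl⟩
    have hden : 0 < m * ((n + 1 : ℕ) : ℝ) - ((n + 1 : ℕ) : ℝ) + 2 := by
      have : m * ((n + 1 : ℕ) : ℝ) - ((n + 1 : ℕ) : ℝ) + 2 = (m - 1) * ((n + 1 : ℕ) : ℝ) + 2 := by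
        ring
      rw [this]; positivity
    obtain ⟨R, hR⟩ : ∃ R, R =
      (m - 1) / (2 * m * (m * ((n + 1 : ℕ) : ℝ) - ((n + 1 : ℕ) : ℝ) + 2)) := ⟨_, rfl⟩
    have hRp : 0 < R := by rw [hR]; positivity
    rw [← hR] at hφsd
    have hφsq : φs ^ (1 / m) = R ^ (1 / (m - 1)) := by
      rw [hφsd, ← Real.rpow_mul hRp.le]; congr 1; field_simp
    have hφs1 : φs = R * R ^ (1 / (m - 1)) := by
      rw [hφsd, mul_comm, ← Real.rpow_add_one hRp.ne']; congr 1; field_simp; ring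
    have hφs : 0 < φs := by rw [hφsd]; positivity
    have hz := zero_case n (1 / m) (p / m) σ β c (2 / (m - 1)) ((σ + 2) / (m - p))
      ((σ + 2) / (m - p) * m) ((σ - 2) / 2) ξ0 M φs Φ F hq0 hq1 hs0 hs1 (by linarith) (by ring) hβ
      (by positivity)
      (by
        have : m - p = 2 * (m - 1) := by rw [hp]; ring
        rw [this, div_lt_div_iff₀ hm1 (by positivity)]
        nlinarith)
      (by field_simp; ring)
      (by rw [hp]; field_simp; ring)
      (by field_simp)
      (by
        have : m - p = 2 * (m - 1) := by rw [hp]; ring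
        rw [this, hp]; field_simp; ring)
      (by
        have : m - p = 2 * (m - 1) := by rw [hp]; ring
        rw [this]; field_simp; ring)
      (by
        have : m - p = 2 * (m - 1) := by rw [hp]; ring
        rw [hc, hα1, hβ1, this]; field_simp)
      hξ0 hφs
      (by
        have e0 : m - p = 2 * (m - 1) := by rw [hp]; ring
        have e1 : β * ((σ + 2) / (m - p) - 2 / (m - 1)) = 1 / (m - 1) := by
          rw [e0, hβ1]; field_simp; ring
        rw [hφsq, hφs1, e1]
        have e2 : (n + 1 + 2 / (m - 1)) * (2 / (m - 1) + 2) * R = 1 / (m - 1) := by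
          rw [hR]
          push_cast at hden ⊢
          field_simp
          ring
        rw [← mul_assoc, e2])
      dΦ dF hpos hFM hlim
    have hcg : ∀ e : ℝ, (fun ξ => Φ ξ ^ (1 / m) * ξ ^ e) =ᶠ[𝓝[>] 0] fun ξ => f ξ * ξ ^ e := by
      intro e
      filter_upwards [Ioo_mem_nhdsGT hξ0] with x hx
      rw [hf x hx]
    rcases hz with h2 | ⟨K, hK, h3⟩
    · left
      refine ⟨hf0, ?_⟩
      rw [← hR, ← hφsq]
      exact h2.congr' (hcg _)
    · right
      exact ⟨hf0, K, hK, h3.congr' (hcg _)⟩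
  · left
    refine ⟨by rw [hf0]; positivity, ?_⟩
    have hB := b1_case n (1 / m) (p / m) σ β α c ξ0 M (g 0) Φ F hq0 hq1 (by linarith) hc hξ0 dΦ dF
      hpos hFM hA hlim
    have e1 : (1 - 1 / m) * α / (2 * (n + 1)) =
        alphaC m p σ * (m - 1) / (2 * m * ((n + 1 : ℕ) : ℝ)) := by
      rw [← hαd]; push_cast; field_simp
    rw [e1] at hB
    have e2 : (1 / m) * (m - 1) = 1 - 1 / m := by field_simp
    refine hB.congr' ?_
    filter_upwards [Ioo_mem_nhdsGT hξ0] with x hx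
    rw [hf x hx, hf0, ← Real.rpow_mul (hpos x hx).le, ← Real.rpow_mul hA.le, e2]
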